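/- Let X be a smooth projective variety of dimension g over an algebraically closed field, φ: X → X an étale morphism, and L an ample line bundle on X with φ*(L) ≅ L^{⊗d} for some d > 1. Then the Hilbert polynomial P(L, x) = χ(X, L^{⊗x}) satisfies P(L, dx) = d^g · P(L, x) for all x, and hence P(L, x) = P(L, 1) · x^g. -/

import Mathlib

open AlgebraicGeometry CategoryTheory CategoryTheory.Limits Opposite

noncomputable section

universe u

/-- Restriction of sections of the structure sheaf, as a ring homomorphism. -/
def sres (X : Scheme.{u}) {V W : X.Opens} (h : V ≤ W) : Γ(X, W) →+* Γ(X, V) :=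
  (X.presheaf.map (homOfLE h).op : Γ(X, W) ⟶ Γ(X, V)).hom

lemma sres_sres (X : Scheme.{u}) {V W T : X.Opens} (h₁ : V ≤ W) (h₂ : W ≤ T) (a : Γ(X, T)) :
    sres X h₁ (sres X h₂ a) = sres X (h₁.trans h₂) a := by
  have : (homOfLE (h₁.trans h₂)).op = (homOfLE h₂).op ≫ (homOfLE h₁).op := rfl
  simp only [sres, this, Functor.map_comp]
  rfl

/-- A line bundle (invertible sheaf) on a scheme `X`, presented by an open cover and a
Čech `1`-cocycle of transition units. -/
structure LineBundle (X : Scheme.{u}) where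
  ι : Type u
  U : ι → X.Opens
  covers : iSup U = ⊤
  t : ∀ i j, (Γ(X, U i ⊓ U j))ˣ
  cocycle : ∀ i j l,
    Units.map (sres X (show U i ⊓ U j ⊓ U l ≤ U i ⊓ U j from inf_le_left)).toMonoidHom (t i j)
      * Units.map (sres X (show U i ⊓ U j ⊓ U l ≤ U j ⊓ U l from
          le_inf (inf_le_left.trans inf_le_right) inf_le_right)).toMonoidHom (t j l)
    = Units.map (sres X (show U i ⊓ U j ⊓ U l ≤ U i ⊓ U l from
          le_inf (inf_le_left.trans inf_le_left) inf_le_right)).toMonoidHom (t i l)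

namespace LineBundle

variable {X Y : Scheme.{u}}

/-- The `n`-th tensor power of a line bundle. -/
def pow (L : LineBundle X) (n : ℕ) : LineBundle X where
  ι := L.ι
  U := L.U
  covers := L.covers
  t i j := L.t i j ^ n
  cocycle i j l := by
    simp only [map_pow, ← mul_pow, L.cocycle i j l]

/-- The dual (inverse) of a line bundle. -/
def dual (L : LineBundle X) : LineBundle X where
  ι := L.ι
  U := L.U
  covers := L.covers
  t i j := (L.t i j)⁻¹
  cocycle i j l := by
    simp only [map_inv, ← mul_inv, L.cocycle i j l]

/-- The trivial line bundle. -/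
def trivial (X : Scheme.{u}) : LineBundle X where
  ι := PUnit
  U _ := ⊤
  covers := by simp
  t _ _ := 1
  cocycle _ _ _ := by simp

lemma unit_sres_sres (X : Scheme.{u}) {V W T : X.Opens} (h₁ : V ≤ W) (h₂ : W ≤ T)
    (u : (Γ(X, T))ˣ) :
    Units.map (sres X h₁).toMonoidHom (Units.map (sres X h₂).toMonoidHom u)
      = Units.map (sres X (h₁.trans h₂)).toMonoidHom u := by
  ext
  exact sres_sres X h₁ h₂ u

/-- The tensor product of two line bundles. -/
def tensor (L M : LineBundle X) : LineBundle X where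
  ι := L.ι × M.ι
  U p := L.U p.1 ⊓ M.U p.2
  covers := by
    apply le_antisymm le_top
    have h : (⊤ : X.Opens) = (⨆ i, L.U i) ⊓ ⨆ j, M.U j := by
      rw [L.covers, M.covers, top_inf_eq]
    rw [h, iSup_inf_eq]
    refine iSup_le fun i => ?_
    rw [inf_iSup_eq]
    exact iSup_le fun j => le_iSup_of_le (i, j) le_rfl
  t p q :=
    Units.map (sres X (show (L.U p.1 ⊓ M.U p.2) ⊓ (L.U q.1 ⊓ M.U q.2) ≤ L.U p.1 ⊓ L.U q.1 from
        le_inf (inf_le_left.trans inf_le_left) (inf_le_right.trans inf_le_left))).toMonoidHom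
      (L.t p.1 q.1) *
    Units.map (sres X (show (L.U p.1 ⊓ M.U p.2) ⊓ (L.U q.1 ⊓ M.U q.2) ≤ M.U p.2 ⊓ M.U q.2 from
        le_inf (inf_le_left.trans inf_le_right) (inf_le_right.trans inf_le_right))).toMonoidHom
      (M.t p.2 q.2)
  cocycle p q r := by
    simp only [map_mul, unit_sres_sres]
    have hL := congrArg (Units.map (sres X (show
        (L.U p.1 ⊓ M.U p.2) ⊓ (L.U q.1 ⊓ M.U q.2) ⊓ (L.U r.1 ⊓ M.U r.2) ≤
          L.U p.1 ⊓ L.U q.1 ⊓ L.U r.1 from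
        le_inf (le_inf (inf_le_left.trans (inf_le_left.trans inf_le_left))
          (inf_le_left.trans (inf_le_right.trans inf_le_left)))
          (inf_le_right.trans inf_le_left))).toMonoidHom) (L.cocycle p.1 q.1 r.1)
    have hM := congrArg (Units.map (sres X (show
        (L.U p.1 ⊓ M.U p.2) ⊓ (L.U q.1 ⊓ M.U q.2) ⊓ (L.U r.1 ⊓ M.U r.2) ≤
          M.U p.2 ⊓ M.U q.2 ⊓ M.U r.2 from
        le_inf (le_inf (inf_le_left.trans (inf_le_left.trans inf_le_right))
          (inf_le_left.trans (inf_le_right.trans inf_le_right)))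
          (inf_le_right.trans inf_le_right))).toMonoidHom) (M.cocycle p.2 q.2 r.2)
    simp only [map_mul, unit_sres_sres] at hL hM
    rw [mul_mul_mul_comm, hL, hM]

lemma preimage_mono (f : X ⟶ Y) {U U' : Y.Opens} (h : U ≤ U') : f ⁻¹ᵁ U ≤ f ⁻¹ᵁ U' :=
  fun _ hx => h hx

lemma unit_sres_appLE (f : X ⟶ Y) {U : Y.Opens} {V V' : X.Opens} (e : V ≤ f ⁻¹ᵁ U)
    (h : V' ≤ V) (u : (Γ(Y, U))ˣ) :
    Units.map (sres X h).toMonoidHom (Units.map (f.appLE U V e).hom.toMonoidHom u)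
      = Units.map (f.appLE U V' (h.trans e)).hom.toMonoidHom u := by
  ext
  show sres X h (f.appLE U V e u) = f.appLE U V' (h.trans e) u
  rw [show f.appLE U V' (h.trans e)
      = f.appLE U V e ≫ X.presheaf.map (homOfLE h).op from (f.appLE_map e (homOfLE h).op).symm]
  rfl

lemma unit_appLE_sres (f : X ⟶ Y) {U U' : Y.Opens} {V : X.Opens} (e : V ≤ f ⁻¹ᵁ U)
    (h : U ≤ U') (u : (Γ(Y, U'))ˣ) :
    Units.map (f.appLE U V e).hom.toMonoidHom (Units.map (sres Y h).toMonoidHom u)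
      = Units.map (f.appLE U' V (e.trans (preimage_mono f h))).hom.toMonoidHom u := by
  ext
  show f.appLE U V e (sres Y h u) = f.appLE U' V _ u
  rw [show f.appLE U' V (e.trans (preimage_mono f h))
      = Y.presheaf.map (homOfLE h).op ≫ f.appLE U V e from (f.map_appLE e (homOfLE h).op).symm]
  rfl

lemma preimage_inf (f : X ⟶ Y) (U V : Y.Opens) :
    f ⁻¹ᵁ (U ⊓ V) = f ⁻¹ᵁ U ⊓ f ⁻¹ᵁ V := by
  ext x; simp

set_option maxHeartbeats 1000000 in
/-- The pullback of a line bundle along a morphism of schemes. -/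
def pullbackLB (f : X ⟶ Y) (L : LineBundle Y) : LineBundle X where
  ι := L.ι
  U i := f ⁻¹ᵁ L.U i
  covers := by
    have : (⨆ i, f ⁻¹ᵁ L.U i) = f ⁻¹ᵁ (⨆ i, L.U i) := by
      ext x
      simp [TopologicalSpace.Opens.mem_iSup]
    rw [this, L.covers]
    rfl
  t i j :=
    Units.map (f.appLE (L.U i ⊓ L.U j) (f ⁻¹ᵁ L.U i ⊓ f ⁻¹ᵁ L.U j)
      (preimage_inf f (L.U i) (L.U j)).ge).hom.toMonoidHom (L.t i j)
  cocycle i j l := by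
    have key := congrArg (Units.map (f.appLE (L.U i ⊓ L.U j ⊓ L.U l)
        (f ⁻¹ᵁ L.U i ⊓ f ⁻¹ᵁ L.U j ⊓ f ⁻¹ᵁ L.U l)
        (le_of_eq (show f ⁻¹ᵁ L.U i ⊓ f ⁻¹ᵁ L.U j ⊓ f ⁻¹ᵁ L.U l
            = f ⁻¹ᵁ (L.U i ⊓ L.U j ⊓ L.U l) by
          rw [preimage_inf, preimage_inf]))).hom.toMonoidHom)
      (L.cocycle i j l)
    rw [map_mul] at key
    rw [unit_sres_appLE, unit_sres_appLE, unit_sres_appLE]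
    rw [unit_appLE_sres, unit_appLE_sres, unit_appLE_sres] at key
    exact key

/-- A global section of a line bundle: compatible local sections with respect to the
transition cocycle. -/
@[ext]
structure GlobalSec {X : Scheme.{u}} (L : LineBundle X) where
  s : ∀ i, Γ(X, L.U i)
  compat : ∀ i j, sres X (inf_le_left : L.U i ⊓ L.U j ≤ L.U i) (s i)
    = (L.t i j : Γ(X, L.U i ⊓ L.U j)) * sres X inf_le_right (s j)

/-- The open locus where a global section of a line bundle does not vanish. -/
def GlobalSec.locus {X : Scheme.{u}} {L : LineBundle X} (σ : GlobalSec L) : X.Opens :=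
  ⨆ i, X.basicOpen (σ.s i)

/-- A line bundle `L` on a scheme `X` is ample if `X` is quasi-compact and every point has
an affine neighbourhood of the form `X_s` for a global section `s` of some positive tensor
power of `L`. -/
def IsAmple {X : Scheme.{u}} (L : LineBundle X) : Prop :=
  CompactSpace X ∧ ∀ x : X, ∃ (m : ℕ) (_ : 0 < m) (σ : GlobalSec (L.pow m)),
    x ∈ σ.locus ∧ IsAffineOpen σ.locus

/-- Two line bundles are isomorphic iff on a common refinement of their trivialising covers
their transition cocycles differ by a coboundary. -/
def EquivLB {X : Scheme.{u}} (L M : LineBundle X) : Prop :=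
  ∃ (κ : Type u) (V : κ → X.Opens) (_ : iSup V = ⊤) (a : κ → L.ι) (b : κ → M.ι)
    (ha : ∀ c, V c ≤ L.U (a c)) (hb : ∀ c, V c ≤ M.U (b c)) (s : ∀ c, (Γ(X, V c))ˣ),
    ∀ c c' : κ,
      Units.map (sres X (le_inf ((inf_le_left.trans (ha c)))
          (inf_le_right.trans (ha c')) : V c ⊓ V c' ≤ L.U (a c) ⊓ L.U (a c'))).toMonoidHom
          (L.t (a c) (a c'))
        * Units.map (sres X (inf_le_right : V c ⊓ V c' ≤ V c')).toMonoidHom (s c')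
      = Units.map (sres X (inf_le_left : V c ⊓ V c' ≤ V c)).toMonoidHom (s c)
        * Units.map (sres X (le_inf ((inf_le_left.trans (hb c)))
            (inf_le_right.trans (hb c')))).toMonoidHom (M.t (b c) (b c'))

/-- The canonical algebra map `k → Γ(X, U)` for a scheme `X` over `Spec k`. -/
def toSections {k : Type u} [Field k] {X : Scheme.{u}} (sX : X ⟶ Spec (CommRingCat.of k))
    (U : X.Opens) : k →+* Γ(X, U) :=
  ((sres X (le_top : U ≤ ⊤)).comp
    ((sX.appTop.hom : Γ(Spec (CommRingCat.of k), ⊤) →+* Γ(X, ⊤)))).comp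
    ((Scheme.ΓSpecIso (CommRingCat.of k)).inv : CommRingCat.of k ⟶ _).hom

lemma sres_toSections {k : Type u} [Field k] {X : Scheme.{u}}
    (sX : X ⟶ Spec (CommRingCat.of k)) {V U : X.Opens} (h : V ≤ U) (c : k) :
    sres X h (toSections sX U c) = toSections sX V c := by
  simp only [toSections, RingHom.comp_apply, sres_sres]

/-- The space of global sections of a line bundle on a scheme over `k`, as a `k`-submodule
of the product of the local section spaces. -/
def secSubmodule {k : Type u} [Field k] {X : Scheme.{u}} (sX : X ⟶ Spec (CommRingCat.of k))
    (L : LineBundle X) :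
    letI : ∀ i, Module k Γ(X, L.U i) := fun i => (toSections sX (L.U i)).toModule
    Submodule k (∀ i, Γ(X, L.U i)) :=
  letI : ∀ i, Module k Γ(X, L.U i) := fun i => (toSections sX (L.U i)).toModule
  { carrier := {s | ∀ i j, sres X (inf_le_left : L.U i ⊓ L.U j ≤ L.U i) (s i)
      = (L.t i j : Γ(X, L.U i ⊓ L.U j)) * sres X inf_le_right (s j)}
    add_mem' := by
      intro s r hs hr i j
      simp only [Pi.add_apply, map_add, hs i j, hr i j, mul_add]
    zero_mem' := by
      intro i j
      simp
    smul_mem' := by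
      intro c s hs i j
      show sres X _ (toSections sX (L.U i) c * s i)
        = (L.t i j : Γ(X, L.U i ⊓ L.U j)) * sres X _ (toSections sX (L.U j) c * s j)
      rw [map_mul, map_mul, hs i j, sres_toSections, sres_toSections]
      ring }

/-- The dimension `h⁰(X, L)` of the space of global sections of a line bundle on a scheme
over a field `k`. -/
def h0 {k : Type u} [Field k] {X : Scheme.{u}} (sX : X ⟶ Spec (CommRingCat.of k))
    (L : LineBundle X) : ℕ :=
  letI : ∀ i, Module k Γ(X, L.U i) := fun i => (toSections sX (L.U i)).toModule
  Module.finrank k (secSubmodule sX L)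

lemma sres_appLE (f : X ⟶ Y) {U : Y.Opens} {V V' : X.Opens} (e : V ≤ f ⁻¹ᵁ U)
    (h : V' ≤ V) (a : Γ(Y, U)) :
    sres X h (f.appLE U V e a) = f.appLE U V' (h.trans e) a := by
  rw [show f.appLE U V' (h.trans e)
      = f.appLE U V e ≫ X.presheaf.map (homOfLE h).op from (f.appLE_map e (homOfLE h).op).symm]
  rfl

lemma appLE_sres (f : X ⟶ Y) {U U' : Y.Opens} {V : X.Opens} (e : V ≤ f ⁻¹ᵁ U)
    (h : U ≤ U') (a : Γ(Y, U')) :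
    f.appLE U V e (sres Y h a) = f.appLE U' V (e.trans (preimage_mono f h)) a := by
  rw [show f.appLE U' V (e.trans (preimage_mono f h))
      = Y.presheaf.map (homOfLE h).op ≫ f.appLE U V e from (f.map_appLE e (homOfLE h).op).symm]
  rfl

/-- Pullback of global sections of a line bundle. -/
def pullbackSec (f : X ⟶ Y) (L : LineBundle Y) (σ : GlobalSec L) :
    GlobalSec (pullbackLB f L) where
  s i := f.app (L.U i) (σ.s i)
  compat i j := by
    have key := congrArg (f.appLE (L.U i ⊓ L.U j)
      (f ⁻¹ᵁ L.U i ⊓ f ⁻¹ᵁ L.U j) (preimage_inf f (L.U i) (L.U j)).ge) (σ.compat i j)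
    rw [map_mul, appLE_sres, appLE_sres] at key
    exact key

end LineBundle

attribute [local instance] MvPolynomial.gradedAlgebra

/-- Projective `N`-space over `k`, as the `Proj` of the polynomial ring in `N + 1`
variables with its standard grading. -/
def ProjSpace (k : Type u) [Field k] (N : ℕ) : Scheme.{u} :=
  Proj (MvPolynomial.homogeneousSubmodule (Fin (N + 1)) k)

/-- The inclusion of `k` into the degree-zero part of the polynomial ring. -/
def degreeZeroInclusion (k : Type u) [Field k] (N : ℕ) :
    k →+* (MvPolynomial.homogeneousSubmodule (Fin (N + 1)) k 0) where
  toFun c := ⟨MvPolynomial.C c, by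
    simp [MvPolynomial.mem_homogeneousSubmodule, MvPolynomial.isHomogeneous_C]⟩
  map_one' := by ext; simp
  map_mul' x y := by ext; simp
  map_zero' := by ext; simp
  map_add' x y := by ext; simp

/-- The structure morphism of projective space over `k`. -/
def ProjSpace.str (k : Type u) [Field k] (N : ℕ) :
    ProjSpace k N ⟶ Spec (CommRingCat.of k) :=
  Proj.toSpecZero _ ≫ Spec.map (CommRingCat.ofHom (degreeZeroInclusion k N))

/-- A scheme over `k` is a projective variety if it is integral and admits a closed
immersion into some projective space over `k`, compatibly with the structure morphisms. -/
def IsProjectiveVariety {k : Type u} [Field k] {X : Scheme.{u}}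
    (sX : X ⟶ Spec (CommRingCat.of k)) : Prop :=
  IsIntegral X ∧ ∃ (N : ℕ) (ι : X ⟶ ProjSpace k N),
    IsClosedImmersion ι ∧ ι ≫ ProjSpace.str k N = sX
set_option maxHeartbeats 2000000 in
open LineBundle in
/-- `ω` is a canonical line bundle on the `g`-dimensional smooth variety `X` over `k`:
on its trivialising cover the module of Kähler differentials is free of rank `g`, and the
transition cocycle of `ω` is given by the determinants of the base-change matrices of the
corresponding bases of differentials, i.e. `ω ≅ det Ω¹_{X/k}`. -/
def IsCanonicalBundle {k : Type u} [Field k] {X : Scheme.{u}}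
    (sX : X ⟶ Spec (CommRingCat.of k)) (g : ℕ) (ω : LineBundle X) : Prop :=
  letI : ∀ U : X.Opens, Algebra k Γ(X, U) := fun U => (toSections sX U).toAlgebra
  ∃ e : ∀ i : ω.ι, Module.Basis (Fin g) Γ(X, ω.U i) (Ω[Γ(X, ω.U i)⁄k]),
    ∀ i j : ω.ι,
      letI : Algebra Γ(X, ω.U i) Γ(X, ω.U i ⊓ ω.U j) :=
        (sres X (inf_le_left : ω.U i ⊓ ω.U j ≤ ω.U i)).toAlgebra
      letI : Algebra Γ(X, ω.U j) Γ(X, ω.U i ⊓ ω.U j) :=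
        (sres X (inf_le_right : ω.U i ⊓ ω.U j ≤ ω.U j)).toAlgebra
      haveI : IsScalarTower k Γ(X, ω.U i) Γ(X, ω.U i ⊓ ω.U j) :=
        IsScalarTower.of_algebraMap_eq fun c => (sres_toSections sX _ c).symm
      haveI : IsScalarTower k Γ(X, ω.U j) Γ(X, ω.U i ⊓ ω.U j) :=
        IsScalarTower.of_algebraMap_eq fun c => (sres_toSections sX _ c).symm
      haveI : SMulCommClass k Γ(X, ω.U i) Γ(X, ω.U i ⊓ ω.U j) :=
        ⟨fun c a b => by
          simp only [Algebra.smul_def, ← mul_assoc, mul_comm]⟩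
      haveI : SMulCommClass k Γ(X, ω.U j) Γ(X, ω.U i ⊓ ω.U j) :=
        ⟨fun c a b => by
          simp only [Algebra.smul_def, ← mul_assoc, mul_comm]⟩
      ∃ M : Matrix (Fin g) (Fin g) Γ(X, ω.U i ⊓ ω.U j),
        (∀ a : Fin g,
          KaehlerDifferential.map k k Γ(X, ω.U j) Γ(X, ω.U i ⊓ ω.U j) (e j a)
            = ∑ b : Fin g, M a b •
              KaehlerDifferential.map k k Γ(X, ω.U i) Γ(X, ω.U i ⊓ ω.U j) (e i b)) ∧
        (ω.t i j : Γ(X, ω.U i ⊓ ω.U j)) = M.det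

/-- A self-map of an integral scheme is separable if it fixes the generic point and the
induced extension of function fields is separable. -/
def IsSeparableSelfMap {X : Scheme.{u}} [IsIntegral X] (φ : X ⟶ X) : Prop :=
  ∃ h : φ.base (genericPoint X) = genericPoint X,
    letI E : X.functionField ⟶ X.functionField :=
      (X.presheaf.stalkCongr (Inseparable.of_eq h.symm)).hom ≫ φ.stalkMap (genericPoint X)
    letI : Algebra X.functionField X.functionField := (E.hom : _ →+* _).toAlgebra
    Algebra.IsSeparable X.functionField X.functionField

/-- The Hilbert polynomial of an (ample) line bundle `L` on a scheme over `k`: a polynomial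
whose values at all large integers `n` equal `h⁰(X, L^{⊗n})` (which for ample `L` agrees
with the Euler characteristic `χ(X, L^{⊗n})` for large `n`). -/
def IsHilbertPoly {k : Type u} [Field k] {X : Scheme.{u}}
    (sX : X ⟶ Spec (CommRingCat.of k)) (L : LineBundle X) (P : Polynomial ℚ) : Prop :=
  ∃ n₀ : ℕ, ∀ n : ℕ, n₀ ≤ n → P.eval (n : ℚ) = (LineBundle.h0 sX (L.pow n) : ℚ)

universe v

section

open Polynomial Filter TensorProduct

/-- A grading of a `k`-algebra by the natural numbers, presented as a coaction of the
multiplicative monoid: a homogeneous element `a` of degree `n` satisfies `coact a = a X ^ n`. -/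
structure PolyGrading (k A : Type*) [Field k] [CommRing A] [Algebra k A] where
  coact : A →ₐ[k] A[X]
  eval_one : ∀ a, (coact a).eval 1 = a
  coact_coeff : ∀ a n, coact ((coact a).coeff n) = monomial n ((coact a).coeff n)

namespace PolyGrading

section Basic

variable {k A M : Type*} [Field k] [CommRing A] [Algebra k A] [CommRing M] [Algebra k M]
  [Algebra A M] (G : PolyGrading k A) (H : PolyGrading k M)

/-- The homogeneous component of degree `n`. -/
def comp (n : ℕ) : A →ₗ[k] A where
  toFun a := (G.coact a).coeff n
  map_add' := by simp
  map_smul' := by simp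

/-- The subspace of homogeneous elements of degree `n`. -/
def deg (n : ℕ) : Submodule k A where
  carrier := {a | G.coact a = monomial n a}
  add_mem' := by
    intro a b ha hb
    have ha' : G.coact a = monomial n a := ha
    have hb' : G.coact b = monomial n b := hb
    change G.coact (a + b) = monomial n (a + b)
    rw [map_add, ha', hb', map_add]
  zero_mem' := by simp
  smul_mem' := by
    intro c a ha
    have ha' : G.coact a = monomial n a := ha
    change G.coact (c • a) = monomial n (c • a)
    rw [map_smul, ha', smul_monomial]

lemma mem_deg {n : ℕ} {a : A} : a ∈ G.deg n ↔ G.coact a = monomial n a := Iff.rfl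

lemma comp_mem_deg (n : ℕ) (a : A) : G.comp n a ∈ G.deg n := G.coact_coeff a n

lemma comp_of_mem {n : ℕ} {a : A} (ha : a ∈ G.deg n) : G.comp n a = a := by
  change (G.coact a).coeff n = a
  rw [G.mem_deg.1 ha]; simp

lemma comp_of_mem_ne {n m : ℕ} {a : A} (ha : a ∈ G.deg n) (h : n ≠ m) : G.comp m a = 0 := by
  change (G.coact a).coeff m = 0
  rw [G.mem_deg.1 ha, coeff_monomial_of_ne _ h.symm]

lemma sum_comp (a : A) : ∑ n ∈ (G.coact a).support, G.comp n a = a := by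
  conv_rhs => rw [← G.eval_one a, eval_eq_sum, Polynomial.sum]
  simp [comp]

lemma mul_mem_deg {n m : ℕ} {a b : A} (ha : a ∈ G.deg n) (hb : b ∈ G.deg m) :
    a * b ∈ G.deg (n + m) := by
  rw [mem_deg] at *
  simp [ha, hb, monomial_mul_monomial]

lemma one_mem_deg : (1 : A) ∈ G.deg 0 := by
  rw [mem_deg]; simp

lemma pow_mem_deg {n : ℕ} {a : A} (ha : a ∈ G.deg n) (m : ℕ) : a ^ m ∈ G.deg (m * n) := by
  induction m with
  | zero => simpa using G.one_mem_deg
  | succ m ih =>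
    rw [pow_succ, Nat.succ_mul]
    exact G.mul_mem_deg ih ha

/-- A subspace is homogeneous when it contains the components of its elements. -/
def Homog (N : Submodule k A) : Prop := ∀ a ∈ N, ∀ n, G.comp n a ∈ N

/-- The structure map of a graded algebra. -/
def Compat : Prop := ∀ a : A, H.coact (algebraMap A M a) = (G.coact a).map (algebraMap A M)

lemma compat_self : G.Compat G := fun a => by simp

variable {G H}

lemma Compat.algebraMap_mem (h : G.Compat H) {n : ℕ} {a : A} (ha : a ∈ G.deg n) :
    algebraMap A M a ∈ H.deg n := by
  rw [mem_deg, h a, G.mem_deg.1 ha, map_monomial]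

lemma Compat.comp_algebraMap (h : G.Compat H) (n : ℕ) (a : A) :
    H.comp n (algebraMap A M a) = algebraMap A M (G.comp n a) := by
  change (H.coact _).coeff n = _
  rw [h a, coeff_map]; rfl

lemma Compat.smul_mem (h : G.Compat H) {n m : ℕ} {a : A} {y : M} (ha : a ∈ G.deg n)
    (hy : y ∈ H.deg m) : a • y ∈ H.deg (n + m) := by
  rw [Algebra.smul_def]
  exact H.mul_mem_deg (h.algebraMap_mem ha) hy

lemma Compat.comp_smul (h : G.Compat H) {e : ℕ} (n : ℕ) (a : A) {y : M} (hy : y ∈ H.deg e) :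
    H.comp (n + e) (a • y) = G.comp n a • y := by
  change (H.coact _).coeff _ = _
  rw [Algebra.smul_def, map_mul, h a, H.mem_deg.1 hy, coeff_mul_monomial, coeff_map,
    Algebra.smul_def]; rfl

lemma Compat.comp_smul_of_lt (h : G.Compat H) {e : ℕ} {n : ℕ} (hn : n < e) (a : A) {y : M}
    (hy : y ∈ H.deg e) : H.comp n (a • y) = 0 := by
  change (H.coact _).coeff _ = _
  rw [Algebra.smul_def, map_mul, h a, H.mem_deg.1 hy, ← C_mul_X_pow_eq_monomial, ← mul_assoc,
    coeff_mul_X_pow', if_neg (by lia)]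

variable (G H)

lemma homog_top : G.Homog ⊤ := fun _ _ _ => trivial

lemma homog_bot : G.Homog ⊥ := fun a ha n => by
  rw [Submodule.mem_bot] at ha; simp [ha]

variable {G H} in
lemma Homog.sup {N N' : Submodule k A} (h : G.Homog N) (h' : G.Homog N') : G.Homog (N ⊔ N') := by
  intro a ha n
  obtain ⟨x, hx, y, hy, rfl⟩ := Submodule.mem_sup.1 ha
  rw [map_add]
  exact Submodule.add_mem_sup (h x hx n) (h' y hy n)

variable {G H} in
lemma Homog.inf {N N' : Submodule k A} (h : G.Homog N) (h' : G.Homog N') : G.Homog (N ⊓ N') :=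
  fun a ha n => ⟨h a ha.1 n, h' a ha.2 n⟩

lemma homog_span [IsScalarTower k A M] (h : G.Compat H) (S : Set M)
    (hS : ∀ y ∈ S, ∃ e, y ∈ H.deg e) :
    H.Homog ((Submodule.span A S).restrictScalars k) := by
  intro a ha n
  rw [Submodule.restrictScalars_mem] at *
  obtain ⟨m, c, y, rfl⟩ := Submodule.mem_span_set'.1 ha
  rw [map_sum]
  refine sum_mem fun i _ => ?_
  obtain ⟨e, he⟩ := hS _ (y i).2
  by_cases hne : n < e
  · rw [h.comp_smul_of_lt hne _ he]; exact zero_mem _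
  · obtain ⟨d, rfl⟩ := Nat.exists_eq_add_of_le' (not_lt.1 hne)
    rw [h.comp_smul _ _ he]
    exact Submodule.smul_mem _ _ (Submodule.subset_span (y i).2)

variable {G H}

lemma Homog.span_homog [IsScalarTower k A M] {N : Submodule A M}
    (hN : H.Homog (N.restrictScalars k)) :
    Submodule.span A {x | x ∈ N ∧ ∃ e, x ∈ H.deg e} = N := by
  refine le_antisymm (Submodule.span_le.2 fun x hx => hx.1) fun x hx => ?_
  rw [← H.sum_comp x]
  exact sum_mem fun n _ => Submodule.subset_span ⟨hN x hx n, n, H.comp_mem_deg n x⟩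

lemma Homog.exists_gens [IsScalarTower k A M] {N : Submodule A M}
    (hN : H.Homog (N.restrictScalars k)) (hfg : N.FG) :
    ∃ (s : Finset M) (e : M → ℕ), (∀ y ∈ s, y ∈ H.deg (e y)) ∧ Submodule.span A (s : Set M) = N := by
  rw [← hN.span_homog] at hfg
  obtain ⟨s, hs, hs'⟩ := Submodule.fg_span_iff_fg_span_finset_subset _ |>.1 hfg
  have : ∀ y : M, ∃ e, y ∈ s → y ∈ H.deg e := fun y => by
    by_cases hy : y ∈ s
    · obtain ⟨e, he⟩ := (hs hy).2
      exact ⟨e, fun _ => he⟩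
    · exact ⟨0, fun h => absurd h hy⟩
  choose e he using this
  exact ⟨s, e, fun y hy => he y hy, by rw [← hs', hN.span_homog]⟩

lemma Compat.exists_coeffs (h : G.Compat H) {s : Finset M} {e : M → ℕ}
    (he : ∀ y ∈ s, y ∈ H.deg (e y)) {n : ℕ} {x : M} (hx : x ∈ H.deg n)
    (hxs : x ∈ Submodule.span A (s : Set M)) :
    ∃ c : M → A, (∀ y, c y ∈ G.deg (n - e y)) ∧ (∀ y, n < e y → c y = 0) ∧
      x = ∑ y ∈ s, c y • y := by
  obtain ⟨f, -, rfl⟩ := Submodule.mem_span_finset.1 hxs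
  refine ⟨fun y => if n < e y then 0 else G.comp (n - e y) (f y), fun y => ?_, fun y hy => ?_, ?_⟩
  · dsimp only
    split_ifs
    · exact zero_mem _
    · exact G.comp_mem_deg _ _
  · simp [hy]
  · rw [← H.comp_of_mem hx, map_sum]
    refine Finset.sum_congr rfl fun y hy => ?_
    dsimp only
    split_ifs with hn
    · rw [h.comp_smul_of_lt hn _ (he y hy), zero_smul]
    · conv_lhs => rw [← Nat.sub_add_cancel (not_lt.1 hn)]
      rw [h.comp_smul _ _ (he y hy)]

end Basic

section Good

variable {k A M : Type*} [Field k] [CommRing A] [Algebra k A] [CommRing M] [Algebra k M]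
  [Algebra A M] [IsScalarTower k A M] {G : PolyGrading k A} {H : PolyGrading k M}

/-- Degree one elements generating the algebra up to finite length, and powers of which generate
the unit ideal in large degrees. -/
structure Good {s : ℕ} (G : PolyGrading k A) (f : Fin s → A) : Prop where
  mem : ∀ i, f i ∈ G.deg 1
  finite : ∀ n, FiniteDimensional k (G.deg n)
  eventually : ∀ K : ℕ, ∀ᶠ n in atTop, ∀ a ∈ G.deg n,
    a ∈ Ideal.span (Set.range fun i => f i ^ K)

lemma Good.map {s : ℕ} {f : Fin s → A} (hf : G.Good f) (h : G.Compat H) [Module.Finite A M] :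
    H.Good (fun i => algebraMap A M (f i)) := by
  obtain ⟨t, e, he, ht⟩ := (H.homog_top : H.Homog ((⊤ : Submodule A M).restrictScalars k)).exists_gens
    (Module.Finite.fg_top (R := A) (M := M))
  refine ⟨fun i => h.algebraMap_mem (hf.mem i), fun n => ?_, fun K => ?_⟩
  · have := hf.finite
    let φ : (∀ y : t, G.deg (n - e y)) →ₗ[k] M :=
      { toFun := fun c => ∑ y, (c y : A) • (y : M)
        map_add' := fun c d => by simp [add_smul, Finset.sum_add_distrib]
        map_smul' := fun r c => by simp [Finset.smul_sum] }
    have hle : H.deg n ≤ LinearMap.range φ := by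
      intro x hx
      obtain ⟨c, hc, -, hx⟩ := h.exists_coeffs he hx (ht ▸ Submodule.mem_top)
      refine ⟨fun y => ⟨c y, hc y⟩, ?_⟩
      rw [hx, ← Finset.sum_coe_sort]; rfl
    exact Submodule.finiteDimensional_of_le hle
  · obtain ⟨n₀, hn₀⟩ := eventually_atTop.1 (hf.eventually K)
    refine eventually_atTop.2 ⟨n₀ + t.sup e, fun n hn x hx => ?_⟩
    obtain ⟨c, hc, -, hx⟩ := h.exists_coeffs he hx (ht ▸ Submodule.mem_top)
    rw [hx]
    refine sum_mem fun y hy => ?_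
    rw [Algebra.smul_def]
    refine Ideal.mul_mem_right _ _ ?_
    have hy' := Finset.le_sup (f := e) hy
    have := Ideal.mem_map_of_mem (algebraMap A M) (hn₀ (n - e y) (by lia) _ (hc y))
    rw [Ideal.map_span, ← Set.range_comp] at this
    convert this using 3
    ext i; simp

/-- Submodules that agree after inverting each `f i` have the same elements in large degrees. -/
lemma Good.eventually_mem {s : ℕ} {f : Fin s → A} (hf : G.Good f) (h : G.Compat H)
    [IsNoetherianRing A] [Module.Finite A M] {N N' : Submodule A M}
    (hN' : H.Homog (N'.restrictScalars k))
    (hNN' : ∀ y ∈ N', ∀ i, ∃ K : ℕ, f i ^ K • y ∈ N) :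
    ∀ᶠ n in atTop, ∀ x ∈ H.deg n, x ∈ N' → x ∈ N := by
  have : IsNoetherian A M := isNoetherian_of_isNoetherianRing_of_finite A M
  obtain ⟨t, e, he, ht⟩ := hN'.exists_gens (IsNoetherian.noetherian N')
  have htN : ∀ y ∈ t, y ∈ N' := fun y hy => ht ▸ Submodule.subset_span hy
  have : ∀ y : M, ∀ i, ∃ K : ℕ, y ∈ t → f i ^ K • y ∈ N := fun y i => by
    by_cases hy : y ∈ t
    · obtain ⟨K, hK⟩ := hNN' y (htN y hy) i
      exact ⟨K, fun _ => hK⟩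
    · exact ⟨0, fun h => absurd h hy⟩
  choose K hK using this
  set K₀ := t.sup fun y => Finset.univ.sup (K y) with hK₀
  have hKle : ∀ y ∈ t, ∀ i, K y i ≤ K₀ := fun y hy i =>
    (Finset.le_sup (f := K y) (Finset.mem_univ i)).trans
      (Finset.le_sup (f := fun y => Finset.univ.sup (K y)) hy)
  obtain ⟨n₀, hn₀⟩ := eventually_atTop.1 (hf.eventually K₀)
  refine eventually_atTop.2 ⟨n₀ + t.sup e, fun n hn x hx hxN => ?_⟩
  obtain ⟨c, hc, -, hx⟩ := h.exists_coeffs he hx (ht ▸ hxN)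
  rw [hx]
  refine sum_mem fun y hy => ?_
  have hy' := Finset.le_sup (f := e) hy
  have hcy := hn₀ (n - e y) (by lia) _ (hc y)
  have hle : Ideal.span (Set.range fun i => f i ^ K₀) ≤ N.comap (LinearMap.toSpanSingleton A M y) := by
    rw [Ideal.span_le]
    rintro _ ⟨i, rfl⟩
    change f i ^ K₀ • y ∈ N
    rw [← Nat.sub_add_cancel (hKle y hy i), pow_add, mul_smul]
    exact N.smul_mem _ (hK y i hy)
  exact hle hcy

end Good

section Hilb

variable {k A M : Type*} [Field k] [CommRing A] [Algebra k A] [CommRing M] [Algebra k M]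
  [Algebra A M] [IsScalarTower k A M] {G : PolyGrading k A} {H : PolyGrading k M}

/-- The Hilbert function of the quotient of a graded algebra by a subspace. -/
def hilb (G : PolyGrading k A) (N : Submodule k A) (n : ℕ) : ℤ :=
  (Module.finrank k (G.deg n) : ℤ) - Module.finrank k (G.deg n ⊓ N : Submodule k A)

lemma hilb_congr {N N' : Submodule k A} {n : ℕ} (h : ∀ x ∈ G.deg n, x ∈ N ↔ x ∈ N') :
    G.hilb N n = G.hilb N' n := by
  have : G.deg n ⊓ N = G.deg n ⊓ N' := by
    ext x; simp only [Submodule.mem_inf]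
    exact and_congr_right (h x)
  rw [hilb, hilb, this]

lemma hilb_eq_zero {N : Submodule k A} {n : ℕ} (h : ∀ x ∈ G.deg n, x ∈ N) :
    G.hilb N n = 0 := by
  rw [hilb, inf_eq_left.2 h, sub_self]

/-- The Hilbert function along the exact sequence
`0 → A / (N : y) → M / N → M / (N + A y) → 0`. -/
lemma Compat.hilb_step (h : G.Compat H) (hG : ∀ n, FiniteDimensional k (G.deg n))
    (hH : ∀ n, FiniteDimensional k (H.deg n)) {N : Submodule A M}
    (hN : H.Homog (N.restrictScalars k)) {e : ℕ} {y : M} (hy : y ∈ H.deg e) {n : ℕ} :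
    H.hilb (N.restrictScalars k) (n + e) =
      H.hilb ((N ⊔ Submodule.span A {y}).restrictScalars k) (n + e) +
      G.hilb ((N.comap (LinearMap.toSpanSingleton A M y)).restrictScalars k) n := by
  have := hG n
  have := hH (n + e)
  set P := H.deg (n + e) ⊓ N.restrictScalars k with hP
  set Q := H.deg (n + e) ⊓ (N ⊔ Submodule.span A {y}).restrictScalars k with hQ
  let φ : G.deg n →ₗ[k] M := ((LinearMap.toSpanSingleton A M y).restrictScalars k).comp (G.deg n).subtype
  have hφ : ∀ a, φ a = (a : A) • y := fun a => rfl
  have hQP : Q = P ⊔ LinearMap.range φ := by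
    apply le_antisymm
    · rintro x ⟨hx, hx'⟩
      rw [SetLike.mem_coe, Submodule.restrictScalars_mem] at hx'
      obtain ⟨u, hu, v, hv, rfl⟩ := Submodule.mem_sup.1 hx'
      obtain ⟨a, rfl⟩ := Submodule.mem_span_singleton.1 hv
      rw [← H.comp_of_mem hx, map_add, h.comp_smul _ _ hy]
      exact Submodule.add_mem_sup ⟨H.comp_mem_deg _ _, hN u hu _⟩ ⟨⟨_, G.comp_mem_deg n a⟩, rfl⟩
    · refine sup_le ?_ ?_
      · exact fun x hx => ⟨hx.1, (le_sup_left : N ≤ N ⊔ Submodule.span A {y}) hx.2⟩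
      · rintro _ ⟨a, rfl⟩
        exact ⟨h.smul_mem a.2 hy, (le_sup_right : _ ≤ N ⊔ Submodule.span A {y})
          (Submodule.smul_mem _ _ (Submodule.mem_span_singleton_self y))⟩
  have : FiniteDimensional k P := Submodule.finiteDimensional_inf_left _ _
  have e1 : Module.finrank k Q + Module.finrank k (P ⊓ LinearMap.range φ : Submodule k M)
      = Module.finrank k P + Module.finrank k (LinearMap.range φ) := by
    rw [hQP]; exact Submodule.finrank_sup_add_finrank_inf_eq _ _
  have e2 := LinearMap.finrank_range_add_finrank_ker φ
  set S := G.deg n ⊓ (N.comap (LinearMap.toSpanSingleton A M y)).restrictScalars k with hS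
  let ψ : S →ₗ[k] M := ((LinearMap.toSpanSingleton A M y).restrictScalars k).comp S.subtype
  have e3 := LinearMap.finrank_range_add_finrank_ker ψ
  have e4 : LinearMap.range ψ = P ⊓ LinearMap.range φ := by
    ext x; constructor
    · rintro ⟨a, rfl⟩
      exact ⟨⟨h.smul_mem a.2.1 hy, a.2.2⟩, ⟨⟨a.1, a.2.1⟩, rfl⟩⟩
    · rintro ⟨h1, ⟨a, rfl⟩⟩
      exact ⟨⟨a.1, a.2, h1.2⟩, rfl⟩
  have e5 : Module.finrank k (LinearMap.ker ψ) = Module.finrank k (LinearMap.ker φ) := by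
    refine LinearEquiv.finrank_eq
      { toFun := fun a => ⟨⟨a.1.1, a.1.2.1⟩, a.2⟩
        map_add' := fun _ _ => rfl
        map_smul' := fun _ _ => rfl
        invFun := fun a => ⟨⟨a.1.1, a.1.2, ?_⟩, a.2⟩
        left_inv := fun _ => rfl
        right_inv := fun _ => rfl }
    change a.1.1 • y ∈ N
    have : φ a.1 = 0 := a.2
    rw [← hφ, this]; exact zero_mem _
  simp only [hilb]
  rw [e4, e5] at e3
  rw [← hP, ← hQ, ← hS]
  omega

/-- The Hilbert function is modular. -/
lemma hilb_sup_add_inf (hG : ∀ n, FiniteDimensional k (G.deg n)) {N N' : Submodule k A}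
    (hN : G.Homog N) (hN' : G.Homog N') (n : ℕ) :
    G.hilb (N ⊔ N') n + G.hilb (N ⊓ N') n = G.hilb N n + G.hilb N' n := by
  have := hG n
  have e1 : G.deg n ⊓ (N ⊔ N') = (G.deg n ⊓ N) ⊔ (G.deg n ⊓ N') := by
    apply le_antisymm
    · rintro x ⟨hx, hx'⟩
      obtain ⟨u, hu, v, hv, rfl⟩ := Submodule.mem_sup.1 hx'
      rw [← G.comp_of_mem hx, map_add]
      exact Submodule.add_mem_sup ⟨G.comp_mem_deg _ _, hN u hu _⟩ ⟨G.comp_mem_deg _ _, hN' v hv _⟩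
    · exact sup_le (inf_le_inf_left _ le_sup_left) (inf_le_inf_left _ le_sup_right)
  have e2 := Submodule.finrank_sup_add_finrank_inf_eq (G.deg n ⊓ N) (G.deg n ⊓ N')
  rw [← e1, ← inf_inf_distrib_left] at e2
  simp only [hilb]
  lia

/-- The Hilbert function of a graded quotient. -/
lemma Compat.hilb_comap (h : G.Compat H) (hG : ∀ n, FiniteDimensional k (G.deg n))
    (hsurj : Function.Surjective (algebraMap A M)) (N : Submodule k M) (n : ℕ) :
    G.hilb (N.comap (IsScalarTower.toAlgHom k A M).toLinearMap) n = H.hilb N n := by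
  have := hG n
  let π := (IsScalarTower.toAlgHom k A M).toLinearMap
  have hπ : ∀ a, π a = algebraMap A M a := fun _ => rfl
  let φ : G.deg n →ₗ[k] M := π.comp (G.deg n).subtype
  have hφ : LinearMap.range φ = H.deg n := by
    apply le_antisymm
    · rintro _ ⟨a, rfl⟩
      exact h.algebraMap_mem a.2
    · intro x hx
      obtain ⟨a, rfl⟩ := hsurj x
      refine ⟨⟨_, G.comp_mem_deg n a⟩, ?_⟩
      change algebraMap A M (G.comp n a) = _
      rw [← h.comp_algebraMap, H.comp_of_mem hx]
  set S := G.deg n ⊓ N.comap π with hS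
  let ψ : S →ₗ[k] M := π.comp S.subtype
  have hψ : LinearMap.range ψ = H.deg n ⊓ N := by
    rw [← hφ]
    ext x; constructor
    · rintro ⟨a, rfl⟩
      exact ⟨⟨⟨a.1, a.2.1⟩, rfl⟩, a.2.2⟩
    · rintro ⟨⟨a, rfl⟩, h1⟩
      exact ⟨⟨a.1, a.2, h1⟩, rfl⟩
  have e5 : Module.finrank k (LinearMap.ker ψ) = Module.finrank k (LinearMap.ker φ) := by
    refine LinearEquiv.finrank_eq
      { toFun := fun a => ⟨⟨a.1.1, a.1.2.1⟩, a.2⟩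
        map_add' := fun _ _ => rfl
        map_smul' := fun _ _ => rfl
        invFun := fun a => ⟨⟨a.1.1, a.1.2, ?_⟩, a.2⟩
        left_inv := fun _ => rfl
        right_inv := fun _ => rfl }
    have : π a.1 = 0 := a.2
    change π a.1 ∈ N
    rw [this]; exact zero_mem _
  have e2 := LinearMap.finrank_range_add_finrank_ker φ
  have e3 := LinearMap.finrank_range_add_finrank_ker ψ
  rw [hφ] at e2
  rw [hψ, e5] at e3
  simp only [hilb]
  change _ - (Module.finrank k S : ℤ) = _
  omega

end Hilb

end PolyGrading

lemma exists_pow_smul_eq_zero_of_one_tmul {A L Q : Type*} [CommRing A] [CommRing L] [Algebra A L]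
    [AddCommGroup Q] [Module A Q] (f : A) [IsLocalization.Away f L] (q : Q)
    (h : (1 : L) ⊗ₜ[A] q = 0) : ∃ K : ℕ, f ^ K • q = 0 := by
  obtain ⟨⟨_, K, rfl⟩, hc⟩ := (IsLocalizedModule.eq_zero_iff (Submonoid.powers f)
    (TensorProduct.mk A L Q 1)).1 h
  exact ⟨K, hc⟩

lemma exists_pow_smul_eq_one_tmul {A L Q : Type*} [CommRing A] [CommRing L] [Algebra A L]
    [AddCommGroup Q] [Module A Q] (f : A) [IsLocalization.Away f L] (x : L ⊗[A] Q) :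
    ∃ (K : ℕ) (q : Q), f ^ K • x = (1 : L) ⊗ₜ[A] q := by
  obtain ⟨⟨q, ⟨_, K, rfl⟩⟩, hc⟩ := IsLocalizedModule.surj (Submonoid.powers f)
    (TensorProduct.mk A L Q 1) x
  exact ⟨K, q, hc⟩

/-- Formation of colon ideals commutes with base change up to `f`-power torsion when the base
change is flat after inverting `f`. -/
lemma exists_pow_mul_mem_map_colon {A B M M' : Type*} [CommRing A] [CommRing B] [Algebra A B]
    [AddCommGroup M] [Module A M] [AddCommGroup M'] [Module A M'] [Module B M']
    [IsScalarTower A B M'] (f : A) [Module.Flat A (Localization.Away f ⊗[A] B)]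
    (p : M →ₗ[A] M') (hp : IsBaseChange B p) (N : Submodule A M) (y : M) (b : B)
    (hb : b • p y ∈ Submodule.span B (p '' N)) :
    ∃ K : ℕ, f ^ K • b ∈
      Ideal.map (algebraMap A B) (N.comap (LinearMap.toSpanSingleton A M y)) := by
  set c : Ideal A := N.comap (LinearMap.toSpanSingleton A M y) with hc
  let L := Localization.Away f
  let E := L ⊗[A] B
  let h₁ : M' →ₗ[B] B ⊗[A] (M ⧸ N) := (N.mkQ.baseChange B) ∘ₗ hp.equiv.symm.toLinearMap
  have hh₁ : ∀ m, h₁ (p m) = 1 ⊗ₜ N.mkQ m := fun m => by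
    have : p m = hp.equiv (1 ⊗ₜ m) := by rw [hp.equiv_tmul, one_smul]
    simp only [h₁, LinearMap.comp_apply, this, LinearEquiv.coe_coe, LinearEquiv.symm_apply_apply,
      LinearMap.baseChange_tmul]
  have hz : b ⊗ₜ[A] N.mkQ y = 0 := by
    have hle : Submodule.span B (p '' N) ≤ LinearMap.ker h₁ := by
      rw [Submodule.span_le]
      rintro _ ⟨m, hm, rfl⟩
      change h₁ (p m) = 0
      rw [hh₁, (Submodule.Quotient.mk_eq_zero N).2 hm |> fun h => (h : N.mkQ m = 0), tmul_zero]
    have := hle hb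
    rw [LinearMap.mem_ker, map_smul, hh₁, smul_tmul', smul_eq_mul, mul_one] at this
    exact this
  let φ : A →ₗ[A] M ⧸ N := N.mkQ ∘ₗ LinearMap.toSpanSingleton A M y
  have hφ : LinearMap.ker φ = c := by
    rw [LinearMap.ker_comp, Submodule.ker_mkQ]
  have hex : Function.Exact c.subtype φ := by
    intro x; rw [← LinearMap.mem_ker, hφ]; simp
  have hex' := Module.Flat.lTensor_exact E hex
  have hz' : φ.lTensor E (((1 : L) ⊗ₜ[A] b) ⊗ₜ[A] (1 : A)) = 0 := by
    have := congrArg (LinearMap.rTensor (M ⧸ N) (TensorProduct.mk A L B 1)) hz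
    rw [LinearMap.rTensor_tmul, map_zero] at this
    rw [LinearMap.lTensor_tmul]
    simpa [φ] using this
  obtain ⟨w, hw⟩ := (hex' _).1 hz'
  let Q := B ⧸ Ideal.map (algebraMap A B) c
  let q : B →ₗ[A] Q := (Ideal.Quotient.mkₐ A _).toLinearMap
  let θ : E ⊗[A] A →ₗ[A] L ⊗[A] Q := (q.lTensor L) ∘ₗ (TensorProduct.rid A E).toLinearMap
  have hθ : ∀ w, θ ((c.subtype).lTensor E w) = 0 := by
    intro w
    induction w using TensorProduct.induction_on with
    | zero => simp
    | add x y hx hy => rw [map_add, map_add, hx, hy, add_zero]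
    | tmul e a =>
      simp only [θ, LinearMap.lTensor_tmul, LinearMap.comp_apply, LinearEquiv.coe_coe,
        TensorProduct.rid_tmul, map_smul]
      generalize q.lTensor L e = z
      induction z using TensorProduct.induction_on with
      | zero => simp
      | add x y hx hy => rw [smul_add, hx, hy, add_zero]
      | tmul l b =>
        obtain ⟨b, rfl⟩ := Ideal.Quotient.mk_surjective b
        rw [← tmul_smul]
        have : (c.subtype a) • (Ideal.Quotient.mk (Ideal.map (algebraMap A B) c) b) = 0 := by
          rw [Algebra.smul_def, IsScalarTower.algebraMap_apply A B, Ideal.Quotient.algebraMap_eq,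
            ← map_mul, Ideal.Quotient.eq_zero_iff_mem]
          exact Ideal.mul_mem_right _ _ (Ideal.mem_map_of_mem _ a.2)
        rw [this, tmul_zero]
  have h2 := hθ w
  rw [hw] at h2
  simp only [θ, LinearMap.comp_apply, LinearEquiv.coe_coe, TensorProduct.rid_tmul, one_smul,
    LinearMap.lTensor_tmul] at h2
  obtain ⟨K, hK⟩ := exists_pow_smul_eq_zero_of_one_tmul f _ h2
  refine ⟨K, ?_⟩
  rw [← map_smul] at hK
  exact Ideal.Quotient.eq_zero_iff_mem.1 hK

/-- Finite étale algebras of constant rank. -/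
structure EtaleRank (r : ℕ) (A B : Type*) [CommRing A] [CommRing B] [Algebra A B] : Prop where
  unramified : Algebra.FormallyUnramified A B
  finite : Module.Finite A B
  flat : Module.Flat A B
  rank : ∀ p, Module.rankAtStalk (R := A) B p = r

lemma EtaleRank.equiv {r : ℕ} {A B B' : Type*} [CommRing A] [CommRing B] [CommRing B'] [Algebra A B]
    [Algebra A B'] (h : EtaleRank r A B) (e : B ≃ₐ[A] B') : EtaleRank r A B' := by
  obtain ⟨h1, h2, h3, h4⟩ := h
  refine ⟨.of_equiv e, .equiv e.toLinearEquiv, .of_linearEquiv e.symm.toLinearEquiv, fun p => ?_⟩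
  rw [← h4, Module.rankAtStalk_eq_of_equiv e.toLinearEquiv]

lemma EtaleRank.baseChange {r : ℕ} {A B : Type*} [CommRing A] [CommRing B] [Algebra A B]
    (h : EtaleRank r A B) (A' : Type*) [CommRing A'] [Algebra A A'] :
    EtaleRank r A' (A' ⊗[A] B) := by
  obtain ⟨h1, h2, h3, h4⟩ := h
  refine ⟨inferInstance, inferInstance, inferInstance, fun p => ?_⟩
  rw [Module.rankAtStalk_baseChange, h4]

/-- A section of a finite étale algebra splits off. -/
lemma EtaleRank.split {r : ℕ} {R D : Type u} [CommRing R] [CommRing D] [Algebra R D]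
    [IsNoetherianRing D] (h : EtaleRank (r + 1) R D) (π : D →ₐ[R] R) :
    ∃ e : D, IsIdempotentElem e ∧ RingHom.ker π = Ideal.span {e} ∧
      EtaleRank r R (D ⧸ Ideal.span {1 - e}) := by
  obtain ⟨h1, h2, h3, h4⟩ := h
  have hsurj : Function.Surjective π := fun x => ⟨algebraMap R D x, by simp⟩
  set J := RingHom.ker π with hJ
  have hJJ : IsIdempotentElem J := by
    refine le_antisymm Ideal.mul_le_left fun x hx => ?_
    let g₁ := Ideal.Quotient.mkₐ R (J * J)
    let g₂ : D →ₐ[R] D ⧸ (J * J) := (Algebra.ofId R _).comp π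
    have : g₁ = g₂ := by
      refine Algebra.FormallyUnramified.ext (J.map (Ideal.Quotient.mk (J * J))) ⟨2, ?_⟩ fun x => ?_
      · rw [← Ideal.map_pow, pow_two, Ideal.map_quotient_self]; rfl
      · rw [Ideal.Quotient.eq]
        have : g₁ x - g₂ x = Ideal.Quotient.mk (J * J) (x - algebraMap R D (π x)) := by
          rw [map_sub]; rfl
        rw [this]
        refine Ideal.mem_map_of_mem _ ?_
        rw [hJ, RingHom.mem_ker]; simp
    have hx' : g₁ x = 0 := by
      rw [this]
      change algebraMap R _ (π x) = 0
      rw [RingHom.mem_ker.1 hx, map_zero]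
    exact Ideal.Quotient.eq_zero_iff_mem.1 hx'
  obtain ⟨e, he, hJe⟩ := (Ideal.isIdempotentElem_iff_of_fg _ (IsNoetherian.noetherian J)).1 hJJ
  refine ⟨e, he, hJe, ?_⟩
  let T := D ⧸ Ideal.span {1 - e}
  let e₁ : D ≃ₐ[R] (D ⧸ Ideal.span {e}) × T :=
    AlgEquiv.prodQuotientOfIsIdempotentElem (R := R) he he.one_sub (by simp) (by simp [mul_sub, he.eq])
  let e₂ : (D ⧸ Ideal.span {e}) ≃ₐ[R] R :=
    (Ideal.quotientEquivAlgOfEq R hJe.symm).trans (Ideal.quotientKerAlgEquivOfSurjective hsurj)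
  let e₃ : D ≃ₐ[R] R × T := e₁.trans (.prodCongr e₂ .refl)
  have hflat : Module.Flat R (R × T) := .of_linearEquiv e₃.symm.toLinearEquiv
  have hT : Module.Flat R T := by
    refine .of_retract (LinearMap.inr R R T) (LinearMap.snd R R T) (by simp)
  have hTfin : Module.Finite R T := inferInstance
  refine ⟨.of_surjective (Ideal.Quotient.mkₐ R _) Ideal.Quotient.mk_surjective, hTfin, hT, fun p => ?_⟩
  have : Nontrivial R := p.nontrivial
  have h5 := h4 p
  rw [Module.rankAtStalk_eq_of_equiv e₃.toLinearEquiv, Module.rankAtStalk_prod] at h5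
  simp at h5
  lia

lemma map_split_one {B C D : Type*} [CommRing B] [CommRing C] [CommRing D] [Algebra B C]
    [Algebra B D] (ι : C →ₐ[B] D) {f : B} {m n : ℕ} {e : D} {x y : C}
    (hx : f ^ m • (1 - e) = ι x) (hy : f ^ n • e = ι y) :
    ι (f ^ (n + m) • 1 - (f ^ n • x + f ^ m • y)) = 0 := by
  rw [map_sub, map_add, map_smul, map_smul, map_smul, ← hx, ← hy, map_one, smul_smul, smul_smul,
    ← pow_add, ← pow_add, add_comm m n, ← smul_add, sub_add_cancel, sub_self]

lemma EtaleRank.split_away {r : ℕ} {B C : Type u} [CommRing B] [CommRing C] [Algebra B C]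
    [IsNoetherianRing C] (μ : C →ₐ[B] B) (f : B)
    (L : Type u) [CommRing L] [Algebra B L] [IsLocalization.Away f L]
    (h : EtaleRank (r + 1) L (L ⊗[B] C)) :
    (∃ m : ℕ, algebraMap B C f ^ m ∈ RingHom.ker μ ⊔ Module.annihilator C (RingHom.ker μ)) ∧
    EtaleRank r L
      (L ⊗[B] (C ⧸ Module.annihilator C (RingHom.ker μ))) := by
  set J := RingHom.ker μ with hJ
  set K := Module.annihilator C J with hK
  let ι : C →ₐ[B] (L ⊗[B] C) := Algebra.TensorProduct.includeRight
  have hι : ∀ c, ι c = 1 ⊗ₜ c := fun _ => rfl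
  have : IsNoetherianRing (L ⊗[B] C) := by
    have : IsLocalization ((Submonoid.powers f).map (algebraMap B C)) (C ⊗[B] L) := inferInstance
    have : IsNoetherianRing (C ⊗[B] L) :=
      IsLocalization.isNoetherianRing ((Submonoid.powers f).map (algebraMap B C)) _ inferInstance
    exact isNoetherianRing_of_ringEquiv _ (Algebra.TensorProduct.comm B C L).toRingEquiv
  have hunit : ∀ m : ℕ, IsUnit (algebraMap B (L ⊗[B] C) f ^ m) := fun m => by
    rw [IsScalarTower.algebraMap_apply B L (L ⊗[B] C)]
    exact ((IsLocalization.Away.algebraMap_isUnit f).map (algebraMap L (L ⊗[B] C))).pow m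
  have hcancel : ∀ (m : ℕ) (x : (L ⊗[B] C)), f ^ m • x = 0 → x = 0 := fun m x hx => by
    rw [Algebra.smul_def, map_pow] at hx
    exact (hunit m).mul_right_eq_zero.1 hx
  have hzero : ∀ c, ι c = 0 → ∃ m : ℕ, f ^ m • c = 0 := fun c hc =>
    exists_pow_smul_eq_zero_of_one_tmul f c hc
  let π : (L ⊗[B] C) →ₐ[L] L := (Algebra.TensorProduct.rid B L L).toAlgHom.comp
    (Algebra.TensorProduct.map (AlgHom.id L L) μ)
  have hπ : ∀ c, π (ι c) = algebraMap B L (μ c) := fun c => by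
    change Algebra.TensorProduct.rid B L L (Algebra.TensorProduct.map (AlgHom.id L L) μ (1 ⊗ₜ c)) = _
    rw [Algebra.TensorProduct.map_tmul, Algebra.TensorProduct.rid_tmul, Algebra.smul_def]
    simp
  obtain ⟨e, he, hker, hT⟩ := h.split π
  have hπe : π e = 0 := by
    rw [← RingHom.mem_ker, hker]; exact Ideal.mem_span_singleton_self e
  have hJe : ∀ j ∈ J, (1 - e) * ι j = 0 := fun j hj => by
    have : ι j ∈ Ideal.span {e} := by
      rw [← hker, RingHom.mem_ker, hπ, (RingHom.mem_ker).1 hj, map_zero]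
    obtain ⟨d, hd⟩ := Ideal.mem_span_singleton.1 this
    rw [hd, ← mul_assoc, sub_mul, he.eq, one_mul, sub_self, zero_mul]
  -- representatives of the two idempotents
  obtain ⟨m₁, k₁, hk₁, hk₁'⟩ : ∃ (m : ℕ) (c : C), c ∈ K ∧ f ^ m • (1 - e) = ι c := by
    obtain ⟨m, c, hc⟩ := exists_pow_smul_eq_one_tmul f (1 - e)
    have hz : ∀ j ∈ J, ∃ M : ℕ, f ^ M • (c * j) = 0 := fun j hj => hzero _ <| by
      rw [map_mul, hι c, ← hc, smul_mul_assoc, hJe j hj, smul_zero]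
    obtain ⟨s, hs⟩ := (IsNoetherian.noetherian J : J.FG)
    have : ∃ M : ℕ, ∀ j ∈ s, f ^ M • (c * j) = 0 := by
      have hz' : ∀ j : C, ∃ M : ℕ, j ∈ s → f ^ M • (c * j) = 0 := fun j => by
        by_cases hj : j ∈ s
        · obtain ⟨M, hM⟩ := hz j (hs ▸ Ideal.subset_span hj); exact ⟨M, fun _ => hM⟩
        · exact ⟨0, fun h => absurd h hj⟩
      choose M hM using hz'
      refine ⟨s.sup M, fun j hj => ?_⟩
      rw [← Nat.sub_add_cancel (Finset.le_sup (f := M) hj), pow_add, mul_smul, hM j hj, smul_zero]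
    obtain ⟨M, hM⟩ := this
    refine ⟨M + m, f ^ M • c, ?_, ?_⟩
    · rw [hK, Module.mem_annihilator]
      rintro ⟨j, hj⟩
      ext
      change f ^ M • c * j = 0
      rw [← hs] at hj
      induction hj using Submodule.span_induction with
      | mem x hx => rw [smul_mul_assoc]; exact hM x hx
      | zero => simp
      | add x y _ _ hx hy => rw [mul_add, hx, hy, add_zero]
      | smul a x _ hx => rw [smul_eq_mul, mul_left_comm, hx, mul_zero]
    · rw [pow_add, mul_smul, hc, map_smul, hι]
  obtain ⟨m₂, j₂, hj₂, hj₂'⟩ : ∃ (m : ℕ) (c : C), c ∈ J ∧ f ^ m • e = ι c := by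
    obtain ⟨m, c, hc⟩ := exists_pow_smul_eq_one_tmul f e
    have h1 : algebraMap B L (μ c) = 0 := by
      rw [← hπ, hι, ← hc, ← IsScalarTower.algebraMap_smul L, map_smul, hπe, smul_zero]
    obtain ⟨⟨_, M, rfl⟩, hM⟩ := (IsLocalization.map_eq_zero_iff (Submonoid.powers f) L _).1 h1
    refine ⟨M + m, f ^ M • c, ?_, ?_⟩
    · rw [hJ, RingHom.mem_ker, map_smul, smul_eq_mul]; exact hM
    · rw [pow_add, mul_smul, hc, map_smul, hι]
  have hKe : ∀ c ∈ K, ι c * e = 0 := fun c hc => by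
    refine hcancel m₂ _ ?_
    rw [← mul_smul_comm, hj₂', ← map_mul]
    have : c * j₂ = 0 := congrArg Subtype.val (Module.mem_annihilator.1 hc ⟨j₂, hj₂⟩)
    rw [this, map_zero]
  refine ⟨?_, ?_⟩
  · have h1 : ι (f ^ (m₂ + m₁) • 1 - (f ^ m₂ • k₁ + f ^ m₁ • j₂)) = 0 :=
      map_split_one ι hk₁' hj₂'
    obtain ⟨M, hM⟩ := hzero _ h1
    refine ⟨M + (m₂ + m₁), ?_⟩
    rw [smul_sub, sub_eq_zero, ← mul_smul, ← pow_add, Algebra.smul_def, mul_one, map_pow] at hM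
    rw [hM, smul_add]
    refine add_mem ?_ ?_
    · refine Ideal.mem_sup_right ?_
      simp only [Algebra.smul_def]
      exact K.mul_mem_left _ (K.mul_mem_left _ hk₁)
    · refine Ideal.mem_sup_left ?_
      simp only [Algebra.smul_def]
      exact J.mul_mem_left _ (J.mul_mem_left _ hj₂)
  · let ψ : (L ⊗[B] C) →ₐ[L] L ⊗[B] (C ⧸ K) :=
      Algebra.TensorProduct.map (AlgHom.id L L) (Ideal.Quotient.mkₐ B K)
    have hψt : ∀ x c, ψ (x ⊗ₜ c) = x ⊗ₜ Ideal.Quotient.mk K c := fun _ _ => rfl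
    have hψ : Function.Surjective ψ := fun y => by
      induction y using TensorProduct.induction_on with
      | zero => exact ⟨0, map_zero _⟩
      | add x y hx hy =>
        obtain ⟨x, rfl⟩ := hx
        obtain ⟨y, rfl⟩ := hy
        exact ⟨x + y, map_add _ _ _⟩
      | tmul x c =>
        obtain ⟨c, rfl⟩ := Ideal.Quotient.mk_surjective c
        exact ⟨x ⊗ₜ c, hψt x c⟩
    have hψker : RingHom.ker ψ = Ideal.span {1 - e} := by
      have h2 := Algebra.TensorProduct.lTensor_ker (A := L) (Ideal.Quotient.mkₐ B K)
        Ideal.Quotient.mk_surjective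
      have h3 : RingHom.ker ψ = RingHom.ker (Algebra.TensorProduct.map (AlgHom.id B L)
        (Ideal.Quotient.mkₐ B K)) := rfl
      have h5 : RingHom.ker (Ideal.Quotient.mkₐ B K) = K := Ideal.mk_ker
      rw [h3, h2, h5]
      apply le_antisymm
      · rw [Ideal.map_le_iff_le_comap]
        intro c hc
        rw [Ideal.mem_comap, Ideal.mem_span_singleton]
        refine ⟨ι c, ?_⟩
        change ι c = _
        rw [sub_mul, one_mul, mul_comm e, hKe c hc, sub_zero]
      · rw [Ideal.span_singleton_le_iff_mem]
        have h4 : f ^ m₁ • (1 - e) ∈ Ideal.map (Algebra.TensorProduct.includeRight : C →ₐ[B] (L ⊗[B] C)) K := by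
          rw [hk₁']; exact Ideal.mem_map_of_mem _ hk₁
        rw [Algebra.smul_def, map_pow] at h4
        exact (Ideal.unit_mul_mem_iff_mem _ (hunit m₁)).1 h4
    exact hT.equiv ((Ideal.quotientEquivAlgOfEq L hψker.symm).trans
      (Ideal.quotientKerAlgEquivOfSurjective hψ))

namespace PolyGrading

variable {k A B : Type*} [Field k] [CommRing A] [Algebra k A] [CommRing B] [Algebra k B]
  [Algebra A B] [IsScalarTower k A B] (G : PolyGrading k A) (H : PolyGrading k B)

/-- The grading on the quotient by a homogeneous ideal. -/
def quot (I : Ideal A) (hI : G.Homog (I.restrictScalars k)) : PolyGrading k (A ⧸ I) where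
  coact := Ideal.Quotient.liftₐ I ((Polynomial.mapAlgHom (Ideal.Quotient.mkₐ k I)).comp G.coact)
    fun a ha => by
      ext n
      change (Polynomial.map _ (G.coact a)).coeff n = _
      rw [coeff_map]
      exact Ideal.Quotient.eq_zero_iff_mem.2 (hI a ha n)
  eval_one x := by
    obtain ⟨a, rfl⟩ := Ideal.Quotient.mk_surjective x
    change (Polynomial.map (Ideal.Quotient.mk I) (G.coact a)).eval 1 = _
    rw [← map_one (Ideal.Quotient.mk I), eval_map_apply, G.eval_one]
  coact_coeff x n := by
    obtain ⟨a, rfl⟩ := Ideal.Quotient.mk_surjective x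
    have key : ∀ a, Ideal.Quotient.liftₐ I
        ((Polynomial.mapAlgHom (Ideal.Quotient.mkₐ k I)).comp G.coact) (fun a ha => by
          ext n
          change (Polynomial.map _ (G.coact a)).coeff n = _
          rw [coeff_map]
          exact Ideal.Quotient.eq_zero_iff_mem.2 (hI a ha n)) (Ideal.Quotient.mk I a) =
        Polynomial.map (Ideal.Quotient.mk I) (G.coact a) := fun a => rfl
    rw [key, coeff_map, key, G.coact_coeff, map_monomial]

lemma compat_quot (I : Ideal A) (hI : G.Homog (I.restrictScalars k)) :
    G.Compat (G.quot I hI) := fun _ => rfl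

variable {G H}

lemma Homog.annihilator {J : Ideal A} (hJ : G.Homog (J.restrictScalars k)) :
    G.Homog ((Module.annihilator A J).restrictScalars k) := by
  have key : ∀ a : A, a ∈ Module.annihilator A J ↔ ∀ j ∈ J, a * j = 0 := fun a => by
    rw [Module.mem_annihilator]
    exact ⟨fun h j hj => congrArg Subtype.val (h ⟨j, hj⟩), fun h j => Subtype.ext (h j j.2)⟩
  intro a ha n
  rw [Submodule.restrictScalars_mem, key] at *
  intro j hj
  rw [← G.sum_comp j, Finset.mul_sum]
  refine Finset.sum_eq_zero fun m _ => ?_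
  rw [← smul_eq_mul, ← (G.compat_self).comp_smul n a (G.comp_mem_deg m j), smul_eq_mul,
    ha _ (hJ j hj m), map_zero]

lemma Homog.map {I : Ideal A} (hI : G.Homog (I.restrictScalars k)) (h : G.Compat H) :
    H.Homog ((I.map (algebraMap A B)).restrictScalars k) := by
  have : I.map (algebraMap A B) =
      Submodule.span B ((algebraMap A B) '' {x | x ∈ I ∧ ∃ e, x ∈ G.deg e}) := by
    conv_lhs => rw [← hI.span_homog]
    exact Ideal.map_span _ _
  rw [this]
  refine homog_span H H H.compat_self _ ?_
  rintro _ ⟨x, ⟨-, e, he⟩, rfl⟩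
  exact ⟨e, h.algebraMap_mem he⟩

lemma Compat.homog_colon (h : G.Compat H) {N : Submodule A B} (hN : H.Homog (N.restrictScalars k))
    {y : B} {e : ℕ} (hy : y ∈ H.deg e) :
    G.Homog ((N.comap (LinearMap.toSpanSingleton A B y)).restrictScalars k) := fun a ha n => by
  change G.comp n a • y ∈ N
  rw [← h.comp_smul n a hy]
  exact hN _ ha _

lemma Homog.sup_span {N : Submodule A B} (hN : H.Homog (N.restrictScalars k))
    (h : G.Compat H) {y : B} {e : ℕ} (hy : y ∈ H.deg e) :
    H.Homog ((N ⊔ Submodule.span A {y}).restrictScalars k) := by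
  rw [← hN.span_homog, ← Submodule.span_union]
  refine homog_span G H h _ ?_
  rintro z (⟨-, hz⟩ | rfl)
  · exact hz
  · exact ⟨e, hy⟩

lemma exists_tensor_lift {A B D : Type*} [CommRing A] [CommRing B] [CommRing D] [Algebra A B]
    (u v : B →+* D) (huv : u.comp (algebraMap A B) = v.comp (algebraMap A B)) :
    ∃ w : B ⊗[A] B →+* D, (∀ b, w (b ⊗ₜ 1) = u b) ∧ ∀ b, w (1 ⊗ₜ b) = v b := by
  let := (u.comp (algebraMap A B)).toAlgebra
  let u' : B →ₐ[A] D := { u with commutes' := fun _ => rfl }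
  let v' : B →ₐ[A] D := { v with commutes' := fun a => (RingHom.congr_fun huv a).symm }
  refine ⟨(Algebra.TensorProduct.lift u' v' fun _ _ => Commute.all _ _).toRingHom, fun b => ?_, fun b => ?_⟩
  · change Algebra.TensorProduct.lift u' v' _ (b ⊗ₜ 1) = _
    rw [Algebra.TensorProduct.lift_tmul, map_one, mul_one]; rfl
  · change Algebra.TensorProduct.lift u' v' _ (1 ⊗ₜ b) = _
    rw [Algebra.TensorProduct.lift_tmul, map_one, one_mul]; rfl

/-- The grading on the tensor square of a graded algebra. -/
lemma Compat.exists_tensor (h : G.Compat H) : ∃ T : PolyGrading k (B ⊗[A] B), H.Compat T ∧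
    ∀ b, T.coact (1 ⊗ₜ b) = (H.coact b).map
      (Algebra.TensorProduct.includeRight : B →ₐ[A] B ⊗[A] B).toRingHom := by
  let iL : B →+* B ⊗[A] B := algebraMap B (B ⊗[A] B)
  let iR : B →+* B ⊗[A] B := (Algebra.TensorProduct.includeRight : B →ₐ[A] B ⊗[A] B).toRingHom
  have hLR : iL.comp (algebraMap A B) = iR.comp (algebraMap A B) := by
    ext a
    change algebraMap A B a ⊗ₜ[A] (1 : B) = 1 ⊗ₜ algebraMap A B a
    rw [Algebra.algebraMap_eq_smul_one, smul_tmul]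
  obtain ⟨w, hwL, hwR⟩ := exists_tensor_lift (A := A)
    ((mapRingHom iL).comp H.coact.toRingHom) ((mapRingHom iR).comp H.coact.toRingHom) (by
      ext1 a
      change Polynomial.map iL (H.coact _) = Polynomial.map iR (H.coact _)
      rw [h a, Polynomial.map_map, Polynomial.map_map, hLR])
  have hwL' : ∀ b, w (b ⊗ₜ 1) = Polynomial.map iL (H.coact b) := hwL
  have hwR' : ∀ b, w (1 ⊗ₜ b) = Polynomial.map iR (H.coact b) := hwR
  let γ : B ⊗[A] B →ₐ[k] (B ⊗[A] B)[X] :=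
    { w with
      commutes' := fun c => by
        change w (algebraMap k B c ⊗ₜ 1) = _
        rw [hwL', AlgHom.commutes, Polynomial.algebraMap_apply, map_C, Polynomial.algebraMap_apply]
        rfl }
  have hγ : ∀ x, γ x = w x := fun _ => rfl
  have hmul : ∀ x y, (∀ n, γ ((γ x).coeff n) = monomial n ((γ x).coeff n)) →
      (∀ n, γ ((γ y).coeff n) = monomial n ((γ y).coeff n)) →
      ∀ n, γ ((γ (x * y)).coeff n) = monomial n ((γ (x * y)).coeff n) := by
    intro x y hx hy n
    rw [map_mul, coeff_mul, map_sum, map_sum]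
    refine Finset.sum_congr rfl fun p hp => ?_
    rw [map_mul, hx, hy, monomial_mul_monomial, Finset.HasAntidiagonal.mem_antidiagonal.1 hp]
  have hsplit : ∀ b c : B, b ⊗ₜ[A] c = (b ⊗ₜ 1) * (1 ⊗ₜ c) := fun b c => by
    rw [Algebra.TensorProduct.tmul_mul_tmul, one_mul, mul_one]
  refine ⟨⟨γ, fun x => ?_, fun x => ?_⟩, fun b => hwL' b, hwR'⟩
  · induction x using TensorProduct.induction_on with
    | zero => simp
    | add x y hx hy => rw [map_add, eval_add, hx, hy]
    | tmul b c =>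
      rw [hsplit, map_mul, eval_mul, hγ, hγ, hwL', hwR', ← map_one iL, eval_map_apply,
        H.eval_one, map_one iL, ← map_one iR, eval_map_apply, H.eval_one]; rfl
  · induction x using TensorProduct.induction_on with
    | zero => simp
    | add x y hx hy => intro n; rw [map_add, coeff_add, map_add, hx, hy, map_add]
    | tmul b c =>
      rw [hsplit]
      refine hmul _ _ (fun n => ?_) (fun n => ?_)
      · rw [hγ (b ⊗ₜ 1), hwL', coeff_map]
        change w ((H.coact b).coeff n ⊗ₜ 1) = _
        rw [hwL', H.coact_coeff, map_monomial]
      · rw [hγ (1 ⊗ₜ c), hwR', coeff_map]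
        change w (1 ⊗ₜ _) = _
        rw [hwR', H.coact_coeff, map_monomial]

lemma Homog.exists_notMem {k A : Type*} [Field k] [CommRing A] [Algebra k A] {G : PolyGrading k A}
    {N : Submodule k A} (hN : N ≠ ⊤) : ∃ y e, y ∈ G.deg e ∧ y ∉ N := by
  by_contra! hc
  refine hN (eq_top_iff.2 fun x _ => ?_)
  rw [← G.sum_comp x]
  exact sum_mem fun n _ => hc _ _ (G.comp_mem_deg n x)

lemma eventually_of_add {P : ℕ → Prop} (e : ℕ) (h : ∀ᶠ n in atTop, P (n + e)) :
    ∀ᶠ n in atTop, P n := by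
  obtain ⟨n₀, hn₀⟩ := eventually_atTop.1 h
  refine eventually_atTop.2 ⟨n₀ + e, fun n hn => ?_⟩
  have := hn₀ (n - e) (by omega)
  rwa [Nat.sub_add_cancel (by omega)] at this

lemma eventually_add {P : ℕ → Prop} (e : ℕ) (h : ∀ᶠ n in atTop, P n) :
    ∀ᶠ n in atTop, P (n + e) :=
  (tendsto_add_atTop_nat e).eventually h

section Delta

variable {k A B M M' : Type*} [Field k] [CommRing A] [Algebra k A] [CommRing B] [Algebra k B]
  [CommRing M] [Algebra k M] [CommRing M'] [Algebra k M']
  [Algebra A B] [Algebra A M] [Algebra A M'] [Algebra B M'] [IsScalarTower A B M']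
  [IsScalarTower k A B] [IsScalarTower k A M] [IsScalarTower k B M']
  {G : PolyGrading k A} {H : PolyGrading k B} {GM : PolyGrading k M} {HM : PolyGrading k M'}

lemma homog_span_image (h' : H.Compat HM) {p : M →ₗ[A] M'}
    (hpd : ∀ y e, y ∈ GM.deg e → p y ∈ HM.deg e)
    {N : Submodule A M} (hN : GM.Homog (N.restrictScalars k)) :
    HM.Homog ((Submodule.span B (p '' N)).restrictScalars k) := by
  have : Submodule.span B (p '' N) =
      Submodule.span B (p '' {x | x ∈ N ∧ ∃ e, x ∈ GM.deg e}) := by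
    conv_lhs => rw [← hN.span_homog]
    refine le_antisymm (Submodule.span_le.2 ?_)
      (Submodule.span_mono (Set.image_mono Submodule.subset_span))
    rintro _ ⟨x, hx, rfl⟩
    have : Submodule.span A {x | x ∈ N ∧ ∃ e, x ∈ GM.deg e} ≤ ((Submodule.span B
        (p '' {x | x ∈ N ∧ ∃ e, x ∈ GM.deg e})).restrictScalars A).comap p :=
      Submodule.span_le.2 fun x hx => Submodule.subset_span ⟨x, hx, rfl⟩
    exact this hx
  rw [this]
  refine homog_span H HM h' _ ?_
  rintro _ ⟨x, ⟨-, e, he⟩, rfl⟩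
  exact ⟨e, hpd x e he⟩

variable (B) in
/-- The defect between the Hilbert function of the extension of `N` along a base change and `ρ`
times the Hilbert function of `N`. -/
def defect (GM : PolyGrading k M) (HM : PolyGrading k M') (ρ : ℤ) (p : M →ₗ[A] M')
    (N : Submodule A M) (n : ℕ) : ℤ :=
  HM.hilb ((Submodule.span B (p '' N)).restrictScalars k) n - ρ * GM.hilb (N.restrictScalars k) n

lemma span_image_sup {p : M →ₗ[A] M'} (N : Submodule A M) (y : M) :
    Submodule.span B (p '' (N ⊔ Submodule.span A {y} : Submodule A M)) =
      Submodule.span B (p '' N) ⊔ Submodule.span B {p y} := by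
  rw [← Submodule.span_union]
  apply le_antisymm
  · rw [Submodule.span_le]
    rintro _ ⟨x, hx, rfl⟩
    obtain ⟨u, hu, v, hv, rfl⟩ := Submodule.mem_sup.1 hx
    obtain ⟨a, rfl⟩ := Submodule.mem_span_singleton.1 hv
    rw [map_add, map_smul, ← IsScalarTower.algebraMap_smul B]
    exact add_mem (Submodule.subset_span (Or.inl ⟨u, hu, rfl⟩))
      (Submodule.smul_mem _ _ (Submodule.subset_span (Or.inr rfl)))
  · refine Submodule.span_mono (Set.union_subset (Set.image_mono (SetLike.coe_subset_coe.2 le_sup_left)) ?_)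
    rintro _ rfl
    exact ⟨y, Submodule.mem_sup_right (Submodule.mem_span_singleton_self y), rfl⟩

lemma defect_step (h : G.Compat H) (hM : G.Compat GM) (h' : H.Compat HM) {p : M →ₗ[A] M'}
    (hp : IsBaseChange B p) (hpd : ∀ y e, y ∈ GM.deg e → p y ∈ HM.deg e)
    [IsNoetherianRing A] [Module.Finite A B] [Module.Finite A M]
    {s : ℕ} {f : Fin s → A} (hf : G.Good f)
    (hfl : ∀ i, Module.Flat A (Localization.Away (f i) ⊗[A] B)) (ρ : ℤ)
    {N : Submodule A M} (hN : GM.Homog (N.restrictScalars k)) {y : M} {e : ℕ}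
    (hy : y ∈ GM.deg e) :
    ∀ᶠ n in atTop, defect B GM HM ρ p N (n + e) =
      defect B GM HM ρ p (N ⊔ Submodule.span A {y}) (n + e) +
      defect B G H ρ (Algebra.linearMap A B) (N.comap (LinearMap.toSpanSingleton A M y)) n := by
  have : IsNoetherianRing B := IsNoetherianRing.of_finite A B
  have : Module.Finite B M' := Module.Finite.equiv hp.equiv
  have hfB := hf.map h
  have hfM := hf.map hM
  have hfM' := hfB.map h'
  have hN' := homog_span_image h' hpd hN
  set N' := Submodule.span B (p '' N) with hN'def
  set c := N.comap (LinearMap.toSpanSingleton A M y) with hc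
  have hle : ∀ x ∈ Submodule.span B (Algebra.linearMap A B '' c),
      x ∈ N'.comap (LinearMap.toSpanSingleton B M' (p y)) := by
    intro x hx
    refine (Submodule.span_le.2 ?_ : _ ≤ N'.comap (LinearMap.toSpanSingleton B M' (p y))) hx
    rintro _ ⟨a, ha, rfl⟩
    change algebraMap A B a • p y ∈ N'
    rw [IsScalarTower.algebraMap_smul, ← map_smul]
    exact Submodule.subset_span ⟨a • y, ha, rfl⟩
  have hev := hfB.eventually_mem H.compat_self
    (N := Submodule.span B (Algebra.linearMap A B '' c)) (h'.homog_colon hN' (hpd y e hy))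
    (fun b hb i => by
      have := hfl i
      obtain ⟨K, hK⟩ := exists_pow_mul_mem_map_colon (f i) p hp N y b hb
      refine ⟨K, ?_⟩
      rw [← map_pow, smul_eq_mul, ← Algebra.smul_def]
      exact hK)
  filter_upwards [hev] with n hn
  have e1 := hM.hilb_step hf.finite hfM.finite hN hy (n := n)
  have e2 := h'.hilb_step hfB.finite hfM'.finite hN' (hpd y e hy) (n := n)
  have e3 : H.hilb ((N'.comap (LinearMap.toSpanSingleton B M' (p y))).restrictScalars k) n =
      H.hilb ((Submodule.span B (Algebra.linearMap A B '' c)).restrictScalars k) n :=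
    hilb_congr fun x hx => ⟨fun hx' => hn x hx hx', hle x⟩
  simp only [defect]
  rw [span_image_sup, e1, e2, e3]
  ring

end Delta

/-- Filtering an algebra by homogeneous submodules, every defect is a multiple of the defect of a
maximal counterexample. -/
lemma exists_defect_eq_mul {k A B M M' : Type*} [Field k] [CommRing A] [Algebra k A] [CommRing B]
    [Algebra k B] [CommRing M] [Algebra k M] [CommRing M'] [Algebra k M']
    [Algebra A B] [Algebra A M] [Algebra A M'] [Algebra B M'] [IsScalarTower A B M']
    [IsScalarTower k A B] [IsScalarTower k A M] [IsScalarTower k B M']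
    {G : PolyGrading k A} {H : PolyGrading k B} {GM : PolyGrading k M} {HM : PolyGrading k M'}
    (h : G.Compat H) (hM : G.Compat GM) (h' : H.Compat HM) {p : M →ₗ[A] M'}
    (hp : IsBaseChange B p) (hpd : ∀ y e, y ∈ GM.deg e → p y ∈ HM.deg e)
    [IsNoetherianRing A] [Module.Finite A B] [Module.Finite A M]
    {s : ℕ} {f : Fin s → A} (hf : G.Good f)
    (hfl : ∀ i, Module.Flat A (Localization.Away (f i) ⊗[A] B)) (ρ : ℤ)
    {I : Ideal A} {c : ℤ}
    (hI : ∀ᶠ n in atTop, defect B G H ρ (Algebra.linearMap A B) I n = c)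
    (hI' : ∀ J : Ideal A, G.Homog (J.restrictScalars k) → I < J →
      ∀ᶠ n in atTop, defect B G H ρ (Algebra.linearMap A B) J n = 0)
    (N : Submodule A M) (hN : GM.Homog (N.restrictScalars k)) (hIN : ∀ a ∈ I, ∀ y : M, a • y ∈ N) :
    ∃ m : ℕ, ∀ᶠ n in atTop, defect B GM HM ρ p N n = m * c := by
  have : IsNoetherian A M := isNoetherian_of_isNoetherianRing_of_finite A M
  induction N using IsNoetherian.induction with
  | hgt N ih =>
  by_cases hNT : N = ⊤
  · refine ⟨0, .of_forall fun n => ?_⟩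
    have : Submodule.span B (p '' N) = ⊤ := by
      rw [hNT, Submodule.top_coe, Set.image_univ, eq_top_iff]
      intro x _
      induction x using hp.inductionOn with
      | zero => exact zero_mem _
      | tmul m => exact Submodule.subset_span ⟨m, rfl⟩
      | smul b x hx => exact Submodule.smul_mem _ _ (hx trivial)
      | add x y hx hy => exact add_mem (hx trivial) (hy trivial)
    rw [defect, this, hNT, Submodule.restrictScalars_top, Submodule.restrictScalars_top,
      hilb_eq_zero fun _ _ => Submodule.mem_top, hilb_eq_zero fun _ _ => Submodule.mem_top]
    simp
  · obtain ⟨y, e, hy, hyN⟩ := Homog.exists_notMem (G := GM) (N := N.restrictScalars k)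
      (fun h => hNT (by simpa using h))
    obtain ⟨m, hm⟩ := ih (N ⊔ Submodule.span A {y})
      (lt_of_le_of_ne le_sup_left fun h => hyN (by
        rw [Submodule.restrictScalars_mem, h]
        exact Submodule.mem_sup_right (Submodule.mem_span_singleton_self y)))
      (hN.sup_span hM hy) (fun a ha z => Submodule.mem_sup_left (hIN a ha z))
    have hstep := defect_step h hM h' hp hpd hf hfl ρ hN hy
    have hIc : I ≤ N.comap (LinearMap.toSpanSingleton A M y) := fun a ha => hIN a ha y
    rcases eq_or_lt_of_le hIc with heq | hlt
    · refine ⟨m + 1, eventually_of_add e ?_⟩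
      filter_upwards [hstep, eventually_add e hm, hI] with n h1 h2 h3
      rw [h1, h2, ← heq, h3]; push_cast; ring
    · refine ⟨m, eventually_of_add e ?_⟩
      filter_upwards [hstep, eventually_add e hm, hI' _ (hM.homog_colon hN hy) hlt] with n h1 h2 h3
      rw [h1, h2, h3, add_zero]

lemma Compat.hilb_of_section {k B C : Type*} [Field k] [CommRing B] [Algebra k B] [CommRing C]
    [Algebra k C] [Algebra B C] [IsScalarTower k B C] {H : PolyGrading k B} {T : PolyGrading k C}
    (h : H.Compat T) [IsNoetherianRing B] [Module.Finite B C] {s : ℕ} {f : Fin s → B}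
    (hf : H.Good f) (μ : C →ₐ[B] B) (hμ : ∀ c, H.coact (μ c) = (T.coact c).map (μ : C →+* B))
    {K : Ideal C} (hK : T.Homog (K.restrictScalars k))
    (hJK : ∀ a ∈ RingHom.ker μ, ∀ b ∈ K, a * b = 0)
    (hfK : ∀ i, ∃ m : ℕ, algebraMap B C (f i) ^ m ∈ RingHom.ker μ ⊔ K)
    {I : Ideal B} (hI : H.Homog (I.restrictScalars k)) {r : ℕ}
    (hr : ∀ᶠ n in atTop, (T.quot K hK).hilb
      ((I.map (algebraMap B (C ⧸ K))).restrictScalars k) n = r * H.hilb (I.restrictScalars k) n) :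
    ∀ᶠ n in atTop, T.hilb ((I.map (algebraMap B C)).restrictScalars k) n =
      (r + 1 : ℕ) * H.hilb (I.restrictScalars k) n := by
  have : IsNoetherianRing C := IsNoetherianRing.of_finite B C
  have hfC := hf.map h
  set IC := I.map (algebraMap B C) with hIC
  set J := RingHom.ker μ with hJdef
  have hICh : T.Homog (IC.restrictScalars k) := hI.map h
  have hJh : T.Homog (J.restrictScalars k) := fun a ha n => by
    change μ ((T.coact a).coeff n) = 0
    have := congrArg (fun q => q.coeff n) (hμ a)
    simp only [coeff_map] at this
    have ha' : μ a = 0 := ha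
    rw [ha', map_zero, coeff_zero] at this
    exact this.symm
  -- the component along the section
  have e1 : ∀ n, H.hilb (I.restrictScalars k) n = T.hilb ((IC ⊔ J).restrictScalars k) n := by
    intro n
    let : Algebra C B := (μ : C →+* B).toAlgebra
    have : IsScalarTower k C B := IsScalarTower.of_algebraMap_eq fun x => by
      change _ = μ _
      rw [IsScalarTower.algebraMap_apply k B C, μ.commutes]; rfl
    have hc : T.Compat H := hμ
    rw [← hc.hilb_comap hfC.finite (fun x => ⟨algebraMap B C x, μ.commutes x⟩)]
    refine hilb_congr fun x _ => ?_
    change μ x ∈ I ↔ x ∈ IC ⊔ J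
    constructor
    · intro hx
      have : x = algebraMap B C (μ x) + (x - algebraMap B C (μ x)) := by ring
      rw [this]
      refine Submodule.add_mem_sup (Ideal.mem_map_of_mem _ hx) ?_
      rw [hJdef, RingHom.mem_ker, map_sub, μ.commutes]; exact sub_self _
    · intro hx
      obtain ⟨u, hu, v, hv, rfl⟩ := Submodule.mem_sup.1 hx
      rw [map_add, show μ v = 0 from hv, add_zero]
      have hle : IC ≤ I.comap (μ : C →+* B) := Ideal.map_le_iff_le_comap.2 fun b hb => by
        rw [Ideal.mem_comap, Ideal.mem_comap]
        change μ (algebraMap B C b) ∈ I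
        rwa [μ.commutes]
      exact hle hu
  -- the complementary component
  have e2 : ∀ n, (T.quot K hK).hilb ((I.map (algebraMap B (C ⧸ K))).restrictScalars k) n =
      T.hilb ((IC ⊔ K).restrictScalars k) n := by
    intro n
    rw [← (T.compat_quot K hK).hilb_comap hfC.finite Ideal.Quotient.mk_surjective]
    refine hilb_congr fun x _ => ?_
    rw [sup_comm IC K, ← Ideal.comap_map_quotientMk, hIC, Ideal.map_map]
    rfl
  have hICJ : T.Homog ((IC ⊔ J).restrictScalars k) := by
    rw [Submodule.restrictScalars_sup]; exact hICh.sup hJh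
  have hICK : T.Homog ((IC ⊔ K).restrictScalars k) := by
    rw [Submodule.restrictScalars_sup]; exact hICh.sup hK
  have e3 := fun n => hilb_sup_add_inf hfC.finite hICJ hICK n
  have e4 := hfC.eventually_mem T.compat_self (N := (IC ⊔ J) ⊔ (IC ⊔ K)) (N' := ⊤) T.homog_top
    (fun y _ i => by
      obtain ⟨m, hm⟩ := hfK i
      exact ⟨m, Ideal.mul_mem_right _ _ ((sup_le_sup le_sup_right le_sup_right : J ⊔ K ≤ _) hm)⟩)
  have e5 := hfC.eventually_mem T.compat_self (N := IC) (N' := (IC ⊔ J) ⊓ (IC ⊔ K))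
    (by rw [Submodule.restrictScalars_inf]; exact hICJ.inf hICK)
    (fun y hy i => by
      obtain ⟨m, hm⟩ := hfK i
      refine ⟨m, ?_⟩
      obtain ⟨j, hj, κ, hκ, hjκ⟩ := Submodule.mem_sup.1 hm
      rw [← hjκ, add_smul]
      refine add_mem ?_ ?_
      · obtain ⟨u, hu, v, hv, rfl⟩ := Submodule.mem_sup.1 hy.2
        rw [smul_add, smul_eq_mul, smul_eq_mul, hJK j hj v hv, add_zero]
        exact Ideal.mul_mem_left _ _ hu
      · obtain ⟨u, hu, v, hv, rfl⟩ := Submodule.mem_sup.1 hy.1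
        rw [smul_add, smul_eq_mul, smul_eq_mul, mul_comm κ v, hJK v hv κ hκ, add_zero]
        exact Ideal.mul_mem_left _ _ hu)
  filter_upwards [hr, e4, e5] with n h1 h2 h3
  have h4 := e3 n
  have h5 : T.hilb (((IC ⊔ J) ⊔ (IC ⊔ K)).restrictScalars k) n = 0 :=
    hilb_eq_zero fun x hx => h2 x hx Submodule.mem_top
  have h6 : T.hilb (((IC ⊔ J) ⊓ (IC ⊔ K)).restrictScalars k) n = T.hilb (IC.restrictScalars k) n :=
    hilb_congr fun x hx => ⟨h3 x hx, fun hx' =>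
      ⟨(le_sup_left : IC ≤ IC ⊔ J) hx', (le_sup_left : IC ≤ IC ⊔ K) hx'⟩⟩
  rw [← e1, ← e2, h1, ← Submodule.restrictScalars_sup, ← Submodule.restrictScalars_inf, h5, h6,
    zero_add] at h4
  rw [h4]; push_cast; ring

end PolyGrading

lemma EtaleRank.one_tmul_eq_zero {L M : Type*} [CommRing L] [CommRing M] [Algebra L M]
    (h : EtaleRank 0 L M) : Subsingleton M := by
  obtain ⟨h1, h2, h3, h4⟩ := h
  refine (Module.rankAtStalk_eq_zero_iff_subsingleton (R := L) (M := M)).1 (funext fun p => ?_)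
  simpa using h4 p

lemma EtaleRank.faithfullyFlat {r : ℕ} {L M : Type*} [CommRing L] [CommRing M] [Algebra L M]
    (h : EtaleRank (r + 1) L M) : Module.FaithfullyFlat L M := by
  obtain ⟨h1, h2, h3, h4⟩ := h
  refine Module.FaithfullyFlat.of_comap_surjective
    (PrimeSpectrum.rankAtStalk_pos_iff_comap_surjective.1 fun p => ?_)
  rw [h4]; omega

lemma EtaleRank.flat_away {r : ℕ} {A B : Type*} [CommRing A] [CommRing B] [Algebra A B] {f : A}
    (h : EtaleRank r (Localization.Away f) (Localization.Away f ⊗[A] B)) :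
    Module.Flat A (Localization.Away f ⊗[A] B) := by
  have := h.flat
  exact Module.Flat.trans A (Localization.Away f) _

lemma EtaleRank.exists_pow_mul_mem {r : ℕ} {A B : Type*} [CommRing A] [CommRing B] [Algebra A B]
    {f : A} (h : EtaleRank (r + 1) (Localization.Away f) (Localization.Away f ⊗[A] B))
    {I : Ideal A} {a : A} (ha : algebraMap A B a ∈ I.map (algebraMap A B)) :
    ∃ m : ℕ, f ^ m * a ∈ I := by
  have := h.faithfullyFlat
  set L := Localization.Away f
  have h1 : algebraMap L (L ⊗[A] B) (algebraMap A L a) ∈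
      (I.map (algebraMap A L)).map (algebraMap L (L ⊗[A] B)) := by
    have h2 := Ideal.mem_map_of_mem
      (Algebra.TensorProduct.includeRight : B →ₐ[A] L ⊗[A] B).toRingHom ha
    rw [Ideal.map_map] at h2 ⊢
    have h3 : (Algebra.TensorProduct.includeRight : B →ₐ[A] L ⊗[A] B).toRingHom.comp
        (algebraMap A B) = (algebraMap L (L ⊗[A] B)).comp (algebraMap A L) := by
      rw [← IsScalarTower.algebraMap_eq]
      ext x
      exact AlgHom.commutes (Algebra.TensorProduct.includeRight : B →ₐ[A] L ⊗[A] B) x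
    rw [← h3]
    rw [← RingHom.comp_apply, h3] at h2
    rwa [← RingHom.comp_apply, h3]
  rw [← Ideal.mem_comap, Ideal.comap_map_eq_self_of_faithfullyFlat,
    IsLocalization.algebraMap_mem_map_algebraMap_iff (Submonoid.powers f)] at h1
  obtain ⟨_, ⟨m, rfl⟩, hm⟩ := h1
  exact ⟨m, hm⟩

lemma EtaleRank.tensor_self {r : ℕ} {A B : Type u} [CommRing A] [CommRing B] [Algebra A B] (f : A)
    (h : EtaleRank r (Localization.Away f) (Localization.Away f ⊗[A] B)) :
    EtaleRank r (Localization.Away (algebraMap A B f))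
      (Localization.Away (algebraMap A B f) ⊗[B] (B ⊗[A] B)) := by
  set L := Localization.Away f
  set L' := Localization.Away (algebraMap A B f)
  have hu : IsUnit (algebraMap A L' f) := by
    rw [IsScalarTower.algebraMap_apply A B L']
    exact IsLocalization.Away.algebraMap_isUnit _
  let : Algebra L L' := (IsLocalization.Away.lift (S := L) f hu).toAlgebra
  have : IsScalarTower A L L' := IsScalarTower.of_algebraMap_eq fun x =>
    (IsLocalization.Away.lift_eq f hu x).symm
  exact ((h.baseChange L').equiv (Algebra.TensorProduct.cancelBaseChange A L L' L' B)).equiv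
    (Algebra.TensorProduct.cancelBaseChange A B L' L' B).symm

namespace PolyGrading

lemma span_image_mk_map {A B : Type*} [CommRing A] [CommRing B] [Algebra A B] (I : Ideal A) :
    Submodule.span B (TensorProduct.mk A B B 1 '' (I.map (algebraMap A B))) =
      ((I.map (algebraMap A B)).map (algebraMap B (B ⊗[A] B))).restrictScalars B := by
  let iR : B →+* B ⊗[A] B := (Algebra.TensorProduct.includeRight : B →ₐ[A] B ⊗[A] B).toRingHom
  have hLR : iR.comp (algebraMap A B) = algebraMap A (B ⊗[A] B) := by
    ext a
    exact AlgHom.commutes (Algebra.TensorProduct.includeRight : B →ₐ[A] B ⊗[A] B) a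
  rw [Ideal.map_map, ← IsScalarTower.algebraMap_eq]
  apply le_antisymm
  · rw [Submodule.span_le]
    rintro _ ⟨x, hx, rfl⟩
    have := Ideal.mem_map_of_mem iR hx
    rw [Ideal.map_map, hLR] at this
    exact this
  · intro x hx
    suffices h : ∀ c, c * x ∈ Submodule.span B
        (TensorProduct.mk A B B 1 '' (I.map (algebraMap A B) : Ideal B)) by
      simpa using h 1
    rw [Submodule.restrictScalars_mem] at hx
    induction hx using Submodule.span_induction with
    | mem x hx =>
      obtain ⟨a, ha, rfl⟩ := hx
      intro c
      induction c using TensorProduct.induction_on with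
      | zero => simp
      | add x y hx hy => rw [add_mul]; exact add_mem hx hy
      | tmul b b' =>
        rw [mul_comm, ← Algebra.smul_def, ← tmul_smul]
        have : b ⊗ₜ[A] (a • b') = b • TensorProduct.mk A B B 1 (a • b') := by
          rw [TensorProduct.mk_apply, smul_tmul', smul_eq_mul, mul_one]
        rw [this]
        refine Submodule.smul_mem _ _ (Submodule.subset_span ⟨_, ?_, rfl⟩)
        rw [Algebra.smul_def]
        exact Ideal.mul_mem_right _ _ (Ideal.mem_map_of_mem _ ha)
    | zero => intro c; rw [mul_zero]; exact zero_mem _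
    | add x y _ _ hx hy => intro c; rw [mul_add]; exact add_mem (hx c) (hy c)
    | smul d x _ hx => intro c; rw [smul_eq_mul, ← mul_assoc]; exact hx _

/-- An étale homomorphism of rank `r` away from the vanishing locus of `f` multiplies Hilbert
functions by `r`. -/
theorem hilb_map {k : Type v} [Field k] (r : ℕ) : ∀ {A B : Type u} [CommRing A] [Algebra k A]
    [CommRing B] [Algebra k B] [Algebra A B] [IsScalarTower k A B] [IsNoetherianRing A]
    [Module.Finite A B] {G : PolyGrading k A} {H : PolyGrading k B} (_ : G.Compat H)
    {s : ℕ} {f : Fin s → A} (_ : G.Good f)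
    (_ : ∀ i, EtaleRank r (Localization.Away (f i)) (Localization.Away (f i) ⊗[A] B))
    (I : Ideal A) (_ : G.Homog (I.restrictScalars k)),
    ∀ᶠ n in atTop, H.hilb ((I.map (algebraMap A B)).restrictScalars k) n =
      r * G.hilb (I.restrictScalars k) n := by
  induction r with
  | zero =>
    intro A B _ _ _ _ _ _ _ _ G H h s f hf hE I hI
    have := hf.eventually_mem h (N := (I.map (algebraMap A B)).restrictScalars A) (N' := ⊤)
      H.homog_top fun y _ i => by
        have := (hE i).one_tmul_eq_zero
        obtain ⟨m, hm⟩ := exists_pow_smul_eq_zero_of_one_tmul (f i) y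
          (Subsingleton.elim ((1 : Localization.Away (f i)) ⊗ₜ[A] y) 0)
        exact ⟨m, hm ▸ zero_mem _⟩
    filter_upwards [this] with n hn
    rw [hilb_eq_zero fun x hx => hn x hx Submodule.mem_top]; simp
  | succ r ihr =>
    intro A B _ _ _ _ _ _ _ _ G H h s f hf hE I
    have hfl := fun i => (hE i).flat_away
    have : IsNoetherianRing B := IsNoetherianRing.of_finite A B
    have hfB := hf.map h
    suffices key : G.Homog (I.restrictScalars k) → ∀ᶠ n in atTop,
        defect B G H (r + 1 : ℕ) (Algebra.linearMap A B) I n = 0 by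
      intro hI
      filter_upwards [key hI] with n hn
      exact sub_eq_zero.1 hn
    induction I using IsNoetherian.induction with
    | hgt I ih =>
    intro hI
    have hpd : ∀ y e, y ∈ G.deg e → Algebra.linearMap A B y ∈ H.deg e :=
      fun y e hy => h.algebraMap_mem hy
    have hstep := fun {y : A} {e : ℕ} (hy : y ∈ G.deg e) => defect_step h G.compat_self H.compat_self
      (IsBaseChange.linearMap A B) hpd hf hfl (r + 1 : ℕ) hI hy
    have hcle : ∀ y : A, I ≤ I.comap (LinearMap.toSpanSingleton A A y) :=
      fun y a ha => Ideal.mul_mem_right y I ha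
    have hlt : ∀ {y : A}, y ∉ I → I < I ⊔ Submodule.span A {y} := fun {y} hyI =>
      lt_of_le_of_ne le_sup_left fun h => hyI (by
        rw [h]; exact Submodule.mem_sup_right (Submodule.mem_span_singleton_self y))
    by_cases hc : ∃ y e, y ∈ G.deg e ∧ y ∉ I ∧ I ≠ I.comap (LinearMap.toSpanSingleton A A y)
    · obtain ⟨y, e, hy, hyI, hne⟩ := hc
      refine eventually_of_add e ?_
      filter_upwards [hstep hy, eventually_add e (ih _ (hlt hyI) (hI.sup_span G.compat_self hy)),
        ih _ (lt_of_le_of_ne (hcle y) hne) (G.compat_self.homog_colon hI hy)] with n h1 h2 h3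
      rw [h1, h2, h3, add_zero]
    push Not at hc
    by_cases hfI : ∀ i, f i ∈ I
    · have hle : Ideal.span (Set.range fun i => f i ^ 1) ≤ I := by
        rw [Ideal.span_le]
        rintro _ ⟨i, rfl⟩
        simpa using hfI i
      have hle' : Ideal.span (Set.range fun i => algebraMap A B (f i) ^ 1) ≤
          Ideal.map (algebraMap A B) I := by
        rw [Ideal.span_le]
        rintro _ ⟨i, rfl⟩
        simpa using Ideal.mem_map_of_mem _ (hfI i)
      filter_upwards [hf.eventually 1, hfB.eventually 1] with n h1 h2
      have e1 : G.hilb (I.restrictScalars k) n = 0 := hilb_eq_zero fun x hx => hle (h1 x hx)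
      have e2 : H.hilb ((Ideal.map (algebraMap A B) I).restrictScalars k) n = 0 :=
        hilb_eq_zero fun x hx => hle' (h2 x hx)
      change H.hilb ((Ideal.map (algebraMap A B) I).restrictScalars k) n - _ * _ = 0
      rw [e1, e2, mul_zero, sub_zero]
    push Not at hfI
    obtain ⟨i, hi⟩ := hfI
    have hmul : ∀ (m : ℕ) (a : A), f i ^ m * a ∈ I → a ∈ I := by
      intro m
      induction m with
      | zero => intro a ha; simpa using ha
      | succ m ihm =>
        intro a ha
        have h1 : f i ^ m * a ∈ I.comap (LinearMap.toSpanSingleton A A (f i)) := by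
          change f i ^ m * a * f i ∈ I
          rwa [mul_right_comm, ← pow_succ]
        rw [← hc _ _ (hf.mem i) hi] at h1
        exact ihm a h1
    -- the defect of `I` is eventually constant
    obtain ⟨c, hconst⟩ : ∃ c : ℤ, ∀ᶠ n in atTop,
        defect B G H (r + 1 : ℕ) (Algebra.linearMap A B) I n = c := by
      obtain ⟨n₀, hn₀⟩ := eventually_atTop.1 ((hstep (hf.mem i)).and
        (eventually_add 1 (ih _ (hlt hi) (hI.sup_span G.compat_self (hf.mem i)))))
      refine ⟨defect B G H (r + 1 : ℕ) (Algebra.linearMap A B) I n₀,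
        eventually_atTop.2 ⟨n₀, fun n hn => ?_⟩⟩
      induction n, hn using Nat.le_induction with
      | base => rfl
      | succ n hn ihn =>
        obtain ⟨h1, h2⟩ := hn₀ n hn
        rw [h1, h2, ← hc _ _ (hf.mem i) hi, zero_add, ihn]
    obtain ⟨T, hT, hTR⟩ := h.exists_tensor
    have hpB : IsBaseChange B (TensorProduct.mk A B B 1) := TensorProduct.isBaseChange A B B
    have hpd' : ∀ y e, y ∈ H.deg e → TensorProduct.mk A B B 1 y ∈ T.deg e := fun y e hy => by
      rw [mem_deg, TensorProduct.mk_apply, hTR, show H.coact y = monomial e y from hy, map_monomial]; rfl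
    have hIB := hI.map h
    have hIBA : H.Homog (((Ideal.map (algebraMap A B) I).restrictScalars A).restrictScalars k) := hIB
    have hcolon : ((Ideal.map (algebraMap A B) I).restrictScalars A).comap
        (LinearMap.toSpanSingleton A B 1) = I := by
      refine le_antisymm (fun a ha => ?_) fun a ha => ?_
      · have ha' : algebraMap A B a ∈ Ideal.map (algebraMap A B) I := by
          rw [Algebra.algebraMap_eq_smul_one]; exact ha
        obtain ⟨m, hm⟩ := (hE i).exists_pow_mul_mem ha'
        exact hmul m a hm
      · change a • (1 : B) ∈ Ideal.map (algebraMap A B) I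
        rw [← Algebra.algebraMap_eq_smul_one]
        exact Ideal.mem_map_of_mem _ ha
    have hstep' := defect_step h h hT hpB hpd' hf hfl (r + 1 : ℕ) hIBA H.one_mem_deg
    rw [hcolon] at hstep'
    obtain ⟨m, hm⟩ := exists_defect_eq_mul h h hT hpB hpd' hf hfl (r + 1 : ℕ) hconst
      (fun J hJ hIJ => ih J hIJ hJ) _ (hIBA.sup_span h H.one_mem_deg) (fun a ha y => by
        refine Submodule.mem_sup_left ?_
        change a • y ∈ Ideal.map (algebraMap A B) I
        rw [Algebra.smul_def]
        exact Ideal.mul_mem_right _ _ (Ideal.mem_map_of_mem _ ha))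
    have hC : ∀ᶠ n in atTop, defect B H T (r + 1 : ℕ) (TensorProduct.mk A B B 1)
        ((Ideal.map (algebraMap A B) I).restrictScalars A) n = 0 := by
      let C := B ⊗[A] B
      have : IsNoetherianRing C := IsNoetherianRing.of_finite B C
      let μ : C →ₐ[B] B := Algebra.TensorProduct.lmul'' A
      have hμL : ∀ b : B, μ (algebraMap B C b) = b := μ.commutes
      have hμR : ∀ b : B, μ (1 ⊗ₜ b) = b := fun b =>
        (Algebra.TensorProduct.lmul'_apply_tmul (R := A) 1 b).trans (one_mul b)
      have hμ : ∀ c, H.coact (μ c) = (T.coact c).map (μ : C →+* B) := fun c => by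
        induction c using TensorProduct.induction_on with
        | zero => simp
        | add x y hx hy => rw [map_add, map_add, map_add, Polynomial.map_add, hx, hy]
        | tmul b b' =>
          have hsplit : (b ⊗ₜ b' : C) = algebraMap B C b * 1 ⊗ₜ b' := by
            rw [Algebra.TensorProduct.algebraMap_apply, Algebra.TensorProduct.tmul_mul_tmul, mul_one,
              one_mul]; rfl
          have e1 : (μ : C →+* B).comp (algebraMap B C) = RingHom.id B := RingHom.ext hμL
          have e2 : (μ : C →+* B).comp
              (Algebra.TensorProduct.includeRight : B →ₐ[A] B ⊗[A] B).toRingHom = RingHom.id B :=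
            RingHom.ext hμR
          rw [hsplit, map_mul, map_mul, map_mul, hμL, hμR, hT, hTR, Polynomial.map_mul,
            Polynomial.map_map, Polynomial.map_map, e1, e2, Polynomial.map_id, Polynomial.map_id]
      have hJ : T.Homog ((RingHom.ker μ).restrictScalars k) := fun a ha n => by
        change μ ((T.coact a).coeff n) = 0
        have := congrArg (fun q => q.coeff n) (hμ a)
        simp only [coeff_map] at this
        have ha' : μ a = 0 := ha
        rw [ha', map_zero, coeff_zero] at this
        exact this.symm
      have hsp := fun i => EtaleRank.split_away μ (algebraMap A B (f i))
        (Localization.Away (algebraMap A B (f i))) (EtaleRank.tensor_self (f i) (hE i))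
      have hK := hJ.annihilator
      have hquot : H.Compat (T.quot _ hK) := fun b => by
        rw [IsScalarTower.algebraMap_apply B C, T.compat_quot, hT, Polynomial.map_map,
          ← IsScalarTower.algebraMap_eq]
      have hr := ihr hquot hfB (fun i => (hsp i).2) _ hIB
      have hJK : ∀ a ∈ RingHom.ker μ, ∀ b ∈ Module.annihilator C (RingHom.ker μ), a * b = 0 :=
        fun a ha b hb => by
          rw [mul_comm]
          exact congrArg Subtype.val (Module.mem_annihilator.1 hb ⟨a, ha⟩)
      filter_upwards [hT.hilb_of_section hfB μ hμ hK hJK (fun i => (hsp i).1) hIB hr] with n hn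
      rw [defect, Submodule.coe_restrictScalars, span_image_mk_map]
      exact sub_eq_zero.2 hn
    obtain ⟨n, h1, h2, h3, h4⟩ := (hstep'.and (hm.and (hC.and hconst))).exists
    simp only [add_zero] at h1
    rw [h2, h3, h4] at h1
    have : c = 0 := by
      have h5 : ((m : ℤ) + 1) * c = 0 := by linarith
      rcases mul_eq_zero.1 h5 with h6 | h6
      · omega
      · exact h6
    rwa [this] at hconst

end PolyGrading

lemma finiteDimensional_quotient_of_isIntegral {k A ι : Type*} [Field k] [CommRing A] [Algebra k A]
    [Algebra.FiniteType k A] (F : ι → A)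
    (hF_int : ∀ a : A, IsIntegral (Algebra.adjoin k (Set.range F)) a) (J : Ideal A)
    (hJ : ∀ i, ∃ n : ℕ, F i ^ n ∈ J) : FiniteDimensional k (A ⧸ J) := by
  have hF : ∀ i, IsIntegral k (Ideal.Quotient.mk J (F i)) := by
    intro i
    obtain ⟨n, hn⟩ := hJ i
    refine ⟨X ^ n, monic_X_pow n, ?_⟩
    rw [eval₂_X_pow, ← map_pow, Ideal.Quotient.eq_zero_iff_mem]
    exact hn
  let C : Subalgebra k A := (integralClosure k (A ⧸ J)).comap (Ideal.Quotient.mkₐ k J)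
  have hC : Algebra.adjoin k (Set.range F) ≤ C := Algebra.adjoin_le (by
    rintro _ ⟨i, rfl⟩
    exact hF i)
  have : Algebra.IsIntegral k (A ⧸ J) := by
    refine ⟨fun x => ?_⟩
    obtain ⟨a, rfl⟩ := Ideal.Quotient.mk_surjective x
    have h1 : IsIntegral (integralClosure k (A ⧸ J)) (Ideal.Quotient.mk J a) := by
      obtain ⟨p, hp, h0⟩ := hF_int a
      let g : Algebra.adjoin k (Set.range F) →+* integralClosure k (A ⧸ J) :=
        ((Ideal.Quotient.mk J).comp (algebraMap (Algebra.adjoin k (Set.range F)) A)).codRestrict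
          (integralClosure k (A ⧸ J)) (fun x => hC x.2)
      refine ⟨p.map g, hp.map g, ?_⟩
      rw [eval₂_map]
      have : (algebraMap (integralClosure k (A ⧸ J)) (A ⧸ J)).comp g =
        (Ideal.Quotient.mk J).comp (algebraMap (Algebra.adjoin k (Set.range F)) A) := rfl
      rw [this, ← hom_eval₂, h0, map_zero]
    exact isIntegral_trans (R := k) (A := integralClosure k (A ⧸ J)) _ h1
  have : Algebra.FiniteType k (A ⧸ J) :=
    .of_surjective (Ideal.Quotient.mkₐ k J) Ideal.Quotient.mk_surjective
  exact Algebra.IsIntegral.finite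

lemma PolyGrading.Good.of_isIntegral {k A : Type*} [Field k] [CommRing A] [Algebra k A]
    [Algebra.FiniteType k A] (G : PolyGrading k A) {s : ℕ} (f : Fin s → A)
    (hf : ∀ i, f i ∈ G.deg 1)
    (hF_int : ∀ a : A, IsIntegral (Algebra.adjoin k (Set.range f)) a) : G.Good f := by
  have hfd (K : ℕ) : FiniteDimensional k (A ⧸ Ideal.span (Set.range fun i => f i ^ K)) :=
    finiteDimensional_quotient_of_isIntegral f hF_int _
      fun i => ⟨K, Ideal.subset_span ⟨i, rfl⟩⟩
  have hcoeff (K n : ℕ) (h : n < K) (a : A)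
      (ha : a ∈ Ideal.span (Set.range fun i => f i ^ K)) : G.comp n a = 0 := by
    induction ha using Submodule.span_induction with
    | mem x hx =>
      obtain ⟨i, rfl⟩ := hx
      have := G.pow_mem_deg (hf i) K
      simp only [mul_one] at this
      exact G.comp_of_mem_ne this h.ne'
    | zero => simp
    | add x y _ _ hx hy => rw [map_add, hx, hy, add_zero]
    | smul b x hx ih =>
      have hd : X ^ K ∣ G.coact x := by
        clear ih
        induction hx using Submodule.span_induction with
        | mem x hx =>
          obtain ⟨i, rfl⟩ := hx
          have := G.pow_mem_deg (hf i) K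
          simp only [mul_one] at this
          rw [G.mem_deg.1 this, ← C_mul_X_pow_eq_monomial]
          exact Dvd.intro_left _ rfl
        | zero => simp
        | add x y _ _ hx hy => rw [map_add]; exact dvd_add hx hy
        | smul b x _ ih => rw [smul_eq_mul, map_mul]; exact ih.mul_left _
      have : X ^ K ∣ G.coact (b • x) := by rw [smul_eq_mul, map_mul]; exact hd.mul_left _
      exact X_pow_dvd_iff.1 this n h
  refine ⟨hf, fun n => ?_, fun K => ?_⟩
  · have := hfd (n + 1)
    refine FiniteDimensional.of_injective
      ((Ideal.Quotient.mkₐ k (Ideal.span (Set.range fun i => f i ^ (n + 1)))).toLinearMap.comp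
        (G.deg n).subtype) ?_
    rw [← LinearMap.ker_eq_bot, LinearMap.ker_eq_bot']
    intro a ha
    have h1 : (a : A) ∈ Ideal.span (Set.range fun i => f i ^ (n + 1)) :=
      Ideal.Quotient.eq_zero_iff_mem.1 ha
    have h2 := hcoeff _ n n.lt_succ_self _ h1
    rw [G.comp_of_mem a.2] at h2
    exact Subtype.ext h2
  · have := hfd K
    set J := Ideal.span (Set.range fun i => f i ^ K) with hJ
    obtain ⟨S, hS⟩ := (Module.Finite.fg_top : (⊤ : Submodule k (A ⧸ J)).FG)
    have hlift (q : A ⧸ J) : ∃ a : A, Ideal.Quotient.mk J a = q := Ideal.Quotient.mk_surjective q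
    choose ρ hρ using hlift
    have hJcomp (n : ℕ) (a : A) (ha : a ∈ J) : G.comp n a ∈ J := by
      induction ha using Submodule.span_induction generalizing n with
      | mem x hx =>
        obtain ⟨i, rfl⟩ := hx
        have h := G.pow_mem_deg (hf i) K
        by_cases h' : K * 1 = n
        · subst h'
          rw [G.comp_of_mem h]
          exact Ideal.subset_span ⟨i, rfl⟩
        · rw [G.comp_of_mem_ne h h']; exact J.zero_mem
      | zero => simp
      | add x y _ _ hx hy => rw [map_add]; exact J.add_mem (hx n) (hy n)
      | smul b x _ ih =>
        change (G.coact (b • x)).coeff n ∈ J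
        rw [smul_eq_mul, map_mul, coeff_mul]
        exact J.sum_mem fun p _ => J.mul_mem_left _ (ih p.2)
    let N := S.sup fun q => (G.coact (ρ q)).natDegree
    filter_upwards [eventually_gt_atTop N] with n hn a ha
    have key : ∀ q : A ⧸ J, ∃ b : A, Ideal.Quotient.mk J b = q ∧ G.comp n b = 0 := by
      intro q
      have hq : q ∈ Submodule.span k (S : Set (A ⧸ J)) := by rw [hS]; trivial
      induction hq using Submodule.span_induction with
      | mem x hx =>
        refine ⟨ρ x, hρ x, ?_⟩
        exact coeff_eq_zero_of_natDegree_lt (lt_of_le_of_lt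
          (Finset.le_sup (f := fun q => (G.coact (ρ q)).natDegree) hx) hn)
      | zero => exact ⟨0, by simp, by simp⟩
      | add x y _ _ hx hy =>
        obtain ⟨b, hb, hb'⟩ := hx
        obtain ⟨c, hc, hc'⟩ := hy
        exact ⟨b + c, by rw [map_add, hb, hc], by rw [map_add, hb', hc', add_zero]⟩
      | smul c x _ ih =>
        obtain ⟨b, hb, hb'⟩ := ih
        refine ⟨c • b, ?_, by rw [map_smul, hb', smul_zero]⟩
        rw [← hb]
        exact map_smul (Ideal.Quotient.mkₐ k J) c b
    obtain ⟨b, hb, hb'⟩ := key (Ideal.Quotient.mk J a)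
    have h3 : a - b ∈ J := Ideal.Quotient.eq.1 hb.symm
    have h4 := hJcomp n _ h3
    rwa [map_sub, hb', sub_zero, G.comp_of_mem ha] at h4

lemma Module.Finite.of_isRelPrime_pow_smul_mem {S M : Type*} [CommRing S] [IsDomain S]
    [IsNoetherianRing S] [DecompositionMonoid S] [AddCommGroup M] [Module S M]
    [Module.IsTorsionFree S M]
    (N : Submodule S M) [Module.Finite S N] {p q : S} (hp : p ≠ 0) (hpq : IsRelPrime p q)
    (h : ∀ y : M, ∃ n : ℕ, p ^ n • y ∈ N ∧ q ^ n • y ∈ N) : Module.Finite S M := by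
  classical
  obtain ⟨T, hT⟩ := (Module.Finite.iff_fg.1 ‹Module.Finite S N›)
  obtain ⟨I, hI, hmax⟩ := exists_maximal_linearIndepOn S (fun t : T => (t : M))
  choose! a ha0 ha using hmax
  let s : S := ∏ t : T, if t ∈ I then 1 else a t
  have hs0 : s ≠ 0 := by
    refine Finset.prod_ne_zero_iff.2 fun t _ => ?_
    split_ifs with h'
    · exact one_ne_zero
    · exact ha0 t h'
  set N' : Submodule S M := Submodule.span S ((fun t : T => (t : M)) '' I) with hN'
  have hsN : ∀ y ∈ N, s • y ∈ N' := by
    intro y hy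
    rw [← hT] at hy
    induction hy using Submodule.span_induction with
    | mem x hx =>
      have : s = (∏ t ∈ Finset.univ.erase (⟨x, hx⟩ : T), if t ∈ I then 1 else a t) *
          (if (⟨x, hx⟩ : T) ∈ I then 1 else a ⟨x, hx⟩) :=
        (Finset.prod_erase_mul _ _ (Finset.mem_univ _)).symm
      rw [this, mul_smul]
      refine N'.smul_mem _ ?_
      split_ifs with h'
      · rw [one_smul]; exact Submodule.subset_span ⟨_, h', rfl⟩
      · exact ha _ h'
    | zero => simp
    | add x y _ _ hx hy => rw [smul_add]; exact N'.add_mem hx hy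
    | smul c x _ ih => rw [smul_comm]; exact N'.smul_mem _ ih
  have hli : LinearIndependent S (fun t : I => ((t : T) : M)) := hI
  have hN'' : N' = Submodule.span S (Set.range fun t : I => ((t : T) : M)) := by
    rw [hN', Set.image_eq_range]
  have hsM : ∀ y : M, s • y ∈ N' := by
    intro y
    obtain ⟨n, h1, h2⟩ := h y
    have h1' := hsN _ h1
    have h2' := hsN _ h2
    rw [hN''] at h1' h2' ⊢
    rw [Submodule.mem_span_range_iff_exists_fun] at h1' h2' ⊢
    obtain ⟨c, hc⟩ := h1'
    obtain ⟨e, he⟩ := h2'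
    have hce : ∀ t, q ^ n * c t = p ^ n * e t := by
      intro t
      refine congrFun (hli.fintypeLinearCombination_injective
        (a₁ := fun t => q ^ n * c t) (a₂ := fun t => p ^ n * e t) ?_) t
      simp only [Fintype.linearCombination_apply, mul_smul, ← Finset.smul_sum]
      rw [hc, he]
      simp only [smul_smul]
      congr 1
      ring
    have hdvd : ∀ t, p ^ n ∣ c t := fun t =>
      (IsRelPrime.pow hpq : IsRelPrime (p ^ n) (q ^ n)).dvd_of_dvd_mul_left ⟨e t, hce t⟩
    choose c' hc' using hdvd
    refine ⟨c', ?_⟩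
    have : p ^ n • (∑ t, c' t • ((t : T) : M)) = p ^ n • s • y := by
      rw [Finset.smul_sum, smul_comm, ← hc]
      exact Finset.sum_congr rfl fun t _ => by rw [smul_smul, ← hc']
    exact smul_right_injective M (pow_ne_zero n hp) this
  have : Module.Finite S N' := by
    rw [hN'']; exact Module.Finite.span_of_finite S (Set.finite_range _)
  refine Module.Finite.of_injective
    ((LinearMap.lsmul S M s).codRestrict N' hsM) fun x y hxy => ?_
  exact smul_right_injective M hs0 (congrArg Subtype.val hxy)

lemma MvPolynomial.isRelPrime_of_degreeOf {k σ : Type*} [Field k] {i j : σ}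
    (p q : MvPolynomial σ k) (hp0 : p ≠ 0) (hq0 : q ≠ 0) (hij : i ≠ j)
    (hp : ∀ l, l ≠ i → p.degreeOf l = 0) (hq : ∀ l, l ≠ j → q.degreeOf l = 0) :
    IsRelPrime p q := by
  rintro h ⟨a, rfl⟩ ⟨b, rfl⟩
  have h0 := left_ne_zero_of_mul hp0
  have key : ∀ l, h.degreeOf l = 0 := by
    intro l
    by_cases hl : l = i
    · have := hq l (by rw [hl]; exact hij)
      rw [degreeOf_mul_eq h0 (right_ne_zero_of_mul hq0)] at this
      omega
    · have := hp l hl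
      rw [degreeOf_mul_eq h0 (right_ne_zero_of_mul hp0)] at this
      omega
  have hv : h.vars = ∅ := by
    ext l
    simp [mem_vars_iff_degreeOf_ne_zero, key]
  rw [vars_eq_empty_iff_eq_C] at hv
  rw [hv] at h0 ⊢
  exact (isUnit_iff_ne_zero.2 fun h => h0 (by rw [h, map_zero])).map C

lemma MvPolynomial.degreeOf_aeval_X {k σ : Type*} [Field k] {i l : σ} (p : k[X]) (h : l ≠ i) :
    (Polynomial.aeval (MvPolynomial.X i : MvPolynomial σ k) p).degreeOf l = 0 := by
  have h1 : Polynomial.aeval (MvPolynomial.X i : MvPolynomial σ k) p ∈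
      MvPolynomial.supported k {i} := by
    rw [MvPolynomial.supported, Set.image_singleton]
    exact aeval_mem_adjoin_singleton k _
  rw [MvPolynomial.mem_supported] at h1
  by_contra h2
  exact h (h1 (MvPolynomial.mem_vars_iff_degreeOf_ne_zero.2 h2))

lemma two_le_of_algebraicIndependent {k A : Type*} [Field k] [CommRing A] [IsDomain A] [Algebra k A]
    {t : ℕ} (g : MvPolynomial (Fin t) k →ₐ[k] A) (hg : Function.Injective g) (hfin : g.Finite)
    {x : Fin 2 → A} (hx : AlgebraicIndependent k x) : 2 ≤ t := by
  let _ : Algebra (MvPolynomial (Fin t) k) A := g.toRingHom.toAlgebra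
  have : IsScalarTower k (MvPolynomial (Fin t) k) A := .of_algHom g
  have : Module.Finite (MvPolynomial (Fin t) k) A := hfin
  have : FaithfulSMul (MvPolynomial (Fin t) k) A :=
    (faithfulSMul_iff_algebraMap_injective _ _).2 hg
  have h1 := lift_trdeg_add_eq k (MvPolynomial (Fin t) k) A
  rw [MvPolynomial.trdeg_of_isDomain, trdeg_eq_zero (R := MvPolynomial (Fin t) k)] at h1
  have h2 := hx.lift_cardinalMk_le_trdeg
  simp at h1 h2
  rw [← h1] at h2
  simpa using h2

lemma Algebra.FiniteType.of_pow_mul_mem {k R : Type*} [Field k] [CommRing R] [IsDomain R]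
    [Algebra k R] (A₀ : Subalgebra k R) (hfg : A₀.FG) {ι : Type*} (F : ι → A₀)
    (hF_int : ∀ a : A₀, IsIntegral (Algebra.adjoin k (Set.range F)) a)
    (hex : ∀ i (y : R), ∃ n : ℕ, (F i : R) ^ n * y ∈ A₀)
    {x : Fin 2 → A₀} (hx : AlgebraicIndependent k x) : Algebra.FiniteType k R := by
  have : Algebra.FiniteType k A₀ := A₀.fg_iff_finiteType.1 hfg
  obtain ⟨t, g, hg, hgf⟩ := exists_finite_inj_algHom_of_fg k A₀
  have ht := two_le_of_algebraicIndependent g hg hgf hx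
  let J : Ideal A₀ := Ideal.span (Set.range F)
  have : FiniteDimensional k (A₀ ⧸ J) := finiteDimensional_quotient_of_isIntegral F hF_int J
    fun i => ⟨1, by rw [pow_one]; exact Ideal.subset_span ⟨i, rfl⟩⟩
  have hex' : ∀ a ∈ J, ∀ y : R, ∃ n : ℕ, (a : R) ^ n * y ∈ A₀ := by
    intro a ha y
    let I : Ideal A₀ :=
      { carrier := {a | (a : R) * y ∈ A₀}
        add_mem' := fun {a b} ha hb => by
          have := A₀.add_mem ha hb
          rwa [← add_mul] at this
        zero_mem' := by simp
        smul_mem' := fun c a ha => by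
          have := A₀.mul_mem c.2 ha
          rwa [← mul_assoc] at this }
    have hJ : J ≤ I.radical := Ideal.span_le.2 (by
      rintro _ ⟨i, rfl⟩
      obtain ⟨n, hn⟩ := hex i y
      exact ⟨n, by simpa [I] using hn⟩)
    obtain ⟨n, hn⟩ := hJ ha
    exact ⟨n, by simpa [I] using hn⟩
  have hpoly : ∀ i : Fin t, ∃ p : k[X], p ≠ 0 ∧
      g (Polynomial.aeval (MvPolynomial.X i) p) ∈ J := by
    intro i
    obtain ⟨p, hp, h0⟩ := Algebra.IsIntegral.isIntegral (R := k)
      (Ideal.Quotient.mkₐ k J (g (MvPolynomial.X i)))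
    refine ⟨p, hp.ne_zero, ?_⟩
    rw [← Ideal.Quotient.eq_zero_iff_mem, ← Ideal.Quotient.mkₐ_eq_mk k]
    rw [← aeval_def, ← AlgHom.comp_apply, aeval_algHom_apply] at h0
    rw [← h0]; rfl
  let i0 : Fin t := ⟨0, by omega⟩
  let i1 : Fin t := ⟨1, by omega⟩
  obtain ⟨p, hp, hpJ⟩ := hpoly i0
  obtain ⟨q, hq, hqJ⟩ := hpoly i1
  have hne (i : Fin t) {p : k[X]} (hp : p ≠ 0) :
      Polynomial.aeval (MvPolynomial.X i : MvPolynomial (Fin t) k) p ≠ 0 := fun h =>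
    hp ((transcendental_iff.1 (MvPolynomial.transcendental_X k i)) p h)
  set P := Polynomial.aeval (MvPolynomial.X i0 : MvPolynomial (Fin t) k) p
  set Q := Polynomial.aeval (MvPolynomial.X i1 : MvPolynomial (Fin t) k) q
  have hPQ : IsRelPrime P Q := MvPolynomial.isRelPrime_of_degreeOf P Q (hne _ hp) (hne _ hq)
    (i := i0) (j := i1) (by simp [i0, i1, Fin.ext_iff])
    (fun l hl => MvPolynomial.degreeOf_aeval_X p hl)
    (fun l hl => MvPolynomial.degreeOf_aeval_X q hl)
  let _ : Algebra (MvPolynomial (Fin t) k) A₀ := g.toRingHom.toAlgebra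
  let _ : Algebra (MvPolynomial (Fin t) k) R := (A₀.val.comp g).toRingHom.toAlgebra
  have : IsScalarTower (MvPolynomial (Fin t) k) A₀ R := .of_algebraMap_eq fun _ => rfl
  have : IsScalarTower k (MvPolynomial (Fin t) k) R := .of_algHom (A₀.val.comp g)
  have : Module.Finite (MvPolynomial (Fin t) k) A₀ := hgf
  have : FaithfulSMul (MvPolynomial (Fin t) k) R :=
    (faithfulSMul_iff_algebraMap_injective _ _).2 (Subtype.val_injective.comp hg)
  let N : Submodule (MvPolynomial (Fin t) k) R :=
    LinearMap.range (IsScalarTower.toAlgHom (MvPolynomial (Fin t) k) A₀ R).toLinearMap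
  have hN : ∀ y : R, y ∈ N ↔ y ∈ A₀ := fun y =>
    ⟨by rintro ⟨a, rfl⟩; exact a.2, fun h => ⟨⟨y, h⟩, rfl⟩⟩
  have : Module.Finite (MvPolynomial (Fin t) k) R := by
    refine Module.Finite.of_isRelPrime_pow_smul_mem N (hne _ hp) hPQ fun y => ?_
    obtain ⟨m, hm⟩ := hex' _ hpJ y
    obtain ⟨n, hn⟩ := hex' _ hqJ y
    refine ⟨m + n, ?_, ?_⟩
    · rw [hN, Algebra.smul_def, map_pow, add_comm, pow_add, mul_assoc]
      exact A₀.mul_mem (pow_mem (g P).2 n) hm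
    · rw [hN, Algebra.smul_def, map_pow, pow_add, mul_assoc]
      exact A₀.mul_mem (pow_mem (g Q).2 m) hn
  exact .trans (S := MvPolynomial (Fin t) k) inferInstance inferInstance

/-- The graded ring `⨁ R n`, embedded in the polynomial ring over the ambient field. -/
def sectionRing {k K : Type*} [Field k] [Field K] [Algebra k K] (R : ℕ → Submodule k K)
    [SetLike.GradedMonoid R] : Subalgebra k K[X] where
  carrier := {p | ∀ n, p.coeff n ∈ R n}
  add_mem' := fun ha hb n => by
    rw [coeff_add]; exact (R n).add_mem (ha n) (hb n)
  mul_mem' := fun ha hb n => by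
    rw [coeff_mul]
    refine (R n).sum_mem fun p hp => ?_
    have := SetLike.mul_mem_graded (ha p.1) (hb p.2)
    rwa [Finset.HasAntidiagonal.mem_antidiagonal.1 hp] at this
  algebraMap_mem' := fun c n => by
    rw [Polynomial.algebraMap_apply, coeff_C]
    split_ifs with h
    · subst h
      rw [Algebra.algebraMap_eq_smul_one]
      exact (R 0).smul_mem _ SetLike.GradedOne.one_mem
    · exact (R n).zero_mem

namespace sectionRing

variable {k K : Type*} [Field k] [Field K] [Algebra k K] {R : ℕ → Submodule k K}
  [SetLike.GradedMonoid R]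

lemma monomial_mem {n : ℕ} {a : K} (ha : a ∈ R n) : monomial n a ∈ sectionRing R := by
  intro m
  rw [coeff_monomial]
  split_ifs with h
  · subst h; exact ha
  · exact (R m).zero_mem

/-- The element `a T ^ n` of the section ring. -/
def mono (R : ℕ → Submodule k K) [SetLike.GradedMonoid R] (n : ℕ) : R n →ₗ[k] sectionRing R where
  toFun a := ⟨monomial n a, monomial_mem a.2⟩
  map_add' a b := Subtype.ext (by simp)
  map_smul' c a := Subtype.ext (smul_monomial c n (a : K)).symm

@[simp] lemma coe_mono (n : ℕ) (a : R n) : (mono R n a : K[X]) = monomial n (a : K) := rfl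

/-- The homogeneous component. -/
def part (p : sectionRing R) (n : ℕ) : R n := ⟨(p : K[X]).coeff n, p.2 n⟩

lemma sum_part (p : sectionRing R) :
    ∑ n ∈ (p : K[X]).support, mono R n (part p n) = p := by
  refine Subtype.ext ?_
  rw [AddSubmonoidClass.coe_finsetSum]
  conv_rhs => rw [(p : K[X]).as_sum_support]
  rfl

/-- The coaction on the section ring. -/
def coactFun (p : sectionRing R) : (sectionRing R)[X] :=
  ∑ n ∈ (p : K[X]).support, monomial n (mono R n (part p n))

lemma coeff_coactFun (p : sectionRing R) (n : ℕ) :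
    (coactFun p).coeff n = mono R n (part p n) := by
  rw [coactFun, finsetSum_coeff]
  simp only [coeff_monomial]
  rw [Finset.sum_ite_eq']
  split_ifs with h
  · rfl
  · have : part p n = 0 := Subtype.ext (notMem_support_iff.1 h)
    rw [this, map_zero]

variable (R) in
/-- The grading of the section ring. -/
def grading : PolyGrading k (sectionRing R) where
  coact :=
    { toFun := coactFun
      map_one' := by
        ext n : 2
        rw [coeff_coactFun, coe_mono]
        simp only [part, OneMemClass.coe_one, coeff_one]
        split_ifs with h
        · subst h; simp
        · simp
      map_mul' := fun p q => by
        ext n : 2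
        rw [coeff_coactFun, coeff_mul, coe_mono, AddSubmonoidClass.coe_finsetSum]
        simp only [coeff_coactFun, MulMemClass.coe_mul, coe_mono, monomial_mul_monomial, part,
          coeff_mul, map_sum]
        exact Finset.sum_congr rfl fun x hx => by rw [Finset.HasAntidiagonal.mem_antidiagonal.1 hx]
      map_zero' := by simp [coactFun]
      map_add' := fun p q => by
        ext n : 2
        rw [coeff_coactFun, coeff_add, coeff_coactFun, coeff_coactFun]
        simp [part]
      commutes' := fun c => by
        ext n : 2
        rw [coeff_coactFun, coe_mono, Polynomial.algebraMap_apply, coeff_C]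
        simp only [part, Subalgebra.coe_algebraMap, Polynomial.algebraMap_apply, coeff_C]
        split_ifs with h
        · subst h; simp
        · simp }
  eval_one p := by
    change (coactFun p).eval 1 = p
    rw [coactFun, eval_finsetSum]
    simp only [eval_monomial, one_pow, mul_one]
    exact sum_part p
  coact_coeff p n := by
    change coactFun ((coactFun p).coeff n) = monomial n ((coactFun p).coeff n)
    rw [coeff_coactFun]
    ext m : 2
    rw [coeff_coactFun, coeff_monomial]
    split_ifs with h
    · subst h; simp [part]
    · simp [part, coeff_monomial_of_ne _ (Ne.symm h)]

lemma mem_deg {n : ℕ} {p : sectionRing R} :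
    p ∈ (grading R).deg n ↔ mono R n (part p n) = p := by
  rw [(grading R).mem_deg]
  change coactFun p = _ ↔ _
  constructor
  · intro h
    have := congrArg (fun q => q.coeff n) h
    simpa [coeff_coactFun] using this
  · intro h
    rw [← h]
    ext m : 2
    rw [coeff_coactFun, coeff_monomial]
    split_ifs with h
    · subst h; simp [part]
    · simp [part, coeff_monomial_of_ne _ (Ne.symm h)]

lemma mono_mem_deg (n : ℕ) (a : R n) : mono R n a ∈ (grading R).deg n := by
  rw [mem_deg]
  congr 1
  exact Subtype.ext (by simp [part])

variable (R) in
/-- The homogeneous elements of degree `n` are the sections of degree `n`. -/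
def degEquiv (n : ℕ) : R n ≃ₗ[k] (grading R).deg n :=
  LinearEquiv.ofBijective ((mono R n).codRestrict _ (mono_mem_deg n)) <| by
    constructor
    · intro a b h
      have h1 : mono R n a = mono R n b := congrArg Subtype.val h
      have h2 := congrArg (fun p : sectionRing R => (p : K[X]).coeff n) h1
      exact Subtype.ext (by simpa using h2)
    · intro p
      exact ⟨part p.1 n, Subtype.ext (mem_deg.1 p.2)⟩

end sectionRing

lemma IsIntegral.of_map_adjoin {k A B ι : Type*} [Field k] [CommRing A] [CommRing B] [Algebra k A]
    [Algebra k B] (j : A →ₐ[k] B) (hj : Function.Injective j) (F : ι → A) (a : A)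
    (h : IsIntegral (Algebra.adjoin k (Set.range fun i => j (F i))) (j a)) :
    IsIntegral (Algebra.adjoin k (Set.range F)) a := by
  have hmap : (Algebra.adjoin k (Set.range F)).map j =
      Algebra.adjoin k (Set.range fun i => j (F i)) := by
    rw [AlgHom.map_adjoin, ← Set.range_comp]; rfl
  rw [← hmap] at h
  obtain ⟨p, hp, h0⟩ := h
  let e := (Algebra.adjoin k (Set.range F)).equivMapOfInjective j hj
  refine ⟨p.map e.symm.toAlgHom.toRingHom, hp.map _, hj ?_⟩
  rw [map_zero, ← h0, eval₂_map, ← AlgHom.coe_toRingHom, hom_eval₂]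
  congr 1
  ext x
  obtain ⟨y, rfl⟩ := e.surjective x
  simp
  rfl

lemma isIntegral_of_forall_valuationSubring {k L : Type*} [Field k] [Field L] [Algebra k L]
    (A : Subalgebra k L) (z : L) (h : ∀ V : ValuationSubring L, (∀ a ∈ A, a ∈ V) → z ∈ V) :
    IsIntegral A z := by
  have h1 : z ∈ (integralClosure (Subring.closure (A : Set L)) L).toSubring := by
    rw [← iInf_valuationSubring_superset]
    simp only [Subring.mem_iInf]
    exact fun V => h V.1 fun a ha => V.2 ha
  have h2 : IsIntegral (Subring.closure (A : Set L)) z := h1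
  obtain ⟨p, hp, h0⟩ := h2
  have hle : Subring.closure (A : Set L) ≤ A.toSubring := Subring.closure_le.2 le_rfl
  refine ⟨p.map (Subring.inclusion hle), hp.map _, ?_⟩
  rw [eval₂_map]
  exact h0

lemma algebraicIndependent_mono {k K : Type*} [Field k] [Field K] [Algebra k K]
    {z f : K} (hz : Transcendental k z) (hf : f ≠ 0) (n : ℕ) :
    AlgebraicIndependent k ![(monomial 1 f : K[X]), monomial n (z * f ^ n)] := by
  set w : K[X] := monomial 1 f with hw
  have h1 : Transcendental K w := by
    rw [hw, ← C_mul_X_pow_eq_monomial, pow_one]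
    intro h
    refine transcendental_X K ?_
    have h2 := (isAlgebraic_algebraMap (A := K[X]) (f⁻¹)).mul h
    rwa [Polynomial.algebraMap_apply, Algebra.algebraMap_self_apply, ← mul_assoc, ← C_mul,
      inv_mul_cancel₀ hf, C_1, one_mul] at h2
  have hx : AlgebraicIndependent k (fun _ : Unit => z) := by
    simpa [algebraicIndependent_unique_type_iff] using hz
  have hy : AlgebraicIndependent K (fun _ : Unit => w) := by
    simpa [algebraicIndependent_unique_type_iff] using h1
  have hxy := hx.sumElim_comp hy
  have hw' : AlgebraicIndependent k (fun _ : Unit => w) := hxy.comp Sum.inl Sum.inl_injective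
  have h3 : AlgebraicIndependent k (fun o : Option Unit => o.elim (C z) fun _ => w) := by
    convert hxy.comp (fun o : Option Unit => o.elim (Sum.inr ()) Sum.inl) ?_ using 1
    · ext o : 1
      cases o <;> rfl
    · rintro (_ | _) (_ | _) <;> simp
  rw [hw'.option_iff_transcendental] at h3
  set S := Algebra.adjoin k (Set.range fun _ : Unit => w)
  have hwS : w ^ n ∈ S := pow_mem (Algebra.subset_adjoin (Set.mem_range_self ())) n
  have h4 : Transcendental S (monomial n (z * f ^ n) : K[X]) := by
    intro h
    refine h3 (IsAlgebraic.of_mul (R := S) (y := w ^ n) (z := C z) ?_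
      (isAlgebraic_algebraMap (⟨w ^ n, hwS⟩ : S)) ?_)
    · exact mem_nonZeroDivisors_of_ne_zero (pow_ne_zero n (by simpa [hw] using hf))
    · have : w ^ n * C z = monomial n (z * f ^ n) := by
        rw [hw, monomial_pow, monomial_mul_C, one_mul, mul_comm]
      rwa [this]
  rw [← hw'.option_iff_transcendental] at h4
  convert h4.comp ![some (), none] ?_ using 1
  · ext i : 1
    fin_cases i <;> rfl
  · intro i j h
    fin_cases i <;> fin_cases j <;> simp_all

lemma AlgebraicIndependent.of_pair_map {k A B : Type*} [Field k] [CommRing A] [CommRing B]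
    [Algebra k A] [Algebra k B] (j : A →ₐ[k] B) {x y : A}
    (h : AlgebraicIndependent k ![j x, j y]) : AlgebraicIndependent k ![x, y] := by
  refine AlgebraicIndependent.of_comp j ?_
  convert h using 1
  ext i : 1
  fin_cases i <;> rfl

lemma Algebra.FiniteType.of_subset {k R : Type*} [Field k] [CommRing R] [IsDomain R]
    [Algebra k R] (A₀ : Subalgebra k R) (hfg : A₀.FG) {ι : Type*} (F : ι → R)
    (hF : ∀ i, F i ∈ A₀) (hF_int : ∀ a : R, IsIntegral (Algebra.adjoin k (Set.range F)) a)
    (hex : ∀ i (y : R), ∃ n : ℕ, F i ^ n * y ∈ A₀)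
    {x y : R} (hx : x ∈ A₀) (hy : y ∈ A₀) (hxy : AlgebraicIndependent k ![x, y]) :
    Algebra.FiniteType k R :=
  .of_pow_mul_mem A₀ hfg (fun i => ⟨F i, hF i⟩)
    (fun a => .of_map_adjoin A₀.val Subtype.val_injective _ a (hF_int a)) hex
    (x := ![⟨x, hx⟩, ⟨y, hy⟩]) (.of_pair_map A₀.val hxy)

/-- A line bundle on an integral scheme, seen from the function field: the local rings `O x`,
and generators `τ x` of the dual of the bundle at the points `x`, so that `a` is a local section at
`x` when `τ x * a ∈ O x`. -/
structure SecData (k K X : Type*) [Field k] [Field K] [Algebra k K] where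
  O : X → Subalgebra k K
  τ : X → K
  τ_ne : ∀ x, τ x ≠ 0

namespace SecData

variable {k K X : Type*} [Field k] [Field K] [Algebra k K] (D : SecData k K X)

/-- The global sections of the `n`-th power. -/
def sec (n : ℕ) : Submodule k K where
  carrier := {a | ∀ x, D.τ x ^ n * a ∈ D.O x}
  add_mem' := fun ha hb x => by rw [mul_add]; exact (D.O x).add_mem (ha x) (hb x)
  zero_mem' := fun x => by simp
  smul_mem' := fun c a ha x => by
    rw [mul_smul_comm]; exact (D.O x).smul_mem (ha x) c

variable {D} in
lemma mem_sec {n : ℕ} {a : K} : a ∈ D.sec n ↔ ∀ x, D.τ x ^ n * a ∈ D.O x := Iff.rfl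

instance : SetLike.GradedMonoid D.sec where
  one_mem := fun x => by simp
  mul_mem := fun m n a b ha hb x => by
    have := (D.O x).mul_mem (ha x) (hb x)
    convert this using 1
    ring

/-- The graded ring of sections. -/
abbrev ring : Subalgebra k K[X] := sectionRing D.sec

/-- The points where `f` generates the bundle. -/
def loc (f : K) : Set X := {x | (D.τ x * f)⁻¹ ∈ D.O x}

/-- The functions regular on `S`. -/
def reg (S : Set X) : Subalgebra k K := ⨅ x ∈ S, D.O x

variable {D} in
lemma mem_reg {S : Set X} {a : K} : a ∈ D.reg S ↔ ∀ x ∈ S, a ∈ D.O x := by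
  simp [reg, Algebra.mem_iInf]

/-- The powers of the bundle. -/
def pow (e : ℕ) : SecData k K X where
  O := D.O
  τ x := D.τ x ^ e
  τ_ne x := pow_ne_zero e (D.τ_ne x)

lemma pow_sec (e n : ℕ) : (D.pow e).sec n = D.sec (e * n) := by
  ext a
  simp [mem_sec, pow, pow_mul]

/-- Every valuation ring of the field dominates some local ring. -/
def Proper : Prop :=
  ∀ V : ValuationSubring K, (∀ c, algebraMap k K c ∈ V) → ∃ x, ∀ a ∈ D.O x, a ∈ V

/-- A family of sections without common zero. -/
structure Gen {ι : Type*} (f : ι → K) : Prop where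
  ne : ∀ i, f i ≠ 0
  mem : ∀ i, f i ∈ D.sec 1
  cover : ∀ x, ∃ i, x ∈ D.loc (f i)

variable {D}

lemma div_pow_mem_O {f y : K} {n : ℕ} (hf : f ≠ 0) (hy : y ∈ D.sec n) {x : X}
    (hx : x ∈ D.loc f) : y / f ^ n ∈ D.O x := by
  have h1 := (D.O x).mul_mem (hy x) (pow_mem hx n)
  convert h1 using 1
  have := D.τ_ne x
  rw [inv_pow, mul_pow]
  field_simp

lemma div_pow_mem_reg {f y : K} {n : ℕ} (hf : f ≠ 0) (hy : y ∈ D.sec n) :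
    y / f ^ n ∈ D.reg (D.loc f) :=
  mem_reg.2 fun _ hx => div_pow_mem_O hf hy hx

lemma isIntegral_monomial (hD : D.Proper) {ι : Type*} {f : ι → K} (hf : D.Gen f) {n : ℕ} {y : K}
    (hy : y ∈ D.sec n) :
    IsIntegral (Algebra.adjoin k (Set.range fun i => (monomial 1 (f i) : K[X])))
      (monomial n y : K[X]) := by
  let L := FractionRing K[X]
  refine IsIntegral.of_map_adjoin (IsScalarTower.toAlgHom k K[X] L)
    (IsFractionRing.injective K[X] L) _ _ ?_
  refine isIntegral_of_forall_valuationSubring _ _ fun W hW => ?_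
  obtain ⟨x, hx⟩ := hD (W.comap ((algebraMap K[X] L).comp C)) fun c =>
    hW _ (Subalgebra.algebraMap_mem _ c)
  obtain ⟨i, hi⟩ := hf.cover x
  have h1 : algebraMap K[X] L (C (y / f i ^ n)) ∈ W :=
    hx _ (div_pow_mem_O (hf.ne i) hy hi)
  have h2 : algebraMap K[X] L (monomial 1 (f i)) ∈ W :=
    hW _ (Algebra.subset_adjoin ⟨i, rfl⟩)
  have h3 := W.mul_mem _ _ h1 (W.toSubring.pow_mem h2 n)
  rw [← map_pow, ← map_mul, monomial_pow, C_mul_monomial, one_mul,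
    div_mul_cancel₀ _ (pow_ne_zero n (hf.ne i))] at h3
  exact h3

/-- The sections of degree one in the section ring. -/
def Gen.elt {ι : Type*} {f : ι → K} (hf : D.Gen f) (i : ι) : D.ring :=
  sectionRing.mono D.sec 1 ⟨f i, hf.mem i⟩

lemma Gen.isIntegral (hD : D.Proper) {ι : Type*} {f : ι → K} (hf : D.Gen f) (a : D.ring) :
    IsIntegral (Algebra.adjoin k (Set.range hf.elt)) a := by
  rw [← sectionRing.sum_part a]
  refine IsIntegral.sum _ fun n _ => ?_
  refine IsIntegral.of_map_adjoin D.ring.val Subtype.val_injective _ _ ?_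
  exact isIntegral_monomial hD hf (sectionRing.part a n).2

/-- The section `f` has affine support. -/
structure Affine (D : SecData k K X) (f : K) : Prop where
  fg : (D.reg (D.loc f)).FG
  exists_mul_pow_mem : ∀ a ∈ D.reg (D.loc f), ∃ n, a * f ^ n ∈ D.sec n

lemma mul_pow_mem_of_le {f a : K} (hf : f ∈ D.sec 1) {m n : ℕ} (h : m ≤ n)
    (ha : a * f ^ m ∈ D.sec m) : a * f ^ n ∈ D.sec n := by
  have h1 : f ^ (n - m) ∈ D.sec (n - m) := by
    simpa using SetLike.pow_mem_graded (n - m) hf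
  have h2 := SetLike.mul_mem_graded ha h1
  rwa [mul_assoc, ← pow_add, Nat.add_sub_cancel' h] at h2

lemma Gen.coe_elt_pow {ι : Type*} {f : ι → K} (hf : D.Gen f) (i : ι) (n : ℕ) :
    ((hf.elt i ^ n : D.ring) : K[X]) = monomial n (f i ^ n) := by
  simp [Gen.elt, monomial_pow]

lemma Gen.exists_mem_of_mem_reg {ι : Type*} {f : ι → K} (hf : D.Gen f) (A₀ : Subalgebra k D.ring)
    (i : ι) (helt : hf.elt i ∈ A₀) (S : Set K) (hS : Algebra.adjoin k S = D.reg (D.loc (f i)))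
    (hSA : ∀ a ∈ S, ∃ n, ∃ p ∈ A₀, (p : K[X]) = monomial n (a * f i ^ n))
    (a : K) (ha : a ∈ D.reg (D.loc (f i))) :
    ∃ n, ∃ p ∈ A₀, (p : K[X]) = monomial n (a * f i ^ n) := by
  rw [← hS] at ha
  induction ha using Algebra.adjoin_induction with
  | mem a ha => exact hSA a ha
  | algebraMap c =>
    refine ⟨0, _, A₀.algebraMap_mem c, ?_⟩
    simp only [pow_zero, mul_one]
    rfl
  | add a b _ _ ha hb =>
    obtain ⟨m, p, hp, hp'⟩ := ha
    obtain ⟨n, q, hq, hq'⟩ := hb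
    refine ⟨m + n, p * hf.elt i ^ n + q * hf.elt i ^ m,
      A₀.add_mem (A₀.mul_mem hp (pow_mem helt n)) (A₀.mul_mem hq (pow_mem helt m)), ?_⟩
    rw [AddMemClass.coe_add, MulMemClass.coe_mul, MulMemClass.coe_mul, hf.coe_elt_pow,
      hf.coe_elt_pow, hp', hq', monomial_mul_monomial, monomial_mul_monomial, add_comm n m,
      ← map_add]
    congr 1
    ring
  | mul a b _ _ ha hb =>
    obtain ⟨m, p, hp, hp'⟩ := ha
    obtain ⟨n, q, hq, hq'⟩ := hb
    refine ⟨m + n, p * q, A₀.mul_mem hp hq, ?_⟩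
    rw [MulMemClass.coe_mul, hp', hq', monomial_mul_monomial]
    congr 1
    ring

lemma Gen.exists_pow_mul_mem {ι : Type*} {f : ι → K} (hf : D.Gen f) (A₀ : Subalgebra k D.ring)
    (i : ι) (helt : hf.elt i ∈ A₀)
    (hreg : ∀ a ∈ D.reg (D.loc (f i)), ∃ n, ∃ p ∈ A₀, (p : K[X]) = monomial n (a * f i ^ n))
    (y : D.ring) : ∃ n, hf.elt i ^ n * y ∈ A₀ := by
  classical
  have hmono : ∀ n, ∃ m, hf.elt i ^ m * sectionRing.mono D.sec n (sectionRing.part y n) ∈ A₀ := by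
    intro n
    set b := sectionRing.part y n
    obtain ⟨m, p, hp, hp'⟩ := hreg _ (div_pow_mem_reg (hf.ne i) b.2)
    refine ⟨m, ?_⟩
    have : hf.elt i ^ m * sectionRing.mono D.sec n b = p * hf.elt i ^ n := by
      refine Subtype.ext ?_
      rw [MulMemClass.coe_mul, MulMemClass.coe_mul, hf.coe_elt_pow, hf.coe_elt_pow, hp',
        monomial_mul_monomial, sectionRing.coe_mono, monomial_mul_monomial]
      congr 1
      have := hf.ne i
      field_simp
    rw [this]
    exact A₀.mul_mem hp (pow_mem helt n)
  choose m hm using hmono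
  have hy (N : ℕ) : hf.elt i ^ N * y = ∑ n ∈ (y : K[X]).support,
      hf.elt i ^ N * sectionRing.mono D.sec n (sectionRing.part y n) := by
    rw [← Finset.mul_sum, sectionRing.sum_part]
  refine ⟨∑ n ∈ (y : K[X]).support, m n, ?_⟩
  rw [hy]
  refine A₀.sum_mem fun n hn => ?_
  rw [← Finset.sum_erase_add _ _ hn, pow_add, mul_assoc]
  exact A₀.mul_mem (pow_mem helt _) (hm n)

lemma Gen.finiteType (hD : D.Proper) {s : ℕ} {f : Fin s → K} (hf : D.Gen f)
    (ha : ∀ i, D.Affine (f i)) (i₀ : Fin s) {z : K} (hz : z ∈ D.reg (D.loc (f i₀)))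
    (hzt : Transcendental k z) : Algebra.FiniteType k D.ring := by
  classical
  choose S hS using fun i => (ha i).fg
  choose N hN using fun (i : Fin s) (a : D.reg (D.loc (f i))) =>
    (ha i).exists_mul_pow_mem a a.2
  let E (i : Fin s) (a : D.reg (D.loc (f i))) : D.ring :=
    sectionRing.mono D.sec (N i a) ⟨_, hN i a⟩
  have hSmem : ∀ i, ∀ a ∈ S i, a ∈ D.reg (D.loc (f i)) := fun i a h => by
    rw [← hS i]; exact Algebra.subset_adjoin h
  let G : Set D.ring := (Set.range hf.elt ∪ {E i₀ ⟨z, hz⟩}) ∪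
    ⋃ i, Set.range fun a : S i => E i ⟨a, hSmem i a a.2⟩
  have hG : G.Finite := ((Set.finite_range _).union (Set.finite_singleton _)).union
    (Set.finite_iUnion fun i => Set.finite_range _)
  let A₀ : Subalgebra k D.ring := Algebra.adjoin k G
  have helt : ∀ i, hf.elt i ∈ A₀ := fun i => Algebra.subset_adjoin (.inl (.inl ⟨i, rfl⟩))
  have hz' : E i₀ ⟨z, hz⟩ ∈ A₀ := Algebra.subset_adjoin (.inl (.inr rfl))
  refine Algebra.FiniteType.of_subset A₀ (Subalgebra.fg_def.2 ⟨G, hG, rfl⟩) hf.elt helt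
    (hf.isIntegral hD) ?_ (helt i₀) hz'
    (.of_pair_map D.ring.val (algebraicIndependent_mono hzt (hf.ne i₀) _))
  intro i y
  refine hf.exists_pow_mul_mem A₀ i (helt i)
    (hf.exists_mem_of_mem_reg A₀ i (helt i) (S i) (hS i) fun a h => ?_) y
  exact ⟨N i ⟨a, hSmem i a h⟩, E i ⟨a, hSmem i a h⟩,
    Algebra.subset_adjoin (.inr (Set.mem_iUnion.2 ⟨i, ⟨a, h⟩, rfl⟩)), rfl⟩

lemma Gen.good (hD : D.Proper) {s : ℕ} {f : Fin s → K} (hf : D.Gen f)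
    [Algebra.FiniteType k D.ring] : (sectionRing.grading D.sec).Good hf.elt :=
  .of_isIntegral _ _ (fun _ => sectionRing.mono_mem_deg 1 _) (hf.isIntegral hD)

end SecData

lemma IsLocalization.Away.of_injective {A P Q : Type*} [CommRing A] [CommRing P] [CommRing Q]
    [Algebra A P] [Algebra P Q] [Algebra A Q] [IsScalarTower A P Q] (a : A)
    (hinj : Function.Injective (algebraMap A P))
    (hsurj : ∀ q : P, ∃ (N : ℕ) (b : A), algebraMap A P b = algebraMap A P a ^ N * q)
    [IsLocalization.Away (algebraMap A P a) Q] : IsLocalization.Away a Q := by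
  have hu : IsUnit (algebraMap A Q a) := by
    rw [IsScalarTower.algebraMap_apply A P Q]
    exact IsLocalization.Away.algebraMap_isUnit _
  refine ⟨⟨?_, ?_, ?_⟩⟩
  · rintro ⟨_, n, rfl⟩
    simpa using hu.pow n
  · intro z
    obtain ⟨⟨q, ⟨_, n, rfl⟩⟩, hq⟩ := IsLocalization.surj
      (Submonoid.powers (algebraMap A P a)) z
    obtain ⟨N, b, hb⟩ := hsurj q
    refine ⟨⟨b, ⟨_, N + n, rfl⟩⟩, ?_⟩
    have hb' := congrArg (algebraMap P Q) hb
    simp only [map_mul, map_pow, ← IsScalarTower.algebraMap_apply] at hb' hq ⊢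
    rw [hb', ← hq, pow_add]
    ring
  · intro x y h
    rw [IsScalarTower.algebraMap_apply A P Q, IsScalarTower.algebraMap_apply A P Q] at h
    obtain ⟨⟨_, n, rfl⟩, hc⟩ := IsLocalization.exists_of_eq
      (M := Submonoid.powers (algebraMap A P a)) h
    refine ⟨⟨_, n, rfl⟩, hinj ?_⟩
    simpa using hc

lemma EtaleRank.of_isLocalization_away {r : ℕ} {A B L₁ L₂ : Type*} [CommRing A] [CommRing B]
    [CommRing L₁] [CommRing L₂] [Algebra A B] [Algebra A L₁] [Algebra B L₂] [Algebra L₁ L₂]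
    [Algebra A L₂] [IsScalarTower A B L₂] [IsScalarTower A L₁ L₂] (a : A)
    [IsLocalization.Away a L₁] [IsLocalization.Away (algebraMap A B a) L₂]
    (h : EtaleRank r L₁ L₂) :
    EtaleRank r (Localization.Away a) (Localization.Away a ⊗[A] B) := by
  have : IsLocalization (Algebra.algebraMapSubmonoid B (Submonoid.powers a)) L₂ := by
    rw [Algebra.algebraMapSubmonoid, Submonoid.map_powers]
    assumption
  have hp : Algebra.IsPushout A B L₁ L₂ :=
    Algebra.isPushout_of_isLocalization (Submonoid.powers a) L₁ B L₂
  have hp' : Algebra.IsPushout A L₁ B L₂ := hp.symm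
  have h1 : EtaleRank r L₁ (L₁ ⊗[A] B) := h.equiv (Algebra.IsPushout.equiv A L₁ B L₂).symm
  let e : L₁ ≃ₐ[A] Localization.Away a := IsLocalization.algEquiv (Submonoid.powers a) _ _
  let _ : Algebra L₁ (Localization.Away a) := e.toAlgHom.toRingHom.toAlgebra
  have : IsScalarTower A L₁ (Localization.Away a) :=
    .of_algebraMap_eq fun x => (e.commutes x).symm
  exact (h1.baseChange (Localization.Away a)).equiv
    (Algebra.TensorProduct.cancelBaseChange A L₁ (Localization.Away a) (Localization.Away a) B)

attribute [local instance] Algebra.TensorProduct.rightAlgebra Polynomial.algebra in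
lemma EtaleRank.localization {r : ℕ} {A B P P' : Type*} [CommRing A] [CommRing B]
    [CommRing P] [CommRing P'] [Algebra A B] [Algebra A P] [Algebra B P'] [Algebra P P']
    [Algebra A P'] [IsScalarTower A B P'] [IsScalarTower A P P'] (a : A)
    (h : EtaleRank r P P') (hA : Function.Injective (algebraMap A P))
    (hA' : ∀ q : P, ∃ (N : ℕ) (b : A), algebraMap A P b = algebraMap A P a ^ N * q)
    (hB : Function.Injective (algebraMap B P'))
    (hB' : ∀ q : P', ∃ (N : ℕ) (b : B),
      algebraMap B P' b = algebraMap B P' (algebraMap A B a) ^ N * q) :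
    EtaleRank r (Localization.Away a) (Localization.Away a ⊗[A] B) := by
  let L₁ := Localization.Away (algebraMap A P a)
  let L₂ := L₁ ⊗[P] P'
  have h2 : IsLocalization (Algebra.algebraMapSubmonoid P'
      (Submonoid.powers (algebraMap A P a))) L₂ :=
    (Algebra.isLocalization_iff_isPushout (R := P) (Submonoid.powers (algebraMap A P a)) L₁).2
      inferInstance
  rw [Algebra.algebraMapSubmonoid, Submonoid.map_powers, ← IsScalarTower.algebraMap_apply,
    IsScalarTower.algebraMap_apply A B P'] at h2
  have h3 : EtaleRank r L₁ L₂ := h.baseChange L₁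
  let _ : Algebra B L₂ := ((algebraMap P' L₂).comp (algebraMap B P')).toAlgebra
  have : IsScalarTower B P' L₂ := .of_algebraMap_eq fun _ => rfl
  have : IsLocalization.Away (algebraMap B P' (algebraMap A B a)) L₂ := h2
  have : IsLocalization.Away (algebraMap A B a) L₂ := .of_injective (P := P') _ hB hB'
  have : IsLocalization.Away a L₁ := .of_injective (P := P) _ hA hA'
  have : IsScalarTower A B L₂ := .of_algebraMap_eq fun x => by
    change algebraMap L₁ L₂ (algebraMap A L₁ x) = algebraMap P' L₂ (algebraMap B P' _)
    rw [← IsScalarTower.algebraMap_apply A B P', IsScalarTower.algebraMap_apply A P P',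
      ← IsScalarTower.algebraMap_apply P P' L₂, IsScalarTower.algebraMap_apply P L₁ L₂,
      ← IsScalarTower.algebraMap_apply A P L₁]
  exact .of_isLocalization_away (L₁ := L₁) (L₂ := L₂) a h3

attribute [local instance] Polynomial.algebra in
lemma EtaleRank.polynomial {r : ℕ} {A B : Type*} [CommRing A] [CommRing B] [Algebra A B]
    (h : EtaleRank r A B) : EtaleRank r A[X] B[X] :=
  (h.baseChange A[X]).equiv (Algebra.IsPushout.equiv A A[X] B B[X])

/-- A finite étale homomorphism of constant rank. -/
def RingHom.EtaleRank (r : ℕ) {A B : Type*} [CommRing A] [CommRing B] (f : A →+* B) : Prop :=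
  @_root_.EtaleRank r A B _ _ f.toAlgebra

namespace SecData

variable {k K : Type u} {X : Type*} [Field k] [Field K] [Algebra k K] {D : SecData k K X}

lemma loc_pow {f : K} (hf : f ∈ D.sec 1) {e : ℕ} (he : 0 < e) : (D.pow e).loc (f ^ e) = D.loc f := by
  ext x
  by_cases h0 : f = 0
  · subst h0
    simp [loc, he.ne']
  have hτ := D.τ_ne x
  have h1 : D.τ x * f ∈ D.O x := by simpa using hf x
  change (D.τ x ^ e * f ^ e)⁻¹ ∈ D.O x ↔ (D.τ x * f)⁻¹ ∈ D.O x
  rw [← mul_pow]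
  constructor
  · intro h
    obtain ⟨n, rfl⟩ := Nat.exists_eq_add_one.2 he
    convert (D.O x).mul_mem h (pow_mem h1 n) using 1
    field_simp
    exact pow_succ' _ _
  · intro h
    rw [← inv_pow]
    exact pow_mem h e

lemma Gen.pow {ι : Type*} {f : ι → K} (hf : D.Gen f) {e : ℕ} (he : 0 < e) :
    (D.pow e).Gen fun i => f i ^ e where
  ne i := pow_ne_zero e (hf.ne i)
  mem i := by
    rw [pow_sec]
    simpa using SetLike.pow_mem_graded e (hf.mem i)
  cover x := by
    obtain ⟨i, hi⟩ := hf.cover x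
    exact ⟨i, by rwa [loc_pow (hf.mem i) he]⟩

lemma Affine.pow {f : K} (hf : D.Affine f) (h1 : f ∈ D.sec 1) {e : ℕ} (he : 0 < e) :
    (D.pow e).Affine (f ^ e) where
  fg := by
    rw [loc_pow h1 he]
    exact hf.fg
  exists_mul_pow_mem a ha := by
    rw [loc_pow h1 he] at ha
    obtain ⟨n, hn⟩ := hf.exists_mul_pow_mem a ha
    refine ⟨n, ?_⟩
    rw [pow_sec, ← pow_mul]
    exact mul_pow_mem_of_le h1 (Nat.le_mul_of_pos_left n he) hn

variable (D) in
/-- An endomorphism together with an isomorphism of the pullback of the bundle with its `d`-th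
power. -/
structure Endo (d : ℕ) where
  σ : K →ₐ[k] K
  φ : X → X
  map_O : ∀ x a, a ∈ D.O (φ x) → σ a ∈ D.O x
  inv_mem : ∀ x a, a ∈ D.O (φ x) → (σ a)⁻¹ ∈ D.O x → a⁻¹ ∈ D.O (φ x)
  c : K
  c_ne : c ≠ 0
  mem_O : ∀ x, D.τ x ^ d * c / σ (D.τ (φ x)) ∈ D.O x
  inv_mem_O : ∀ x, σ (D.τ (φ x)) / (D.τ x ^ d * c) ∈ D.O x

namespace Endo

variable {d : ℕ} (E : D.Endo d)

/-- The endomorphism for a power of the bundle. -/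
def pow (e : ℕ) : (D.pow e).Endo d where
  σ := E.σ
  φ := E.φ
  map_O := E.map_O
  inv_mem := E.inv_mem
  c := E.c ^ e
  c_ne := pow_ne_zero e E.c_ne
  mem_O x := by
    change _ ∈ D.O x
    convert pow_mem (E.mem_O x) e using 1
    change (_ ^ e) ^ d * _ / E.σ (_ ^ e) = _
    rw [map_pow]
    ring
  inv_mem_O x := by
    change _ ∈ D.O x
    convert pow_mem (E.inv_mem_O x) e using 1
    change E.σ (_ ^ e) / ((_ ^ e) ^ d * _) = _
    rw [map_pow]
    ring

lemma map_sec {n : ℕ} {a : K} (ha : a ∈ D.sec n) : E.σ a * E.c ^ n ∈ (D.pow d).sec n := by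
  intro x
  change _ ∈ D.O x
  convert (D.O x).mul_mem (E.map_O x _ (ha (E.φ x))) (pow_mem (E.mem_O x) n) using 1
  have := (map_ne_zero E.σ).2 (D.τ_ne (E.φ x))
  change (D.τ x ^ d) ^ n * _ = _
  rw [map_mul, map_pow, div_pow, mul_pow]
  field_simp

lemma mem_loc {f : K} (hf : f ∈ D.sec 1) {x : X} :
    x ∈ (D.pow d).loc (E.c * E.σ f) ↔ E.φ x ∈ D.loc f := by
  have h1 := (map_ne_zero E.σ).2 (D.τ_ne (E.φ x))
  have h2 := D.τ_ne x
  have h3 := E.c_ne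
  by_cases h0 : f = 0
  · subst h0; simp [loc]
  have h0' := (map_ne_zero E.σ).2 h0
  change (D.τ x ^ d * (E.c * E.σ f))⁻¹ ∈ D.O x ↔ (D.τ (E.φ x) * f)⁻¹ ∈ D.O (E.φ x)
  constructor
  · intro h
    refine E.inv_mem x _ (by simpa using hf (E.φ x)) ?_
    convert (D.O x).mul_mem h (E.mem_O x) using 1
    rw [map_mul]
    field_simp
  · intro h
    convert (D.O x).mul_mem (E.map_O x _ h) (E.inv_mem_O x) using 1
    rw [map_inv₀, map_mul]
    field_simp

/-- The pullback on regular functions. -/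
def regMap {f : K} (hf : f ∈ D.sec 1) :
    D.reg (D.loc f) →ₐ[k] (D.pow d).reg ((D.pow d).loc (E.c * E.σ f)) :=
  (E.σ.comp (D.reg (D.loc f)).val).codRestrict _ fun a => mem_reg.2 fun x hx =>
    E.map_O x _ (mem_reg.1 a.2 _ ((E.mem_loc hf).1 hx))

/-- The pullback on section rings. -/
def map : D.ring →ₐ[k] (D.pow d).ring :=
  (((aeval (C E.c * Polynomial.X) : K[X] →ₐ[K] K[X]).restrictScalars k).comp
    ((mapAlgHom E.σ).comp D.ring.val)).codRestrict _ fun p n => by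
      change ((((p : K[X]).map (E.σ : K →+* K))).comp (C E.c * Polynomial.X)).coeff n ∈ _
      rw [comp_C_mul_X_coeff, coeff_map]
      exact E.map_sec (p.2 n)

lemma coeff_map (p : D.ring) (n : ℕ) :
    (E.map p : K[X]).coeff n = E.σ ((p : K[X]).coeff n) * E.c ^ n := by
  change ((((p : K[X]).map (E.σ : K →+* K))).comp (C E.c * Polynomial.X)).coeff n = _
  rw [comp_C_mul_X_coeff, Polynomial.coeff_map]
  rfl

lemma map_mono {n : ℕ} (a : D.sec n) : E.map (sectionRing.mono D.sec n a) =
    sectionRing.mono (D.pow d).sec n ⟨_, E.map_sec a.2⟩ := by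
  refine Subtype.ext (Polynomial.ext fun m => ?_)
  rw [coeff_map, sectionRing.coe_mono, sectionRing.coe_mono, coeff_monomial, coeff_monomial]
  split_ifs with h
  · subst h; rfl
  · simp

end Endo

lemma _root_.RingHom.exists_lift_of_injective {A P Q : Type*} [CommRing A] [CommRing P]
    [CommRing Q] (j : P →+* Q) (hj : Function.Injective j) (h : A →+* Q)
    (hh : ∀ a, ∃ p, j p = h a) : ∃ h' : A →+* P, ∀ a, j (h' a) = h a := by
  choose g hg using hh
  refine ⟨⟨⟨⟨g, hj ?_⟩, fun a b => hj ?_⟩, hj ?_, fun a b => hj ?_⟩, hg⟩ <;> simp [hg]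

lemma exists_locMap (D : SecData k K X) {f : K} (hf : f ≠ 0) :
    ∃ h : D.ring →+* (D.reg (D.loc f))[X], ∀ a n, ((h a).coeff n : K) = (a : K[X]).coeff n / f ^ n := by
  let j : (D.reg (D.loc f))[X] →+* K[X] := mapRingHom (D.reg (D.loc f)).val.toRingHom
  obtain ⟨h, hh⟩ := RingHom.exists_lift_of_injective j
    (map_injective _ Subtype.val_injective)
    ((compRingHom (C f⁻¹ * Polynomial.X)).comp D.ring.val.toRingHom) fun a => by
      have : ((a : K[X]).comp (C f⁻¹ * Polynomial.X)) ∈ Polynomial.lifts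
          (D.reg (D.loc f)).val.toRingHom := by
        rw [lifts_iff_coeff_lifts]
        intro n
        rw [comp_C_mul_X_coeff, inv_pow, ← div_eq_mul_inv]
        exact ⟨⟨_, div_pow_mem_reg hf (a.2 n)⟩, rfl⟩
      obtain ⟨p, hp⟩ := (mem_lifts _).1 this
      exact ⟨p, hp⟩
  refine ⟨h, fun a n => ?_⟩
  have := congrArg (fun p => p.coeff n) (hh a)
  simp only [j, coe_mapRingHom, Polynomial.coeff_map] at this
  refine this.trans ?_
  change ((a : K[X]).comp (C f⁻¹ * Polynomial.X)).coeff n = _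
  rw [comp_C_mul_X_coeff, inv_pow, ← div_eq_mul_inv]

lemma locMap_injective {f : K} (hf : f ≠ 0) (h : D.ring →+* (D.reg (D.loc f))[X])
    (hh : ∀ a n, ((h a).coeff n : K) = (a : K[X]).coeff n / f ^ n) : Function.Injective h := by
  intro a b hab
  refine Subtype.ext (Polynomial.ext fun n => ?_)
  have h1 := hh a n
  rw [hab, hh, div_left_inj' (pow_ne_zero n hf)] at h1
  exact h1.symm

lemma locMap_surj {f : K} (hf : f ≠ 0) (h1 : f ∈ D.sec 1)
    (hex : ∀ a ∈ D.reg (D.loc f), ∃ n, a * f ^ n ∈ D.sec n)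
    (h : D.ring →+* (D.reg (D.loc f))[X])
    (hh : ∀ a n, ((h a).coeff n : K) = (a : K[X]).coeff n / f ^ n) (F : D.ring)
    (hF : (F : K[X]) = monomial 1 f)
    (q : (D.reg (D.loc f))[X]) : ∃ (N : ℕ) (b : D.ring), h b = h F ^ N * q := by
  have hX : h F = Polynomial.X := by
    refine Polynomial.ext fun n => Subtype.ext ?_
    rw [hh, hF, coeff_monomial, coeff_X]
    split_ifs with hn
    · subst hn; simp [hf]
    · simp
  obtain ⟨M, hM⟩ : ∃ M, ∀ m, (q.coeff m : K) * f ^ (m + M) ∈ D.sec (m + M) := by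
    choose N hN using fun a : D.reg (D.loc f) => hex a a.2
    refine ⟨∑ m ∈ q.support, N (q.coeff m), fun m => ?_⟩
    by_cases hm : m ∈ q.support
    · refine mul_pow_mem_of_le h1 ?_ (hN (q.coeff m))
      have := Finset.single_le_sum (f := fun m => N (q.coeff m)) (fun _ _ => Nat.zero_le _) hm
      exact this.trans (Nat.le_add_left _ _)
    · rw [notMem_support_iff.1 hm]
      simp
  refine ⟨M, ∑ m ∈ q.support, sectionRing.mono D.sec (m + M) ⟨_, hM m⟩, ?_⟩
  rw [hX]
  refine Polynomial.ext fun n => Subtype.ext ?_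
  rw [hh, AddSubmonoidClass.coe_finsetSum, finsetSum_coeff, coeff_X_pow_mul']
  simp only [sectionRing.coe_mono, coeff_monomial]
  split_ifs with hn
  · rw [Finset.sum_eq_single (n - M)]
    · rw [if_pos (Nat.sub_add_cancel hn)]
      rw [Nat.sub_add_cancel hn, mul_div_cancel_right₀ _ (pow_ne_zero n hf)]
    · intro b _ hb
      exact if_neg (by omega)
    · intro h0
      simp [notMem_support_iff.1 h0]
  · rw [Finset.sum_eq_zero, zero_div]
    · rfl
    · intro b _
      exact if_neg (by omega)

lemma hilb_grading (D : SecData k K X) (n : ℕ) :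
    (sectionRing.grading D.sec).hilb ⊥ n = Module.finrank k (D.sec n) := by
  rw [PolyGrading.hilb, ← (sectionRing.degEquiv D.sec n).finrank_eq]
  simp

attribute [local instance] Polynomial.algebra in
lemma Endo.localization {d : ℕ} (E : D.Endo d) {r : ℕ} {f : K} (hf : f ≠ 0)
    (h1 : f ∈ D.sec 1) (hex : ∀ a ∈ D.reg (D.loc f), ∃ n, a * f ^ n ∈ D.sec n)
    (hex' : ∀ a ∈ (D.pow d).reg ((D.pow d).loc (E.c * E.σ f)),
      ∃ n, a * (E.c * E.σ f) ^ n ∈ (D.pow d).sec n)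
    (hE : (E.regMap h1).toRingHom.EtaleRank r) (F : D.ring) (hF : (F : K[X]) = monomial 1 f) :
    let _ : Algebra D.ring (D.pow d).ring := E.map.toRingHom.toAlgebra
    _root_.EtaleRank r (Localization.Away F) (Localization.Away F ⊗[D.ring] (D.pow d).ring) := by
  intro _
  have hne : E.c * E.σ f ≠ 0 := mul_ne_zero E.c_ne ((map_ne_zero E.σ).2 hf)
  have h1' : E.c * E.σ f ∈ (D.pow d).sec 1 := by
    simpa [mul_comm] using E.map_sec h1
  obtain ⟨h, hh⟩ := exists_locMap D hf
  obtain ⟨h', hh'⟩ := exists_locMap (D.pow d) hne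
  let P := (D.reg (D.loc f))[X]
  let P' := ((D.pow d).reg ((D.pow d).loc (E.c * E.σ f)))[X]
  let _ : Algebra (D.reg (D.loc f)) ((D.pow d).reg ((D.pow d).loc (E.c * E.σ f))) :=
    (E.regMap h1).toRingHom.toAlgebra
  have hPP : _root_.EtaleRank r P P' := _root_.EtaleRank.polynomial hE
  let _ : Algebra D.ring P := h.toAlgebra
  let _ : Algebra (D.pow d).ring P' := h'.toAlgebra
  let _ : Algebra D.ring P' := (h'.comp E.map.toRingHom).toAlgebra
  have : IsScalarTower D.ring (D.pow d).ring P' := .of_algebraMap_eq fun _ => rfl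
  have : IsScalarTower D.ring P P' := .of_algebraMap_eq fun a => by
    refine Polynomial.ext fun n => Subtype.ext ?_
    change ((h' (E.map a)).coeff n : K) =
      ((Polynomial.map (E.regMap h1).toRingHom (h a)).coeff n : K)
    rw [hh', E.coeff_map, Polynomial.coeff_map]
    change _ = E.σ ((h a).coeff n)
    rw [hh, map_div₀, map_pow, mul_pow, mul_comm (E.c ^ n),
      mul_div_mul_right _ _ (pow_ne_zero n E.c_ne)]
  have hF' : (E.map F : K[X]) = monomial 1 (E.c * E.σ f) := by
    refine Polynomial.ext fun n => ?_
    rw [E.coeff_map, hF, coeff_monomial, coeff_monomial]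
    split_ifs with hn
    · subst hn; rw [pow_one, mul_comm]
    · simp
  exact EtaleRank.localization (P := P) (P' := P') F hPP (locMap_injective hf h hh)
    (locMap_surj hf h1 hex h hh F hF) (locMap_injective hne h' hh')
    (locMap_surj hne h1' hex' h' hh' _ hF')

lemma Endo.finrank_sec (hD : D.Proper) {s : ℕ} {f : Fin s → K} (hf : D.Gen f)
    (ha : ∀ i, D.Affine (f i)) (i₀ : Fin s) {z : K} (hz : z ∈ D.reg (D.loc (f i₀)))
    (hzt : Transcendental k z) {d : ℕ} (hd : 0 < d) (E : D.Endo d)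
    (hex : ∀ i, ∀ a ∈ (D.pow d).reg ((D.pow d).loc (E.c * E.σ (f i))),
      ∃ n, a * (E.c * E.σ (f i)) ^ n ∈ (D.pow d).sec n)
    {r : ℕ} (hE : ∀ i, (E.regMap (hf.mem i)).toRingHom.EtaleRank r) :
    ∀ᶠ n in atTop, Module.finrank k (D.sec (d * n)) = r * Module.finrank k (D.sec n) := by
  have hft : Algebra.FiniteType k D.ring := hf.finiteType hD ha i₀ hz hzt
  have hft' : Algebra.FiniteType k (D.pow d).ring := by
    refine (hf.pow hd).finiteType (D := D.pow d) hD (fun i => (ha i).pow (hf.mem i) hd) i₀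
      (z := z) ?_ hzt
    rw [loc_pow (hf.mem i₀) hd]
    exact hz
  let _ : Algebra D.ring (D.pow d).ring := E.map.toRingHom.toAlgebra
  have : IsScalarTower k D.ring (D.pow d).ring :=
    .of_algebraMap_eq fun c => (E.map.commutes c).symm
  have hnoeth : IsNoetherianRing D.ring := Algebra.FiniteType.isNoetherianRing k _
  have hgen : (D.pow d).Gen fun i => E.c * E.σ (f i) := by
    refine ⟨fun i => mul_ne_zero E.c_ne ((map_ne_zero E.σ).2 (hf.ne i)), fun i => ?_, fun x => ?_⟩
    · simpa [mul_comm] using E.map_sec (hf.mem i)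
    · obtain ⟨i, hi⟩ := hf.cover (E.φ x)
      exact ⟨i, (E.mem_loc (hf.mem i)).2 hi⟩
  have hF_int : Algebra.IsIntegral D.ring (D.pow d).ring := by
    refine ⟨fun b => ?_⟩
    obtain ⟨p, hp, hpb⟩ := hgen.isIntegral (D := D.pow d) hD b
    have hle : ∀ x ∈ Algebra.adjoin k (Set.range hgen.elt), x ∈ (algebraMap D.ring (D.pow d).ring).range := by
      intro x hx
      have : Algebra.adjoin k (Set.range hgen.elt) ≤ E.map.range := by
        rw [Algebra.adjoin_le_iff]
        rintro _ ⟨i, rfl⟩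
        refine ⟨hf.elt i, ?_⟩
        refine (E.map_mono _).trans (Subtype.ext ?_)
        simp [Gen.elt, mul_comm]
      exact this hx
    have hl : p.map (algebraMap _ (D.pow d).ring) ∈ Polynomial.lifts
        (algebraMap D.ring (D.pow d).ring) := by
      rw [lifts_iff_coeff_lifts]
      intro n
      rw [Polynomial.coeff_map]
      exact hle _ (p.coeff n).2
    obtain ⟨q, hq, -, hqm⟩ := lifts_and_natDegree_eq_and_monic hl (hp.map _)
    exact ⟨q, hqm, by rw [← Polynomial.eval_map, hq, Polynomial.eval_map, hpb]⟩
  have : Algebra.FiniteType D.ring (D.pow d).ring := .of_restrictScalars_finiteType k _ _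
  have : Module.Finite D.ring (D.pow d).ring := Algebra.IsIntegral.finite
  have hcompat : (sectionRing.grading D.sec).Compat (sectionRing.grading (D.pow d).sec) := by
    intro a
    refine Polynomial.ext fun n => ?_
    rw [Polynomial.coeff_map]
    refine (sectionRing.coeff_coactFun (R := (D.pow d).sec) _ n).trans ?_
    refine Eq.trans ?_ (congrArg E.map (sectionRing.coeff_coactFun a n)).symm
    rw [E.map_mono]
    congr 1
    exact Subtype.ext (E.coeff_map a n)
  have := PolyGrading.hilb_map r hcompat (hf.good hD) (fun i => E.localization (hf.ne i) (hf.mem i)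
    (ha i).exists_mul_pow_mem (hex i) (hE i) (hf.elt i) rfl) ⊥ (PolyGrading.homog_bot _)
  filter_upwards [this] with n hn
  rw [Ideal.map_bot, Submodule.restrictScalars_bot, Submodule.restrictScalars_bot,
    hilb_grading, hilb_grading, pow_sec] at hn
  exact_mod_cast hn

end SecData

namespace MvPolynomial

lemma nat_card_setOf_le (t n : ℕ) :
    Nat.card {s : Fin t →₀ ℕ | ∀ i, s i ≤ n} = (n + 1) ^ t := by
  let e : {s : Fin t →₀ ℕ | ∀ i, s i ≤ n} ≃ (Fin t → Fin (n + 1)) :=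
    { toFun := fun s i => ⟨s.1 i, Nat.lt_succ_of_le (s.2 i)⟩
      invFun := fun g => ⟨Finsupp.equivFunOnFinite.symm fun i => g i,
        fun i => Nat.le_of_lt_succ (g i).2⟩
      left_inv := fun s => Subtype.ext (Finsupp.ext fun i => rfl)
      right_inv := fun g => rfl }
  rw [Nat.card_congr e]
  simp

lemma finite_setOf_le (t n : ℕ) : Finite {s : Fin t →₀ ℕ | ∀ i, s i ≤ n} :=
  Nat.finite_of_card_ne_zero (by rw [nat_card_setOf_le]; positivity)

variable (k : Type*) [Field k]

lemma finrank_restrictDegree (t n : ℕ) :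
    Module.finrank k (restrictDegree (Fin t) k n) = (n + 1) ^ t := by
  rw [restrictDegree, Module.finrank_eq_nat_card_basis (basisRestrictSupport k _),
    nat_card_setOf_le]

instance finiteDimensional_restrictDegree (t n : ℕ) :
    FiniteDimensional k (restrictDegree (Fin t) k n) :=
  have := finite_setOf_le t n
  .of_basis (basisRestrictSupport k {s : Fin t →₀ ℕ | ∀ i, s i ≤ n})

variable {k}

lemma mem_restrictDegree_iff_degreeOf {σ : Type*} {p : MvPolynomial σ k} {n : ℕ} :
    p ∈ restrictDegree σ k n ↔ ∀ i, degreeOf i p ≤ n := by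
  simp only [mem_restrictDegree, degreeOf_le_iff]
  exact ⟨fun h i m hm => h m hm i, fun h m hm i => h i m hm⟩

lemma mul_mem_restrictDegree {σ : Type*} {p q : MvPolynomial σ k} {m n : ℕ}
    (hp : p ∈ restrictDegree σ k m) (hq : q ∈ restrictDegree σ k n) :
    p * q ∈ restrictDegree σ k (m + n) := by
  rw [mem_restrictDegree_iff_degreeOf] at *
  exact fun i => (degreeOf_mul_le i p q).trans (Nat.add_le_add (hp i) (hq i))

lemma restrictDegree_mono {σ : Type*} {m n : ℕ} (h : m ≤ n) :
    restrictDegree σ k m ≤ restrictDegree σ k n := by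
  intro p hp
  rw [mem_restrictDegree_iff_degreeOf] at *
  exact fun i => (hp i).trans h

lemma exists_mem_restrictDegree {t : ℕ} (p : MvPolynomial (Fin t) k) :
    ∃ n, p ∈ restrictDegree (Fin t) k n :=
  ⟨p.totalDegree, mem_restrictDegree_iff_degreeOf.2 fun i => degreeOf_le_totalDegree p i⟩

end MvPolynomial

/-- The combinations of a finite family with coefficients of bounded degree. -/
def boundedSpan {k A : Type*} [Field k] [CommRing A] [Algebra k A] {t l : ℕ}
    (g : MvPolynomial (Fin t) k →ₐ[k] A) (w : Fin l → A) (n : ℕ) : Submodule k A where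
  carrier := {a | ∃ p : Fin l → MvPolynomial (Fin t) k,
    (∀ j, p j ∈ MvPolynomial.restrictDegree (Fin t) k n) ∧ a = ∑ j, g (p j) * w j}
  zero_mem' := ⟨0, fun j => zero_mem _, by simp⟩
  add_mem' := by
    rintro _ _ ⟨p, hp, rfl⟩ ⟨q, hq, rfl⟩
    exact ⟨p + q, fun j => add_mem (hp j) (hq j), by
      simp [add_mul, Finset.sum_add_distrib]⟩
  smul_mem' := by
    rintro c _ ⟨p, hp, rfl⟩
    exact ⟨c • p, fun j => Submodule.smul_mem _ c (hp j), by simp [Finset.smul_sum]⟩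

section boundedSpan

variable {k A : Type*} [Field k] [CommRing A] [Algebra k A] {t l : ℕ}
  {g : MvPolynomial (Fin t) k →ₐ[k] A} {w : Fin l → A}

lemma boundedSpan_mono {m n : ℕ} (h : m ≤ n) : boundedSpan g w m ≤ boundedSpan g w n := by
  rintro _ ⟨p, hp, rfl⟩
  exact ⟨p, fun j => MvPolynomial.restrictDegree_mono h (hp j), rfl⟩

lemma finrank_boundedSpan (n : ℕ) : FiniteDimensional k (boundedSpan g w n) ∧
    Module.finrank k (boundedSpan g w n) ≤ l * (n + 1) ^ t := by
  let F : (Fin l → MvPolynomial.restrictDegree (Fin t) k n) →ₗ[k] A :=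
    ∑ j, ((LinearMap.mulRight k (w j)).comp (g.toLinearMap.comp (Submodule.subtype _))).comp
      (LinearMap.proj j)
  have hF : LinearMap.range F = boundedSpan g w n := by
    ext a
    constructor
    · rintro ⟨p, rfl⟩
      exact ⟨fun j => p j, fun j => (p j).2, by simp [F]⟩
    · rintro ⟨p, hp, rfl⟩
      exact ⟨fun j => ⟨p j, hp j⟩, by simp [F]⟩
  rw [← hF]
  refine ⟨inferInstance, (LinearMap.finrank_range_le F).trans ?_⟩
  rw [Module.finrank_pi_fintype]
  simp [MvPolynomial.finrank_restrictDegree]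

lemma exists_mem_boundedSpan (hw : ∀ a, ∃ p : Fin l → MvPolynomial (Fin t) k,
    a = ∑ j, g (p j) * w j) (a : A) : ∃ n, a ∈ boundedSpan g w n := by
  obtain ⟨p, hp⟩ := hw a
  choose N hN using fun j => MvPolynomial.exists_mem_restrictDegree (p j)
  exact ⟨Finset.univ.sup N, p, fun j => MvPolynomial.restrictDegree_mono
    (Finset.le_sup (f := N) (Finset.mem_univ j)) (hN j), hp⟩

lemma exists_mul_mem_boundedSpan (hw : ∀ a, ∃ p : Fin l → MvPolynomial (Fin t) k,
    a = ∑ j, g (p j) * w j) (y : A) :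
    ∃ c, ∀ n, ∀ a ∈ boundedSpan g w n, y * a ∈ boundedSpan g w (n + c) := by
  choose N hN using fun j => exists_mem_boundedSpan hw (y * w j)
  refine ⟨Finset.univ.sup N, ?_⟩
  rintro n _ ⟨p, hp, rfl⟩
  rw [Finset.mul_sum]
  refine sum_mem fun j _ => ?_
  obtain ⟨q, hq, hq'⟩ := boundedSpan_mono (Finset.le_sup (f := N) (Finset.mem_univ j)) (hN j)
  refine ⟨fun i => p j * q i, fun i => MvPolynomial.mul_mem_restrictDegree (hp j) (hq i), ?_⟩
  rw [mul_left_comm, hq', Finset.mul_sum]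
  simp [mul_assoc]

lemma exists_le_boundedSpan (hw : ∀ a, ∃ p : Fin l → MvPolynomial (Fin t) k,
    a = ∑ j, g (p j) * w j) (V : Submodule k A) [FiniteDimensional k V] :
    ∃ n, V ≤ boundedSpan g w n := by
  obtain ⟨S, hS⟩ := (Module.Finite.iff_fg.1 ‹_› : V.FG)
  choose N hN using exists_mem_boundedSpan hw
  refine ⟨S.sup N, ?_⟩
  rw [← hS, Submodule.span_le]
  exact fun a ha => boundedSpan_mono (Finset.le_sup ha) (hN a)

end boundedSpan

namespace SecData

variable {k K : Type u} {P : Type*} [Field k] [Field K] [Algebra k K] {D : SecData k K P}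

lemma exists_le_finrank_sec {f : K} (hf : f ≠ 0) (h1 : f ∈ D.sec 1) (ha : D.Affine f)
    (hfin : ∀ n, FiniteDimensional k (D.sec n)) {t : ℕ}
    (g : MvPolynomial (Fin t) k →ₐ[k] D.reg (D.loc f)) (hg : Function.Injective g) :
    ∃ M > 0, ∀ n, (n + 1) ^ t ≤ Module.finrank k (D.sec (M * n)) := by
  choose N hN using fun a : D.reg (D.loc f) => ha.exists_mul_pow_mem a a.2
  let M := Finset.univ.sup fun i => N (g (MvPolynomial.X i))
  have hM : ∀ i, (g (MvPolynomial.X i) : K) * f ^ M ∈ D.sec M := fun i =>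
    mul_pow_mem_of_le h1 (Finset.le_sup (f := fun i => N (g (MvPolynomial.X i)))
      (Finset.mem_univ i)) (hN _)
  have hmon : ∀ s : Fin t →₀ ℕ, (g (MvPolynomial.monomial s 1) : K) * f ^ (∑ i, s i * M) ∈
      D.sec (∑ i, s i * M) := by
    intro s
    rw [MvPolynomial.monomial_eq, map_one, one_mul, Finsupp.prod_fintype _ _ (by simp),
      map_prod, ← Finset.prod_pow_eq_pow_sum, SubmonoidClass.coe_finsetProd,
      ← Finset.prod_mul_distrib]
    refine SetLike.prod_mem_graded _ _ _ fun i _ => ?_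
    have := SetLike.pow_mem_graded (s i) (hM i)
    rw [smul_eq_mul, mul_pow, ← pow_mul, mul_comm M] at this
    rwa [map_pow, SubmonoidClass.coe_pow]
  refine ⟨t * M + 1, Nat.succ_pos _, fun n => ?_⟩
  let F : MvPolynomial (Fin t) k →ₗ[k] K := (LinearMap.mulRight k (f ^ ((t * M + 1) * n))).comp
    ((D.reg (D.loc f)).val.toLinearMap.comp g.toLinearMap)
  have hF : MvPolynomial.restrictDegree (Fin t) k n ≤ (D.sec ((t * M + 1) * n)).comap F := by
    rw [MvPolynomial.restrictDegree, MvPolynomial.restrictSupport_eq_span, Submodule.span_le]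
    rintro _ ⟨s, hs, rfl⟩
    refine mul_pow_mem_of_le h1 ?_ (hmon s)
    calc ∑ i, s i * M ≤ ∑ _i : Fin t, n * M :=
          Finset.sum_le_sum fun i _ => Nat.mul_le_mul_right _ (hs i)
      _ = t * (n * M) := by simp
      _ ≤ (t * M + 1) * n := by nlinarith
  have hinj : Function.Injective F := by
    intro p q h
    exact hg (Subtype.ext (mul_right_cancel₀ (pow_ne_zero _ hf) h))
  have := hfin ((t * M + 1) * n)
  rw [← MvPolynomial.finrank_restrictDegree k t n]
  refine LinearMap.finrank_le_finrank_of_injective (f := F.restrict hF) ?_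
  intro p q h
  exact Subtype.ext (hinj (congrArg Subtype.val h))

lemma exists_finrank_sec_le {s : ℕ} {f : Fin s → K} (hf : D.Gen f)
    (hG : (sectionRing.grading D.sec).Good hf.elt)
    (i₀ : Fin s) {t : ℕ} (g : MvPolynomial (Fin t) k →ₐ[k] D.reg (D.loc (f i₀)))
    (hg : g.Finite) :
    ∃ l C : ℕ, ∀ᶠ n in atTop, Module.finrank k (D.sec n) ≤ l * (C * n + 1) ^ t := by
  obtain ⟨l, w, hw⟩ : ∃ (l : ℕ) (w : Fin l → D.reg (D.loc (f i₀))),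
      ∀ a, ∃ p : Fin l → MvPolynomial (Fin t) k, a = ∑ j, g (p j) * w j := by
    let _ : Algebra (MvPolynomial (Fin t) k) (D.reg (D.loc (f i₀))) := g.toRingHom.toAlgebra
    have : Module.Finite (MvPolynomial (Fin t) k) (D.reg (D.loc (f i₀))) := hg
    obtain ⟨l, w, hw⟩ := Module.Finite.exists_fin (R := MvPolynomial (Fin t) k)
      (M := D.reg (D.loc (f i₀)))
    refine ⟨l, w, fun a => ?_⟩
    have ha : a ∈ Submodule.span (MvPolynomial (Fin t) k) (Set.range w) := hw ▸ Submodule.mem_top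
    obtain ⟨p, hp⟩ := (Submodule.mem_span_range_iff_exists_fun _).1 ha
    exact ⟨p, hp.symm⟩
  have hne := hf.ne i₀
  let y (i : Fin s) : D.reg (D.loc (f i₀)) :=
    ⟨f i / f i₀, by simpa using div_pow_mem_reg hne (hf.mem i)⟩
  choose c hc using fun i => exists_mul_mem_boundedSpan hw (y i)
  obtain ⟨n₀, hn₀⟩ := eventually_atTop.1 (hG.eventually 1)
  have hfin := hG.finite n₀
  have : FiniteDimensional k (D.sec n₀) := Module.Finite.equiv (sectionRing.degEquiv D.sec n₀).symm
  let Q (n : ℕ) : D.sec n →ₗ[k] D.reg (D.loc (f i₀)) :=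
    { toFun := fun a => ⟨a / f i₀ ^ n, div_pow_mem_reg hne a.2⟩
      map_add' := fun a b => Subtype.ext (add_div _ _ _)
      map_smul' := fun r a => Subtype.ext (smul_div_assoc _ _ _) }
  have hQ (n) : Function.Injective (Q n) := fun a b h => Subtype.ext <|
    (div_left_inj' (pow_ne_zero n hne)).1 (congrArg Subtype.val h)
  obtain ⟨c₀, hc₀⟩ := exists_le_boundedSpan hw (LinearMap.range (Q n₀))
  let C := Finset.univ.sup c
  have key : ∀ n, n₀ ≤ n → LinearMap.range (Q n) ≤ boundedSpan g w (C * n + c₀) := by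
    intro n hn
    induction n, hn using Nat.le_induction with
    | base => exact hc₀.trans (boundedSpan_mono (Nat.le_add_left _ _))
    | succ n hn ih =>
      rintro _ ⟨a, rfl⟩
      have h1 := hn₀ (n + 1) (by omega) _ (sectionRing.mono_mem_deg (n + 1) a)
      simp only [pow_one] at h1
      obtain ⟨b, hb⟩ := (Submodule.mem_span_range_iff_exists_fun _).1 h1
      have h2 : Q (n + 1) a = ∑ i, y i * Q n (sectionRing.part (b i) n) := by
        have h3 := congrArg (fun p : D.ring => (p : K[X]).coeff (n + 1)) hb
        rw [AddSubmonoidClass.coe_finsetSum, finsetSum_coeff] at h3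
        simp only [smul_eq_mul, MulMemClass.coe_mul, Gen.elt, sectionRing.coe_mono,
          coeff_monomial_same] at h3
        refine Subtype.ext ?_
        rw [AddSubmonoidClass.coe_finsetSum]
        change (a : K) / f i₀ ^ (n + 1) = ∑ i, f i / f i₀ * (((b i : K[X]).coeff n) / f i₀ ^ n)
        rw [← h3, Finset.sum_div]
        refine Finset.sum_congr rfl fun i _ => ?_
        rw [coeff_mul_monomial]
        field_simp
        ring
      rw [h2]
      refine sum_mem fun i _ => boundedSpan_mono ?_ (hc i _ _ (ih ⟨_, rfl⟩))
      have : c i ≤ C := Finset.le_sup (f := c) (Finset.mem_univ i)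
      nlinarith
  refine ⟨l, C + c₀, ?_⟩
  filter_upwards [eventually_ge_atTop n₀, eventually_gt_atTop 0] with n hn hn0
  obtain ⟨h1, h2⟩ := finrank_boundedSpan (g := g) (w := w) (C * n + c₀)
  rw [← LinearMap.finrank_range_of_inj (hQ n)]
  refine (Submodule.finrank_mono (key n hn)).trans (h2.trans ?_)
  gcongr
  nlinarith

end SecData

lemma EtaleRank.of_isFractionRing {A B K L : Type*} [CommRing A] [CommRing B] [Field K] [Field L]
    [IsDomain A] [IsDomain B]
    [Algebra A B] [Algebra A K] [Algebra B L] [Algebra K L] [IsFractionRing A K]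
    [IsFractionRing B L]
    (h : ∀ a, algebraMap B L (algebraMap A B a) = algebraMap K L (algebraMap A K a))
    (hu : Algebra.FormallyUnramified A B) (hfin : Module.Finite A B) (hfl : Module.Flat A B) :
    EtaleRank (Module.finrank K L) A B := by
  refine ⟨hu, hfin, hfl, fun p => ?_⟩
  have hp := p.2
  rw [Module.rankAtStalk_eq, Ideal.finrank_fiber_eq_finrank]
  let _ : Algebra A L := ((algebraMap K L).comp (algebraMap A K)).toAlgebra
  have : IsScalarTower A K L := .of_algebraMap_eq fun _ => rfl
  have : IsScalarTower A B L := .of_algebraMap_eq fun a => (h a).symm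
  have hinj : Function.Injective (algebraMap A B) := by
    refine Function.Injective.of_comp (f := algebraMap B L) ?_
    have : ⇑(algebraMap B L) ∘ algebraMap A B = algebraMap K L ∘ algebraMap A K := funext h
    rw [this]
    exact (algebraMap K L).injective.comp (IsFractionRing.injective A K)
  have : FaithfulSMul A B := (faithfulSMul_iff_algebraMap_injective A B).2 hinj
  have := Algebra.IsAlgebraic.lift_rank_of_isFractionRing A K B L
  have h2 := congrArg Cardinal.toNat this
  simpa [Module.finrank] using h2.symm

lemma Polynomial.eq_of_eventually_eval_natCast {p q : ℚ[X]}
    (h : ∀ᶠ n : ℕ in atTop, p.eval (n : ℚ) = q.eval (n : ℚ)) : p = q := by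
  obtain ⟨N, hN⟩ := eventually_atTop.1 h
  refine eq_of_infinite_eval_eq p q (((Set.Ici_infinite N).image
    (f := fun n : ℕ => (n : ℚ)) Nat.cast_injective.injOn).mono ?_)
  rintro _ ⟨n, hn, rfl⟩
  exact hN n hn

lemma Polynomial.eq_C_mul_X_pow_of_comp {p : ℚ[X]} {d r : ℕ} (hd : 1 < d)
    (h : p.comp (C (d : ℚ) * X) = C (r : ℚ) * p) :
    p = C p.leadingCoeff * X ^ p.natDegree := by
  by_cases hp : p = 0
  · simp [hp]
  have hc (n) : p.coeff n * (d : ℚ) ^ n = r * p.coeff n := by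
    rw [← comp_C_mul_X_coeff, h, coeff_C_mul]
  have h0 (n) (hn : p.coeff n ≠ 0) : (d : ℚ) ^ n = r :=
    mul_left_cancel₀ hn (by rw [hc n, mul_comm])
  ext n
  rw [coeff_C_mul, coeff_X_pow]
  split_ifs with hn
  · rw [hn, mul_one]; rfl
  · rw [mul_zero]
    by_contra hn0
    have h1 := (h0 n hn0).trans (h0 _ (leadingCoeff_ne_zero.2 hp)).symm
    exact hn (Nat.pow_right_injective hd (by exact_mod_cast h1))

/-- A monomial function bounded between two polynomial growth rates has that degree. -/
lemma natDegree_le_of_growth {a : ℚ} {m t l c : ℕ} (ha : 0 < a)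
    (h : ∀ᶠ n : ℕ in atTop, a * (n : ℚ) ^ m ≤ l * (c * n + 1) ^ t) : m ≤ t := by
  by_contra! hlt
  obtain ⟨N, hN⟩ := eventually_atTop.1 h
  obtain ⟨M, hM⟩ := exists_nat_gt ((l : ℚ) * (c + 1) ^ t / a)
  have h1 := hN (N + M + 1) (by omega)
  rw [div_lt_iff₀ ha] at hM
  set n : ℚ := ((N + M + 1 : ℕ) : ℚ) with hn
  have hn1 : 1 ≤ n := by rw [hn]; exact_mod_cast Nat.le_add_left 1 _
  have hMn : (M : ℚ) ≤ n := by rw [hn]; exact_mod_cast (by omega)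
  have h2 : (c * n + 1 : ℚ) ^ t ≤ (c + 1) ^ t * n ^ t := by
    rw [← mul_pow]
    gcongr
    linarith
  have h3 : n ^ t * n ≤ n ^ m := by
    rw [← pow_succ]
    exact pow_le_pow_right₀ hn1 hlt
  have hnt : 0 < n ^ t := by positivity
  have h4 : a * (n ^ t * n) ≤ l * ((c + 1) ^ t * n ^ t) :=
    (mul_le_mul_of_nonneg_left h3 ha.le).trans (h1.trans (by gcongr))
  have h5 : a * n ≤ l * (c + 1) ^ t := by
    refine le_of_mul_le_mul_right ?_ hnt
    linarith
  nlinarith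

lemma le_natDegree_of_growth {a : ℚ} {m t M : ℕ}
    (h : ∀ᶠ n : ℕ in atTop, ((n : ℚ) + 1) ^ t ≤ a * ((M * n : ℕ) : ℚ) ^ m) : t ≤ m := by
  have ha : 0 < a := by
    obtain ⟨n, hn⟩ := h.exists
    by_contra! h0
    have : (0 : ℚ) < ((n : ℚ) + 1) ^ t := by positivity
    have h2 : a * ((M * n : ℕ) : ℚ) ^ m ≤ 0 := mul_nonpos_of_nonpos_of_nonneg h0 (by positivity)
    linarith
  obtain ⟨l, hl⟩ := exists_nat_gt (a * M ^ m)
  refine natDegree_le_of_growth (a := 1) (l := l) (c := 1) one_pos ?_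
  filter_upwards [h] with n hn
  have h1 : (n : ℚ) ^ t ≤ (n + 1) ^ t := by gcongr; linarith
  push_cast at hn
  rw [mul_pow, ← mul_assoc] at hn
  have h2 : (a * M ^ m) * (n : ℚ) ^ m ≤ l * (1 * n + 1) ^ m := by
    gcongr
    linarith
  push_cast
  linarith

namespace SecData

variable {k K : Type u} {S : Type*} [Field k] [Field K] [Algebra k K] {D : SecData k K S}

lemma pow_mem_sec {f : K} (hf : f ∈ D.sec 1) (n : ℕ) : f ^ n ∈ D.sec n := fun x => by
  rw [← mul_pow]
  exact (D.O x).pow_mem (by simpa using hf x) n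

lemma finrank_sec_eq_one [IsAlgClosed k] {f : K} (hf : f ≠ 0) (h1 : f ∈ D.sec 1)
    (h : ∀ z ∈ D.reg (D.loc f), ¬ Transcendental k z) (n : ℕ) :
    Module.finrank k (D.sec n) = 1 := by
  have hn := pow_ne_zero n hf
  refine finrank_eq_one (⟨f ^ n, pow_mem_sec h1 n⟩ : D.sec n) (fun h0 => hn
    (congrArg Subtype.val h0)) fun y => ?_
  have hy := h _ (div_pow_mem_reg hf y.2)
  rw [Transcendental, not_not] at hy
  obtain ⟨c, hc⟩ : (y : K) / f ^ n ∈ (algebraMap k K).range := by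
    let L := IntermediateField.adjoin k {(y : K) / f ^ n}
    have : Algebra.IsIntegral k L := ⟨fun z => by
      have : FiniteDimensional k L := IntermediateField.adjoin.finiteDimensional hy.isIntegral
      exact .of_finite k z⟩
    obtain ⟨c, hc⟩ := (IsAlgClosed.algebraMap_bijective_of_isIntegral (k := k) (K := L)).2
      ⟨_, IntermediateField.mem_adjoin_simple_self k _⟩
    exact ⟨c, congrArg Subtype.val hc⟩
  refine ⟨c, Subtype.ext ?_⟩
  change c • f ^ n = _
  rw [Algebra.smul_def, hc, div_mul_cancel₀ _ hn]

lemma exists_transcendental {t : ℕ} {A : Subalgebra k K} {g : MvPolynomial (Fin t) k →ₐ[k] A}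
    (hg : Function.Injective g) (ht : t ≠ 0) : ∃ z ∈ A, Transcendental k z := by
  obtain ⟨j⟩ : Nonempty (Fin t) := Fin.pos_iff_nonempty.1 (Nat.pos_of_ne_zero ht)
  refine ⟨_, (g (MvPolynomial.X j)).2, ?_⟩
  have h1 := MvPolynomial.transcendental_X k j
  have h2 : Function.Injective (A.val.comp g) := Subtype.val_injective.comp hg
  exact fun h => h1 ((isAlgebraic_algHom_iff (A.val.comp g) h2).1 h)

lemma Endo.exists_eq_C_mul_X_pow [IsAlgClosed k] [Nonempty S] (hD : D.Proper) {s : ℕ}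
    {f : Fin s → K} (hf : D.Gen f) (hfg : ∀ i, (D.reg (D.loc (f i))).FG)
    (hext : ∀ n, ∀ y ∈ D.sec n, y ≠ 0 → ∀ a ∈ D.reg ((D.pow n).loc y),
      ∃ m, a * y ^ m ∈ D.sec (n * m))
    (hfrac : ∀ i, IsFractionRing (D.reg (D.loc (f i))) K)
    {d : ℕ} (hd : 1 < d) (E : D.Endo d)
    (hfrac' : ∀ i, IsFractionRing ((D.pow d).reg ((D.pow d).loc (E.c * E.σ (f i)))) K)
    (hE : ∀ i, (E.regMap (hf.mem i)).toRingHom.Flat ∧ (E.regMap (hf.mem i)).toRingHom.Finite ∧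
      (E.regMap (hf.mem i)).toRingHom.FormallyUnramified)
    {Q : ℚ[X]} (hQ : ∀ᶠ n : ℕ in atTop, Q.eval (n : ℚ) = Module.finrank k (D.sec n)) :
    ∃ m, (∀ i, ∃ g : MvPolynomial (Fin m) k →ₐ[k] D.reg (D.loc (f i)),
      Function.Injective g ∧ g.Finite) ∧ Q.leadingCoeff ≠ 0 ∧ Q = C Q.leadingCoeff * X ^ m := by
  have hpow : D.pow 1 = D := by
    obtain ⟨O, τ, hτ⟩ := D
    change SecData.mk _ _ _ = _
    congr
    exact funext fun x => pow_one _
  have ha (i) : D.Affine (f i) := ⟨hfg i, fun a ha => by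
    have := hext 1 (f i) (hf.mem i) (hf.ne i) a (by rwa [hpow])
    simpa using this⟩
  have hN (i) : ∃ t, ∃ g : MvPolynomial (Fin t) k →ₐ[k] D.reg (D.loc (f i)),
      Function.Injective g ∧ g.Finite := by
    have : Algebra.FiniteType k (D.reg (D.loc (f i))) :=
      (D.reg (D.loc (f i))).fg_iff_finiteType.1 (hfg i)
    exact exists_finite_inj_algHom_of_fg k _
  choose t g hg hgf using hN
  obtain ⟨x₀⟩ := ‹Nonempty S›
  obtain ⟨j₀, -⟩ := hf.cover x₀
  by_cases hz : ∀ i, ∀ z ∈ D.reg (D.loc (f i)), ¬ Transcendental k z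
  · refine ⟨0, fun i => ?_, ?_⟩
    · by_cases hti : t i = 0
      · rw [← hti]
        exact ⟨g i, hg i, hgf i⟩
      · obtain ⟨z, hz1, hz2⟩ := exists_transcendental (hg i) hti
        exact absurd hz2 (hz i z hz1)
    · have : Q = 1 := eq_of_eventually_eval_natCast (hQ.mono fun n hn => by
        rw [hn, finrank_sec_eq_one (hf.ne j₀) (hf.mem j₀) (hz j₀)]; simp)
      simp [this]
  push Not at hz
  obtain ⟨i₀, z, hz, hzt⟩ := hz
  have hft : Algebra.FiniteType k D.ring := hf.finiteType hD ha i₀ hz hzt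
  have hG := hf.good hD
  have hfin (n) : FiniteDimensional k (D.sec n) := by
    have := hG.finite n
    exact Module.Finite.equiv (sectionRing.degEquiv D.sec n).symm
  have hcf (i) : E.c * E.σ (f i) ∈ (D.pow d).sec 1 := by
    simpa [mul_comm] using E.map_sec (hf.mem i)
  have hcf0 (i) : E.c * E.σ (f i) ≠ 0 := mul_ne_zero E.c_ne ((map_ne_zero E.σ).2 (hf.ne i))
  have hcf' (i) : E.c * E.σ (f i) ∈ D.sec d := by
    have := hcf i
    rwa [pow_sec, mul_one] at this
  have hex : ∀ i, ∀ a ∈ (D.pow d).reg ((D.pow d).loc (E.c * E.σ (f i))),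
      ∃ n, a * (E.c * E.σ (f i)) ^ n ∈ (D.pow d).sec n := fun i a ha => by
    simp only [pow_sec]
    exact hext d _ (hcf' i) (hcf0 i) a ha
  let r : ℕ := @Module.finrank K K _ _ E.σ.toRingHom.toAlgebra.toModule
  have hrank (i) : (E.regMap (hf.mem i)).toRingHom.EtaleRank r := by
    let _ : Algebra (D.reg (D.loc (f i))) ((D.pow d).reg ((D.pow d).loc (E.c * E.σ (f i)))) :=
      (E.regMap (hf.mem i)).toRingHom.toAlgebra
    exact @EtaleRank.of_isFractionRing _ _ K K _ _ _ _ _ _ _ _ _ E.σ.toRingHom.toAlgebra (hfrac i)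
      (hfrac' i)
      (fun a => rfl) (hE i).2.2 (hE i).2.1 (hE i).1
  have hcomp : Q.comp (C (d : ℚ) * Polynomial.X) = C (r : ℚ) * Q := by
    refine eq_of_eventually_eval_natCast ?_
    have hQd : ∀ᶠ n : ℕ in atTop,
        Q.eval ((d * n : ℕ) : ℚ) = Module.finrank k (D.sec (d * n)) :=
      (tendsto_id.const_mul_atTop' (by omega)).eventually hQ
    filter_upwards [hQ, hQd, E.finrank_sec hD hf ha i₀ hz hzt (by omega) hex hrank]
      with n h1 h2 h3
    rw [eval_comp, eval_mul, eval_C, eval_X, eval_mul, eval_C, h1, ← Nat.cast_mul, h2, h3,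
      Nat.cast_mul]
  have hmon := eq_C_mul_X_pow_of_comp hd hcomp
  have hev (n : ℕ) : Q.eval (n : ℚ) = Q.leadingCoeff * (n : ℚ) ^ Q.natDegree := by
    conv_lhs => rw [hmon]
    simp
  have hlow (i) : ∃ M : ℕ, 0 < M ∧ ∀ᶠ n : ℕ in atTop,
      ((n : ℚ) + 1) ^ t i ≤ Q.leadingCoeff * ((M * n : ℕ) : ℚ) ^ Q.natDegree := by
    obtain ⟨M, hM, h⟩ := exists_le_finrank_sec (hf.ne i) (hf.mem i) (ha i) hfin (g i) (hg i)
    have hQM : ∀ᶠ n : ℕ in atTop,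
        Q.eval ((M * n : ℕ) : ℚ) = Module.finrank k (D.sec (M * n)) :=
      (tendsto_id.const_mul_atTop' hM).eventually hQ
    refine ⟨M, hM, hQM.mono fun n hn => ?_⟩
    rw [← hev, hn]
    exact_mod_cast h n
  have hpos : 0 < Q.leadingCoeff := by
    obtain ⟨M, -, h⟩ := hlow i₀
    obtain ⟨n, hn⟩ := h.exists
    by_contra! h0
    have h1 : (0 : ℚ) < ((n : ℚ) + 1) ^ t i₀ := by positivity
    have h2 : Q.leadingCoeff * ((M * n : ℕ) : ℚ) ^ Q.natDegree ≤ 0 :=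
      mul_nonpos_of_nonpos_of_nonneg h0 (by positivity)
    linarith
  have ht (i) : t i = Q.natDegree := by
    refine le_antisymm ?_ ?_
    · obtain ⟨M, hM, h⟩ := hlow i
      exact le_natDegree_of_growth h
    · obtain ⟨l, c, h⟩ := exists_finrank_sec_le hf hG i (g i) (hgf i)
      refine natDegree_le_of_growth hpos (l := l) (c := c) (t := t i) ?_
      filter_upwards [h, hQ] with n h1 h2
      rw [← hev, h2]
      exact_mod_cast h1
  refine ⟨Q.natDegree, fun i => ?_, hpos.ne', hmon⟩
  rw [← ht i]
  exact ⟨g i, hg i, hgf i⟩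

end SecData

lemma ringKrullDim_eq_of_isIntegral_of_injective {R S : Type*} [CommRing R] [CommRing S]
    [Algebra R S] [Algebra.IsIntegral R S] (h : Function.Injective (algebraMap R S)) :
    ringKrullDim R = ringKrullDim S := by
  have : FaithfulSMul R S := (faithfulSMul_iff_algebraMap_injective R S).2 h
  refine le_antisymm (iSup_le fun l => ?_) ?_
  · obtain ⟨P, hP, hPl⟩ := Ideal.exists_ideal_over_prime_of_isIntegral l.head.asIdeal (⊥ : Ideal S)
      (by simp [Ideal.comap_bot_of_injective _ h]) |>.imp fun P hP => hP.2
    have : P.LiesOver l.head.asIdeal := ⟨hPl.symm⟩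
    obtain ⟨L, hL, -⟩ := Ideal.exists_ltSeries_of_hasGoingUp l P
    rw [← hL]
    exact Order.LTSeries.length_le_krullDim L
  · refine Order.krullDim_le_of_strictMono (PrimeSpectrum.comap (algebraMap R S)) fun p q hpq => ?_
    exact Ideal.IsIntegral.comap_lt_comap (R := R) hpq

lemma ringKrullDim_eq_of_finite_injective {k A : Type*} [Field k] [CommRing A] [Algebra k A]
    {m : ℕ} (g : MvPolynomial (Fin m) k →ₐ[k] A) (hg : Function.Injective g) (hgf : g.Finite) :
    ringKrullDim A = m := by
  let _ : Algebra (MvPolynomial (Fin m) k) A := g.toRingHom.toAlgebra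
  have : Module.Finite (MvPolynomial (Fin m) k) A := hgf
  rw [← ringKrullDim_eq_of_isIntegral_of_injective (R := MvPolynomial (Fin m) k) (S := A) hg,
    MvPolynomial.ringKrullDim_of_isNoetherianRing, ringKrullDim_eq_zero_of_field]
  simp

open TopologicalSpace in
lemma topologicalKrullDim_eq_of_cover {X ι : Type*} [TopologicalSpace X] [Nonempty X]
    (U : ι → Opens X) (hU : ∀ x, ∃ i, x ∈ U i) {m : WithBot ℕ∞}
    (h : ∀ i, topologicalKrullDim (U i) = m) : topologicalKrullDim X = m := by
  refine le_antisymm ?_ ?_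
  · rw [topologicalKrullDim, Order.krullDim_eq_iSup_coheight]
    refine iSup_le fun Z => ?_
    obtain ⟨x, hx⟩ := Z.isIrreducible.nonempty
    obtain ⟨i, hi⟩ := hU x
    have ho := (U i).isOpenEmbedding'
    let e := IrreducibleCloseds.orderIsoOfIsOpenEmbedding _ ho
    obtain ⟨W, hW⟩ := e.surjective ⟨Z, ⟨⟨x, hi⟩, hx⟩⟩
    have hWZ : IrreducibleCloseds.map _ ho.continuous W = Z := congrArg Subtype.val hW
    rw [← hWZ, ho.coheight_map, ← h i]
    exact Order.coheight_le_krullDim _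
  · obtain ⟨x⟩ := ‹Nonempty X›
    obtain ⟨i, -⟩ := hU x
    rw [← h i]
    exact topologicalKrullDim_subspace_le X _

open AlgebraicGeometry in
lemma AlgebraicGeometry.IsAffineOpen.topologicalKrullDim_eq {X : Scheme.{u}} {U : X.Opens}
    (hU : IsAffineOpen U) : topologicalKrullDim U = ringKrullDim Γ(X, U) := by
  rw [← PrimeSpectrum.topologicalKrullDim_eq_ringKrullDim]
  exact IsHomeomorph.topologicalKrullDim_eq _ hU.isoSpec.hom.homeomorph.isHomeomorph

lemma Polynomial.eq_of_comp_eq {P : ℚ[X]} {e : ℕ} (he : 0 < e) {m : ℕ} {a : ℚ}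
    (h : P.comp (C (e : ℚ) * X) = C a * X ^ m) : P = C (P.eval 1) * X ^ m := by
  have he' : (e : ℚ) ≠ 0 := by positivity
  have h1 : P = C (a * (e : ℚ)⁻¹ ^ m) * X ^ m := by
    have := congrArg (fun q => q.comp (C (e : ℚ)⁻¹ * X)) h
    simp only [comp_assoc, mul_comp, C_comp, X_comp, pow_comp] at this
    rw [← mul_assoc, ← C_mul, mul_inv_cancel₀ he', C_1, one_mul, comp_X, mul_pow, ← mul_assoc,
      ← C_pow, ← C_mul] at this
    exact this
  have h2 : P.eval 1 = a * (e : ℚ)⁻¹ ^ m := by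
    rw [h1]
    simp
  rw [h2]
  exact h1

end

namespace RatSec

open LineBundle (toSections sres_toSections)

section

variable {X : Scheme.{u}} [IsIntegral X]

lemma gen_mem {U : X.Opens} {x : X} (hx : x ∈ U) : genericPoint X ∈ U :=
  ((genericPoint_spec X).mem_open_set_iff U.isOpen).mpr ⟨x, trivial, hx⟩

/-- The germ at the generic point, as a rational function. -/
def toK (U : X.Opens) (h : genericPoint X ∈ U) : Γ(X, U) →+* X.functionField :=
  (X.presheaf.germ U _ h).hom

lemma toK_sres {V U : X.Opens} (h : V ≤ U) (hV : genericPoint X ∈ V) (s : Γ(X, U)) :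
    toK V hV (sres X h s) = toK U (h hV) s :=
  X.presheaf.germ_res_apply (homOfLE h) _ hV s

lemma toK_injective (U : X.Opens) (h : genericPoint X ∈ U) : Function.Injective (toK U h) :=
  germ_injective_of_isIntegral X _ h

/-- The local ring at a point inside the function field. -/
def stalkRing (x : X) : Subring X.functionField :=
  (algebraMap (X.presheaf.stalk x) X.functionField).range

lemma algebraMap_germ {U : X.Opens} {x : X} (hx : x ∈ U) (s : Γ(X, U)) :
    algebraMap (X.presheaf.stalk x) X.functionField (X.presheaf.germ U x hx s)
      = toK U (gen_mem hx) s := by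
  have : Nonempty U := ⟨⟨x, hx⟩⟩
  exact Scheme.algebraMap_germ_eq_germToFunctionField X hx s

lemma toK_mem {U : X.Opens} {x : X} (hx : x ∈ U) (h : genericPoint X ∈ U) (s : Γ(X, U)) :
    toK U h s ∈ stalkRing x :=
  ⟨_, algebraMap_germ hx s⟩

lemma exists_toK_eq {x : X} {a : X.functionField} (ha : a ∈ stalkRing x) :
    ∃ (U : X.Opens) (hx : x ∈ U) (s : Γ(X, U)), toK U (gen_mem hx) s = a := by
  obtain ⟨b, rfl⟩ := ha
  obtain ⟨U, hx, s, rfl⟩ := X.presheaf.exists_germ_eq b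
  exact ⟨U, hx, s, (algebraMap_germ hx s).symm⟩

lemma mem_basicOpen_iff {U : X.Opens} {x : X} (hx : x ∈ U) (h : genericPoint X ∈ U) (s : Γ(X, U))
    (hs : toK U h s ≠ 0) : x ∈ X.basicOpen s ↔ (toK U h s)⁻¹ ∈ stalkRing x := by
  rw [X.mem_basicOpen s x hx]
  constructor
  · intro hu
    obtain ⟨b, hb⟩ := hu.exists_right_inv
    refine ⟨b, eq_inv_of_mul_eq_one_right ?_⟩
    rw [← algebraMap_germ hx, ← map_mul, hb, map_one]
  · rintro ⟨b, hb⟩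
    refine .of_mul_eq_one b ?_
    have hinj : Function.Injective (algebraMap (X.presheaf.stalk x) X.functionField) :=
      IsFractionRing.injective _ _
    apply hinj
    rw [map_mul, hb, algebraMap_germ hx, map_one, mul_inv_cancel₀ hs]

lemma toK_ne_zero {U : X.Opens} {x : X} {s : Γ(X, U)} (hx : x ∈ X.basicOpen s)
    (h : genericPoint X ∈ U) : toK U h s ≠ 0 := by
  intro h0
  have h1 : s = 0 := toK_injective U h (h0.trans (map_zero _).symm)
  rw [h1, X.basicOpen_zero] at hx
  exact hx

lemma subsingleton_of_not_mem {U : X.Opens} (h : genericPoint X ∉ U) :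
    Subsingleton Γ(X, U) := by
  have h0 : U = ⊥ := by
    ext x
    exact ⟨fun hx => (h (gen_mem hx)).elim, fun hx => hx.elim⟩
  subst h0
  infer_instance

lemma exists_toK_eq_of_forall {U : X.Opens} (h : genericPoint X ∈ U) {a : X.functionField}
    (ha : ∀ x ∈ U, a ∈ stalkRing x) : ∃ s, toK U h s = a := by
  choose V hV s hs using fun x : U => exists_toK_eq (ha x x.2)
  have hc : U ≤ ⨆ x : U, (V x ⊓ U) := fun x hx =>
    TopologicalSpace.Opens.mem_iSup.2 ⟨⟨x, hx⟩, hV ⟨x, hx⟩, hx⟩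
  obtain ⟨t, ht, -⟩ := X.sheaf.existsUnique_gluing' (fun x : U => V x ⊓ U) U
    (fun x => homOfLE inf_le_right) hc (fun x => sres X inf_le_left (s x)) (by
      intro x y
      have hg : genericPoint X ∈ (V x ⊓ U) ⊓ (V y ⊓ U) :=
        ⟨⟨gen_mem (hV x), h⟩, ⟨gen_mem (hV y), h⟩⟩
      change sres X inf_le_left (sres X inf_le_left (s x))
        = sres X inf_le_right (sres X inf_le_left (s y))
      apply toK_injective _ hg
      rw [sres_sres, sres_sres, toK_sres, toK_sres, hs, hs])
  refine ⟨t, ?_⟩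
  have h1 := ht ⟨_, h⟩
  have h2 : genericPoint X ∈ V ⟨_, h⟩ ⊓ U := ⟨hV _, h⟩
  have h3 := toK_sres (inf_le_right : V ⟨_, h⟩ ⊓ U ≤ U) h2 t
  rw [← h3, ← hs ⟨_, h⟩, ← toK_sres (inf_le_left : V ⟨_, h⟩ ⊓ U ≤ _) h2]
  exact congrArg _ h1

end

section

variable {k : Type u} [Field k] {X : Scheme.{u}} [IsIntegral X] {sX : X ⟶ Spec (CommRingCat.of k)}
  [Algebra k X.functionField]

/-- The scalars act on rational functions through the structure morphism. -/
def Compat (sX : X ⟶ Spec (CommRingCat.of k)) : Prop :=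
  ∀ c, algebraMap k X.functionField c = toK ⊤ trivial (toSections sX ⊤ c)

lemma Compat.toK_toSections (hk : Compat sX) (U : X.Opens) (h : genericPoint X ∈ U) (c : k) :
    toK U h (toSections sX U c) = algebraMap k X.functionField c := by
  rw [hk c, ← toK_sres (le_top : U ≤ ⊤) h, sres_toSections]

/-- The local ring at a point as a subalgebra of the function field. -/
def stalkAlg (hk : Compat sX) (x : X) : Subalgebra k X.functionField where
  __ := stalkRing x
  algebraMap_mem' c := by
    rw [hk c]
    exact toK_mem (U := ⊤) trivial _ _

variable (L M : LineBundle X)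

omit [IsIntegral X] in
lemma exists_mem_U (x : X) : ∃ i, x ∈ M.U i :=
  TopologicalSpace.Opens.mem_iSup.1 (M.covers.ge (trivial : x ∈ (⊤ : X.Opens)))

/-- A trivialising open set around a point. -/
def idx (x : X) : M.ι := (exists_mem_U M x).choose

omit [IsIntegral X] in
lemma mem_U_idx (x : X) : x ∈ M.U (idx M x) := (exists_mem_U M x).choose_spec

/-- The transition functions as rational functions. -/
def tr (i j : M.ι) (hi : genericPoint X ∈ M.U i) (hj : genericPoint X ∈ M.U j) :
    X.functionField :=
  toK (M.U i ⊓ M.U j) ⟨hi, hj⟩ (M.t i j)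

variable {M} in
lemma tr_ne_zero {i j : M.ι} (hi : genericPoint X ∈ M.U i) (hj : genericPoint X ∈ M.U j) :
    tr M i j hi hj ≠ 0 :=
  ((M.t i j).isUnit.map (toK (M.U i ⊓ M.U j) ⟨hi, hj⟩)).ne_zero

variable {M} in
lemma tr_mul_tr {i j l : M.ι} (hi : genericPoint X ∈ M.U i) (hj : genericPoint X ∈ M.U j)
    (hl : genericPoint X ∈ M.U l) : tr M i j hi hj * tr M j l hj hl = tr M i l hi hl := by
  have h0 : genericPoint X ∈ M.U i ⊓ M.U j ⊓ M.U l := ⟨⟨hi, hj⟩, hl⟩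
  have h1 := congrArg (fun u : (Γ(X, M.U i ⊓ M.U j ⊓ M.U l))ˣ =>
    toK (M.U i ⊓ M.U j ⊓ M.U l) h0 u) (M.cocycle i j l)
  rw [Units.val_mul, map_mul] at h1
  have h2 : ∀ {V : X.Opens} (h : M.U i ⊓ M.U j ⊓ M.U l ≤ V) (u : (Γ(X, V))ˣ),
      toK _ h0 (Units.map (sres X h).toMonoidHom u : Γ(X, M.U i ⊓ M.U j ⊓ M.U l))
        = toK V (h h0) u := fun h u => toK_sres h h0 _
  rw [h2, h2, h2] at h1
  exact h1

variable {M} in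
lemma tr_self {i : M.ι} (hi : genericPoint X ∈ M.U i) : tr M i i hi hi = 1 :=
  mul_left_cancel₀ (tr_ne_zero hi hi) ((tr_mul_tr hi hi hi).trans (mul_one _).symm)

variable {M} in
lemma tr_inv {i j : M.ι} (hi : genericPoint X ∈ M.U i) (hj : genericPoint X ∈ M.U j) :
    (tr M i j hi hj)⁻¹ = tr M j i hj hi :=
  inv_eq_of_mul_eq_one_right ((tr_mul_tr hi hj hi).trans (tr_self hi))

variable {M} in
lemma tr_mem {i j : M.ι} {x : X} (hi : x ∈ M.U i) (hj : x ∈ M.U j) :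
    tr M i j (gen_mem hi) (gen_mem hj) ∈ stalkRing x :=
  toK_mem (U := M.U i ⊓ M.U j) ⟨hi, hj⟩ _ _

lemma tr_pow (n : ℕ) {i j : M.ι} (hi : genericPoint X ∈ M.U i) (hj : genericPoint X ∈ M.U j) :
    tr (M.pow n) i j hi hj = tr M i j hi hj ^ n := by
  change toK _ _ ((M.t i j ^ n : (Γ(X, M.U i ⊓ M.U j))ˣ) : Γ(X, M.U i ⊓ M.U j)) = _
  rw [Units.val_pow_eq_pow_val, map_pow]
  rfl

/-- The trivialising open set chosen around the generic point. -/
abbrev idx₀ : M.ι := idx M (genericPoint X)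

abbrev mem_U_idx₀ : genericPoint X ∈ M.U (idx₀ M) := mem_U_idx M _

/-- A line bundle seen from the function field. -/
def dataOf (hk : Compat sX) : SecData k X.functionField X where
  O := stalkAlg hk
  τ x := tr M (idx M x) (idx₀ M) (gen_mem (mem_U_idx M x)) (mem_U_idx₀ M)
  τ_ne _ := tr_ne_zero _ _

lemma dataOf_pow (hk : Compat sX) (n : ℕ) : dataOf (M.pow n) hk = (dataOf M hk).pow n := by
  have h : (dataOf (M.pow n) hk).τ = ((dataOf M hk).pow n).τ :=
    funext fun x => tr_pow M n (gen_mem (mem_U_idx M x)) (mem_U_idx₀ M)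
  rw [SecData.mk.injEq]
  exact ⟨rfl, h⟩

variable {M}

lemma τ_eq (hk : Compat sX) {x : X} {i : M.ι} (hi : x ∈ M.U i) :
    (dataOf M hk).τ x = tr M (idx M x) i (gen_mem (mem_U_idx M x)) (gen_mem hi) *
      tr M i (idx₀ M) (gen_mem hi) (mem_U_idx₀ M) :=
  (tr_mul_tr _ _ _).symm

lemma mem_sec_one (hk : Compat sX) {a : X.functionField} :
    a ∈ (dataOf M hk).sec 1 ↔ ∀ (x : X) (i : M.ι) (hi : x ∈ M.U i),
      tr M i (idx₀ M) (gen_mem hi) (mem_U_idx₀ M) * a ∈ stalkRing x := by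
  constructor
  · intro h x i hi
    have h1 := (stalkRing x).mul_mem (tr_mem hi (mem_U_idx M x)) (h x)
    rwa [pow_one, ← mul_assoc, dataOf, tr_mul_tr] at h1
  · intro h x
    rw [pow_one]
    exact h x _ (mem_U_idx M x)

/-- A global section as a rational function. -/
def val (σ : LineBundle.GlobalSec M) : X.functionField :=
  toK (M.U (idx₀ M)) (mem_U_idx₀ M) (σ.s (idx₀ M))

lemma toK_s' {s : ∀ i, Γ(X, M.U i)} {i j : M.ι}
    (h : sres X (inf_le_left : M.U i ⊓ M.U j ≤ M.U i) (s i)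
      = (M.t i j : Γ(X, M.U i ⊓ M.U j)) * sres X inf_le_right (s j))
    (hi : genericPoint X ∈ M.U i) (hj : genericPoint X ∈ M.U j) :
    toK (M.U i) hi (s i) = tr M i j hi hj * toK (M.U j) hj (s j) := by
  have hij : genericPoint X ∈ M.U i ⊓ M.U j := ⟨hi, hj⟩
  have h1 := congrArg (toK _ hij) h
  rwa [map_mul, toK_sres, toK_sres] at h1

lemma toK_s (σ : LineBundle.GlobalSec M) {i : M.ι} (hi : genericPoint X ∈ M.U i) :
    toK (M.U i) hi (σ.s i) = tr M i (idx₀ M) hi (mem_U_idx₀ M) * val σ :=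
  toK_s' (σ.compat _ _) _ _

lemma val_mem (hk : Compat sX) (σ : LineBundle.GlobalSec M) : val σ ∈ (dataOf M hk).sec 1 := by
  rw [mem_sec_one]
  intro x i hi
  rw [← toK_s σ (gen_mem hi)]
  exact toK_mem hi _ _

lemma exists_val_eq (hk : Compat sX) {a : X.functionField} (ha : a ∈ (dataOf M hk).sec 1) :
    ∃ σ : LineBundle.GlobalSec M, val σ = a := by
  rw [mem_sec_one] at ha
  have h1 : ∀ i, ∃ s : Γ(X, M.U i), ∀ hi : genericPoint X ∈ M.U i,
      toK (M.U i) hi s = tr M i (idx₀ M) hi (mem_U_idx₀ M) * a := by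
    intro i
    by_cases hi : genericPoint X ∈ M.U i
    · obtain ⟨s, hs⟩ := exists_toK_eq_of_forall hi (a := tr M i (idx₀ M) hi (mem_U_idx₀ M) * a)
        (fun x hx => ha x i hx)
      exact ⟨s, fun _ => hs⟩
    · exact ⟨0, fun h => (hi h).elim⟩
  choose s hs using h1
  refine ⟨⟨s, fun i j => ?_⟩, ?_⟩
  · by_cases hij : genericPoint X ∈ M.U i ⊓ M.U j
    · apply toK_injective _ hij
      rw [map_mul, toK_sres, toK_sres, hs i, hs j, ← mul_assoc]
      congr 1
      exact (tr_mul_tr hij.1 hij.2 _).symm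
    · have := subsingleton_of_not_mem hij
      exact Subsingleton.elim _ _
  · change toK _ _ (s _) = a
    rw [hs, tr_self, one_mul]

lemma val_injective {s : ∀ i, Γ(X, M.U i)}
    (h : ∀ i j, sres X (inf_le_left : M.U i ⊓ M.U j ≤ M.U i) (s i)
      = (M.t i j : Γ(X, M.U i ⊓ M.U j)) * sres X inf_le_right (s j))
    (h0 : toK (M.U (idx₀ M)) (mem_U_idx₀ M) (s (idx₀ M)) = 0) : s = 0 := by
  funext i
  by_cases hi : genericPoint X ∈ M.U i
  · apply toK_injective _ hi
    rw [toK_s' (h i (idx₀ M)) hi (mem_U_idx₀ M), h0, mul_zero, Pi.zero_apply, map_zero]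
  · have := subsingleton_of_not_mem hi
    exact Subsingleton.elim _ _

lemma h0_eq (hk : Compat sX) :
    LineBundle.h0 sX M = Module.finrank k ((dataOf M hk).sec 1) := by
  let _ : ∀ i, Module k Γ(X, M.U i) := fun i => (toSections sX (M.U i)).toModule
  have hsm : ∀ i (c : k) (a : Γ(X, M.U i)), c • a = toSections sX (M.U i) c * a :=
    fun _ _ _ => rfl
  let F : LineBundle.secSubmodule sX M →ₗ[k] X.functionField :=
    { toFun := fun s => toK (M.U (idx₀ M)) (mem_U_idx₀ M) (s.1 (idx₀ M))
      map_add' := fun s t => map_add _ _ _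
      map_smul' := fun c s => by
        change toK _ _ (toSections sX _ c * s.1 (idx₀ M)) = c • _
        rw [map_mul, hk.toK_toSections, Algebra.smul_def] }
  have hF : Function.Injective F := by
    rw [← LinearMap.ker_eq_bot, LinearMap.ker_eq_bot']
    rintro ⟨s, hs⟩ h
    exact Subtype.ext (val_injective hs h)
  have hr : LinearMap.range F = (dataOf M hk).sec 1 := by
    ext a
    constructor
    · rintro ⟨⟨s, hs⟩, rfl⟩
      exact val_mem hk (⟨s, hs⟩ : LineBundle.GlobalSec M)
    · intro ha
      obtain ⟨σ, rfl⟩ := exists_val_eq hk ha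
      exact ⟨⟨σ.s, σ.compat⟩, rfl⟩
  rw [← hr, LinearMap.finrank_range_of_inj hF]
  rfl

lemma mem_locus_iff (hk : Compat sX) (σ : LineBundle.GlobalSec M) (h0 : val σ ≠ 0) (x : X) :
    x ∈ σ.locus ↔ x ∈ (dataOf M hk).loc (val σ) := by
  have hne : ∀ {i} (hi : genericPoint X ∈ M.U i), toK (M.U i) hi (σ.s i) ≠ 0 := by
    intro i hi
    rw [toK_s σ hi]
    exact mul_ne_zero (tr_ne_zero _ _) h0
  have h1 : x ∈ (dataOf M hk).loc (val σ) ↔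
      (toK _ (gen_mem (mem_U_idx M x)) (σ.s (idx M x)))⁻¹ ∈ stalkRing x := by
    rw [toK_s σ]
    rfl
  rw [h1]
  constructor
  · intro hx
    obtain ⟨j, hj⟩ := TopologicalSpace.Opens.mem_iSup.1 hx
    have hxj := X.basicOpen_le _ hj
    rw [mem_basicOpen_iff hxj (gen_mem hxj) _ (hne _)] at hj
    have h2 := (stalkRing x).mul_mem (tr_mem hxj (mem_U_idx M x)) hj
    rwa [← tr_inv, ← mul_inv, ← toK_s' (σ.compat _ _)] at h2
  · intro hx
    exact TopologicalSpace.Opens.mem_iSup.2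
      ⟨_, (mem_basicOpen_iff (mem_U_idx M x) _ _ (hne _)).2 hx⟩

lemma val_ne_zero_of_mem (σ : LineBundle.GlobalSec M) {x : X} (hx : x ∈ σ.locus) : val σ ≠ 0 := by
  obtain ⟨j, hj⟩ := TopologicalSpace.Opens.mem_iSup.1 hx
  have h1 := toK_ne_zero hj (gen_mem (X.basicOpen_le _ hj))
  rw [toK_s σ] at h1
  exact right_ne_zero_of_mul h1

/-- The functions regular on an open set. -/
def regEquiv (D : SecData k X.functionField X) (hk : Compat sX) (hD : D.O = stalkAlg hk)
    (S : Set X) (U : X.Opens) (hU : ∀ x, x ∈ U ↔ x ∈ S) (h : genericPoint X ∈ U) :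
    Γ(X, U) ≃+* D.reg S :=
  RingEquiv.ofBijective
    ((toK U h).codRestrict (D.reg S) fun s => SecData.mem_reg.2 fun x hx => by
      rw [hD]
      exact toK_mem ((hU x).2 hx) _ _)
    ⟨fun s t hst => toK_injective U h (congrArg Subtype.val hst), fun a => by
      obtain ⟨s, hs⟩ := exists_toK_eq_of_forall h (a := (a : X.functionField)) fun x hx => by
        have := SecData.mem_reg.1 a.2 x ((hU x).1 hx)
        rwa [hD] at this
      exact ⟨s, Subtype.ext hs⟩⟩

end

section

variable {k : Type u} [Field k] {X : Scheme.{u}} [IsIntegral X] {sX : X ⟶ Spec (CommRingCat.of k)}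
  [Algebra k X.functionField] {M : LineBundle X}

lemma isFractionRing_reg (D : SecData k X.functionField X) (hk : Compat sX)
    (hD : D.O = stalkAlg hk) (S : Set X) (U : X.Opens) (hU : ∀ x, x ∈ U ↔ x ∈ S)
    (h : genericPoint X ∈ U) (hUa : IsAffineOpen U) :
    IsFractionRing (D.reg S) X.functionField := by
  refine IsFractionRing.of_field _ _ fun z => ?_
  have : Nonempty U := ⟨⟨_, h⟩⟩
  have := functionField_isFractionRing_of_isAffineOpen X U hUa
  obtain ⟨a, b, -, hab⟩ := IsFractionRing.div_surjective (A := Γ(X, U)) z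
  exact ⟨regEquiv D hk hD S U hU h a, regEquiv D hk hD S U hU h b, hab.symm⟩

lemma fg_reg [LocallyOfFiniteType sX] (D : SecData k X.functionField X) (hk : Compat sX)
    (hD : D.O = stalkAlg hk) (S : Set X) (U : X.Opens) (hU : ∀ x, x ∈ U ↔ x ∈ S)
    (h : genericPoint X ∈ U) (hUa : IsAffineOpen U) : (D.reg S).FG := by
  rw [Subalgebra.fg_iff_finiteType]
  have h1 : (toSections sX U).FiniteType := by
    have h2 := sX.finiteType_appLE (isAffineOpen_top (Spec (CommRingCat.of k))) hUa le_top
    have h3 : toSections sX U = (sX.appLE ⊤ U le_top).hom.comp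
        ((Scheme.ΓSpecIso (CommRingCat.of k)).inv : CommRingCat.of k ⟶ _).hom := rfl
    rw [h3]
    exact h2.comp (RingHom.FiniteType.of_surjective _
      (ConcreteCategory.bijective_of_isIso (Scheme.ΓSpecIso (CommRingCat.of k)).inv).2)
  have h4 := (RingHom.FiniteType.of_surjective (regEquiv D hk hD S U hU h).toRingHom
    (regEquiv D hk hD S U hU h).surjective).comp h1
  have h5 : (regEquiv D hk hD S U hU h).toRingHom.comp (toSections sX U)
      = algebraMap k (D.reg S) := by
    ext c
    exact hk.toK_toSections U h c
  rw [h5] at h4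
  exact RingHom.finiteType_algebraMap.1 h4

lemma exists_nhds_mul_pow_mem (hk : Compat sX) {y : X.functionField}
    (hy : y ∈ (dataOf M hk).sec 1) (hy0 : y ≠ 0) {a : X.functionField}
    (ha : a ∈ (dataOf M hk).reg ((dataOf M hk).loc y)) (x : X) :
    ∃ W : X.Opens, x ∈ W ∧ ∃ m : ℕ, ∀ m' ≥ m, ∀ z ∈ W,
      (dataOf M hk).τ z ^ m' * (a * y ^ m') ∈ stalkRing z := by
  obtain ⟨σ, rfl⟩ := exists_val_eq hk hy
  obtain ⟨_, ⟨W, hW, rfl⟩, hxW, hWU⟩ :=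
    X.isBasis_affineOpens.exists_subset_of_mem_open (mem_U_idx M x) (M.U (idx M x)).isOpen
  replace hWU : W ≤ M.U (idx M x) := hWU
  have hηW := gen_mem hxW
  set gs : Γ(X, W) := sres X hWU (σ.s (idx M x)) with hg
  have hgK : toK W hηW gs = tr M (idx M x) (idx₀ M) (hWU hηW) (mem_U_idx₀ M) * val σ := by
    rw [hg, toK_sres, toK_s]
  have hg0 : toK W hηW gs ≠ 0 := by
    rw [hgK]
    exact mul_ne_zero (tr_ne_zero _ _) hy0
  have hgη : genericPoint X ∈ X.basicOpen gs := by
    rw [mem_basicOpen_iff hηW hηW gs hg0]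
    obtain ⟨U, -, f', hU, hf, -⟩ := exists_isUnit_germ_eq X _ (inv_ne_zero hg0)
    rw [← hf]
    exact toK_mem (gen_mem hU.some.2) _ _
  obtain ⟨b, hb⟩ := exists_toK_eq_of_forall hgη (a := a) fun z hz => by
    refine SecData.mem_reg.1 ha z ((mem_locus_iff hk σ hy0 z).1 ?_)
    refine TopologicalSpace.Opens.mem_iSup.2 ⟨idx M x, ?_⟩
    have hzW := X.basicOpen_le _ hz
    have hne := toK_ne_zero hz (gen_mem hzW)
    rw [mem_basicOpen_iff hzW (gen_mem hzW) _ hne] at hz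
    rw [hg, toK_sres] at hz hne
    rwa [mem_basicOpen_iff (hWU hzW) _ _ hne]
  let _ : Algebra Γ(X, W) Γ(X, X.basicOpen gs) := (sres X (X.basicOpen_le gs)).toAlgebra
  have hloc : IsLocalization.Away gs Γ(X, X.basicOpen gs) :=
    hW.isLocalization_of_eq_basicOpen gs (homOfLE (X.basicOpen_le gs)) rfl
  obtain ⟨m, c, hc⟩ := IsLocalization.Away.surj gs b
  refine ⟨W, hxW, m, fun m' hm' z hz => ?_⟩
  have hcK : a * toK W hηW gs ^ m = toK W hηW c := by
    have h1 := congrArg (toK _ hgη) hc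
    rw [map_mul, map_pow, hb] at h1
    exact (congrArg (a * · ^ m) (toK_sres (X.basicOpen_le gs) hgη gs).symm).trans
      (h1.trans (toK_sres (X.basicOpen_le gs) hgη c))
  have h2 : a * toK W hηW gs ^ m' ∈ stalkRing z := by
    obtain ⟨l, rfl⟩ := Nat.exists_eq_add_of_le hm'
    rw [pow_add, ← mul_assoc, hcK]
    exact (stalkRing z).mul_mem (toK_mem hz _ _) (pow_mem (toK_mem hz _ _) l)
  rw [hgK] at h2
  have h3 := (stalkRing z).mul_mem (pow_mem (tr_mem (mem_U_idx M z) (hWU hz)) m') h2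
  rw [τ_eq hk (hWU hz)]
  convert h3 using 1
  ring

lemma exists_mul_pow_mem [CompactSpace X] (hk : Compat sX) {y : X.functionField}
    (hy : y ∈ (dataOf M hk).sec 1) (hy0 : y ≠ 0) {a : X.functionField}
    (ha : a ∈ (dataOf M hk).reg ((dataOf M hk).loc y)) :
    ∃ m : ℕ, a * y ^ m ∈ (dataOf M hk).sec m := by
  choose W hxW m hm using exists_nhds_mul_pow_mem hk hy hy0 ha
  obtain ⟨t, ht⟩ := CompactSpace.elim_nhds_subcover (fun x => (W x : Set X))
    fun x => (W x).isOpen.mem_nhds (hxW x)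
  refine ⟨t.sup m, fun z => ?_⟩
  obtain ⟨x, hx, hzx⟩ := Set.mem_iUnion₂.1 (ht.ge (Set.mem_univ z))
  exact hm x _ (Finset.le_sup hx) z hzx

lemma exists_mul_pow_mem_sec [CompactSpace X] (hk : Compat sX) (n : ℕ) {y : X.functionField}
    (hy : y ∈ (dataOf M hk).sec n) (hy0 : y ≠ 0) {a : X.functionField}
    (ha : a ∈ (dataOf M hk).reg (((dataOf M hk).pow n).loc y)) :
    ∃ m : ℕ, a * y ^ m ∈ (dataOf M hk).sec (n * m) := by
  simp only [← SecData.pow_sec, ← dataOf_pow]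
  apply exists_mul_pow_mem hk _ hy0
  · change a ∈ ((dataOf M hk).pow n).reg _ at ha
    rwa [← dataOf_pow] at ha
  · rwa [dataOf_pow, SecData.pow_sec, mul_one]

end

section

variable {k : Type u} [Field k] {X : Scheme.{u}}

instance finiteType_zero (N : ℕ) :
    Algebra.FiniteType (MvPolynomial.homogeneousSubmodule (Fin (N + 1)) k 0)
      (MvPolynomial (Fin (N + 1)) k) := by
  rw [← RingHom.finiteType_algebraMap]
  refine RingHom.FiniteType.of_comp_finiteType (f := degreeZeroInclusion k N) ?_
  have h : (algebraMap (MvPolynomial.homogeneousSubmodule (Fin (N + 1)) k 0)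
      (MvPolynomial (Fin (N + 1)) k)).comp (degreeZeroInclusion k N)
      = algebraMap k (MvPolynomial (Fin (N + 1)) k) := rfl
  rw [h, RingHom.finiteType_algebraMap]
  infer_instance

lemma degreeZeroInclusion_bijective (N : ℕ) : Function.Bijective (degreeZeroInclusion k N) := by
  refine ⟨fun a b h =>
    MvPolynomial.C_injective (Fin (N + 1)) k (congrArg Subtype.val h), fun ⟨p, hp⟩ => ?_⟩
  rw [MvPolynomial.homogeneousSubmodule_zero] at hp
  obtain ⟨c, hc⟩ := Submodule.mem_one.1 hp
  exact ⟨c, Subtype.ext hc⟩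

instance isProper_str (N : ℕ) : IsProper (ProjSpace.str k N) := by
  have : IsIso (CommRingCat.ofHom (degreeZeroInclusion k N)) :=
    (RingEquiv.ofBijective _ (degreeZeroInclusion_bijective N)).toCommRingCatIso.isIso_hom
  have h1 : IsProper (Proj.toSpecZero (MvPolynomial.homogeneousSubmodule (Fin (N + 1)) k)) := by
    infer_instance
  have h2 : IsProper (Spec.map (CommRingCat.ofHom (degreeZeroInclusion k N))) := inferInstance
  exact MorphismProperty.comp_mem _ _ _ h1 h2

lemma isProper_of_isProjectiveVariety {sX : X ⟶ Spec (CommRingCat.of k)}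
    (h : IsProjectiveVariety sX) : IsProper sX := by
  obtain ⟨-, N, ι, hι, rfl⟩ := h
  infer_instance

variable [IsIntegral X] {sX : X ⟶ Spec (CommRingCat.of k)} [Algebra k X.functionField]
  {M : LineBundle X}

lemma fromSpecStalk_comp (hk : Compat sX) :
    X.fromSpecStalk (genericPoint X) ≫ sX
      = Spec.map (CommRingCat.ofHom (algebraMap k X.functionField)) := by
  apply ext_to_Spec
  have h1 : CommRingCat.ofHom (algebraMap k X.functionField)
      = (Scheme.ΓSpecIso (CommRingCat.of k)).inv ≫ sX.appTop ≫
        X.presheaf.germ ⊤ (genericPoint X) trivial := by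
    apply CommRingCat.hom_ext
    ext c
    exact (hk c).trans (toK_sres (le_refl ⊤) trivial
      (sX.appTop ((Scheme.ΓSpecIso (CommRingCat.of k)).inv c)))
  change _ ≫ (X.fromSpecStalk (genericPoint X) ≫ sX).appTop = _ ≫ (Spec.map _).appTop
  rw [← Scheme.ΓSpecIso_inv_naturality, Scheme.Hom.comp_appTop, Scheme.fromSpecStalk_appTop, h1]
  simp

lemma proper [IsProper sX] (hk : Compat sX) : (dataOf M hk).Proper := by
  intro V hV
  let j : k →+* V := (algebraMap k X.functionField).codRestrict V.toSubring hV
  have hj : V.subtype.comp j = algebraMap k X.functionField := rfl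
  let S : ValuativeCommSq sX :=
    { R := V
      K := X.functionField
      i₁ := X.fromSpecStalk (genericPoint X)
      i₂ := Spec.map (CommRingCat.ofHom j)
      commSq := ⟨by
        rw [← Spec.map_comp]
        exact fromSpecStalk_comp hk⟩ }
  have hex : ValuativeCriterion.Existence sX := by
    have : UniversallyClosed sX := inferInstance
    rw [UniversallyClosed.eq_valuativeCriterion] at this
    exact this.1
  obtain ⟨⟨l, hl, -⟩⟩ := hex S
  refine ⟨l (IsLocalRing.closedPoint V), ?_⟩
  have h1 := Scheme.Spec_stalkClosedPointTo_fromSpecStalk (R := .of V) l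
  have h2 : Spec.map (CommRingCat.ofHom (algebraMap V X.functionField)) ≫
      Spec.map (Scheme.stalkClosedPointTo (R := .of V) l) ≫
        X.fromSpecStalk (l (IsLocalRing.closedPoint V))
      = Spec.map (X.presheaf.stalkSpecializes ((genericPoint_spec X).specializes trivial)) ≫
        X.fromSpecStalk (l (IsLocalRing.closedPoint V)) := by
    rw [Scheme.SpecMap_stalkSpecializes_fromSpecStalk, h1]
    exact hl
  rw [← Category.assoc, cancel_mono, ← Spec.map_comp, Spec.map_inj] at h2
  rintro _ ⟨b, rfl⟩
  have h3 := congrArg (fun f => f.hom b) h2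
  change _ = algebraMap _ _ b at h3
  rw [← h3]
  exact (Scheme.stalkClosedPointTo (R := .of V) l b).2

end

section

instance {X Y : Scheme.{u}} (f : X ⟶ Y) [Etale f] : LocallyQuasiFinite f where
  quasiFinite_appLE hU _ hV e := by
    have h := f.etale_appLE hU hV e
    algebraize [(f.appLE _ _ e).hom]
    exact inferInstanceAs (Algebra.QuasiFinite _ _)

variable {X : Scheme.{u}} [IsIntegral X]

omit [IsIntegral X] in
lemma isFinite_of_etale {S : Scheme.{u}} {sX : X ⟶ S} [IsProper sX] {φ : X ⟶ X}
    (hφ : φ ≫ sX = sX) [Etale φ] : IsFinite φ := by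
  have : IsProper (φ ≫ sX) := by rwa [hφ]
  have := IsProper.of_comp φ sX
  exact .of_isProper_of_locallyQuasiFinite φ

lemma map_genericPoint (φ : X ⟶ X) [UniversallyOpen φ] :
    φ (genericPoint X) = genericPoint X := by
  have h1 : genericPoint X ∈ Set.range φ :=
    ((genericPoint_spec X).mem_open_set_iff φ.isOpenMap.isOpen_range).mpr
      ⟨φ (genericPoint X), trivial, Set.mem_range_self _⟩
  obtain ⟨y, hy⟩ := h1
  have h2 : φ (genericPoint X) ⤳ φ y := (genericPoint_specializes y).map φ.continuous
  rw [hy] at h2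
  exact (h2.antisymm (genericPoint_specializes _)).eq

/-- Pullback of rational functions. -/
def pullK (φ : X ⟶ X) [UniversallyOpen φ] : X.functionField →+* X.functionField :=
  (X.presheaf.stalkSpecializes (specializes_of_eq (map_genericPoint φ)) ≫
    φ.stalkMap (genericPoint X)).hom

lemma pullK_toK (φ : X ⟶ X) [UniversallyOpen φ] {U : X.Opens} (h : genericPoint X ∈ U)
    (h' : genericPoint X ∈ φ ⁻¹ᵁ U) (s : Γ(X, U)) :
    pullK φ (toK U h s) = toK (φ ⁻¹ᵁ U) h' (φ.app U s) := by
  have h1 : X.presheaf.germ U _ h ≫ X.presheaf.stalkSpecializes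
      (specializes_of_eq (map_genericPoint φ)) = X.presheaf.germ U _ h' :=
    X.presheaf.germ_stalkSpecializes h _
  have h2 := φ.germ_stalkMap U (genericPoint X) h'
  rw [← h1, Category.assoc] at h2
  exact congrArg (fun f => f.hom s) h2

lemma mem_preimage_gen (φ : X ⟶ X) [UniversallyOpen φ] {U : X.Opens} (h : genericPoint X ∈ U) :
    genericPoint X ∈ φ ⁻¹ᵁ U := by
  change φ (genericPoint X) ∈ U
  rwa [map_genericPoint]

lemma pullK_mem (φ : X ⟶ X) [UniversallyOpen φ] {x : X} {a : X.functionField}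
    (ha : a ∈ stalkRing (φ x)) : pullK φ a ∈ stalkRing x := by
  obtain ⟨U, hx, s, rfl⟩ := exists_toK_eq ha
  rw [pullK_toK φ _ (mem_preimage_gen φ (gen_mem hx))]
  exact toK_mem (U := φ ⁻¹ᵁ U) hx _ _

lemma inv_mem_of_pullK_inv_mem (φ : X ⟶ X) [UniversallyOpen φ] {x : X} {a : X.functionField}
    (ha : a ∈ stalkRing (φ x)) (h : (pullK φ a)⁻¹ ∈ stalkRing x) : a⁻¹ ∈ stalkRing (φ x) := by
  by_cases h0 : a = 0
  · rw [h0, inv_zero]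
    exact Subring.zero_mem _
  obtain ⟨U, hx, s, rfl⟩ := exists_toK_eq ha
  rw [← mem_basicOpen_iff hx _ _ h0]
  have h1 := (map_ne_zero (pullK φ)).2 h0
  rw [pullK_toK φ _ (mem_preimage_gen φ (gen_mem hx))] at h h1
  rw [← mem_basicOpen_iff (U := φ ⁻¹ᵁ U) hx _ _ h1, ← Scheme.preimage_basicOpen] at h
  exact h

variable {k : Type u} [Field k] {sX : X ⟶ Spec (CommRingCat.of k)}
  [Algebra k X.functionField]

omit [IsIntegral X] [Algebra k X.functionField] in
lemma app_toSections {φ : X ⟶ X} (hφ : φ ≫ sX = sX) (c : k) :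
    φ.appTop (toSections sX ⊤ c) = toSections sX ⊤ c := by
  have h : sX.appTop ≫ φ.appTop = sX.appTop := by
    rw [← Scheme.Hom.comp_appTop, hφ]
  have h2 : ∀ b, toSections sX ⊤ b = sX.appTop ((Scheme.ΓSpecIso (CommRingCat.of k)).inv b) := by
    intro b
    have : ∀ t : Γ(X, ⊤), sres X (le_refl ⊤) t = t := fun t =>
      congrArg (fun f => f.hom t) (X.presheaf.map_id (op ⊤))
    exact this _
  rw [h2]
  exact congrArg (fun f => f.hom ((Scheme.ΓSpecIso (CommRingCat.of k)).inv c)) h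

/-- Pullback of rational functions, as a map of algebras. -/
def pullKAlg (hk : Compat sX) (φ : X ⟶ X) [UniversallyOpen φ] (hφ : φ ≫ sX = sX) :
    X.functionField →ₐ[k] X.functionField where
  __ := pullK φ
  commutes' c := by
    change pullK φ (algebraMap k _ c) = _
    rw [hk c, pullK_toK φ (U := ⊤) trivial trivial]
    exact congrArg (toK ⊤ trivial) (app_toSections hφ c)

lemma tr_pullbackLB (φ : X ⟶ X) [UniversallyOpen φ] (L : LineBundle X) {i j : L.ι}
    (hi : genericPoint X ∈ L.U i) (hj : genericPoint X ∈ L.U j) :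
    tr (LineBundle.pullbackLB φ L) i j (mem_preimage_gen φ hi) (mem_preimage_gen φ hj) =
      pullK φ (tr L i j hi hj) := by
  have h : genericPoint X ∈ φ ⁻¹ᵁ (L.U i ⊓ L.U j) := mem_preimage_gen φ ⟨hi, hj⟩
  have h1 := LineBundle.sres_appLE φ (le_refl (φ ⁻¹ᵁ (L.U i ⊓ L.U j)))
    (LineBundle.preimage_inf φ (L.U i) (L.U j)).ge (L.t i j)
  have h2 := toK_sres (LineBundle.preimage_inf φ (L.U i) (L.U j)).ge
    (⟨mem_preimage_gen φ hi, mem_preimage_gen φ hj⟩) (φ.appLE _ _ le_rfl (L.t i j : Γ(X, _)))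
  rw [h1, ← Scheme.Hom.app_eq_appLE, ← pullK_toK φ (U := L.U i ⊓ L.U j) ⟨hi, hj⟩] at h2
  exact h2

omit [Algebra k X.functionField] in
/-- An isomorphism of line bundles, as a family of rational functions. -/
lemma exists_tr_of_equivLB {N M : LineBundle X} (h : N.EquivLB M) :
    ∃ (κ : Type u) (V : κ → X.Opens) (a : κ → N.ι) (b : κ → M.ι) (S : κ → X.functionField),
      (∀ x, ∃ c, x ∈ V c) ∧ (∀ c, S c ≠ 0) ∧ (∀ c, ∀ x ∈ V c, S c ∈ stalkRing x) ∧
      (∀ c, ∀ x ∈ V c, (S c)⁻¹ ∈ stalkRing x) ∧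
      ∃ (ha : ∀ c, V c ≤ N.U (a c)) (hb : ∀ c, V c ≤ M.U (b c)),
        ∀ (c c' : κ) (hc : genericPoint X ∈ V c) (hc' : genericPoint X ∈ V c'),
          tr N (a c) (a c') (ha c hc) (ha c' hc') * S c' =
            S c * tr M (b c) (b c') (hb c hc) (hb c' hc') := by
  classical
  obtain ⟨κ, V, hV, a, b, ha, hb, s, hs⟩ := h
  let S : κ → X.functionField := fun c =>
    if hc : genericPoint X ∈ V c then toK (V c) hc (s c) else 1
  have hS : ∀ c (hc : genericPoint X ∈ V c), S c = toK (V c) hc (s c) := fun c hc => dif_pos hc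
  have hS' : ∀ c (hc : genericPoint X ∈ V c),
      (S c)⁻¹ = toK (V c) hc ((s c)⁻¹ : (Γ(X, V c))ˣ) := fun c hc => by
    rw [hS c hc]
    refine inv_eq_of_mul_eq_one_right ?_
    rw [← map_mul, Units.mul_inv, map_one]
  refine ⟨κ, V, a, b, S, fun x => TopologicalSpace.Opens.mem_iSup.1 (hV.ge trivial), fun c => ?_,
    fun c x hx => ?_, fun c x hx => ?_, ha, hb, fun c c' hc hc' => ?_⟩
  · by_cases hc : genericPoint X ∈ V c
    · rw [hS c hc]
      exact ((s c).isUnit.map (toK (V c) hc)).ne_zero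
    · change dite _ _ _ ≠ _
      rw [dif_neg hc]
      exact one_ne_zero
  · rw [hS c (gen_mem hx)]
    exact toK_mem hx _ _
  · rw [hS' c (gen_mem hx)]
    exact toK_mem hx _ _
  · have h0 : genericPoint X ∈ V c ⊓ V c' := ⟨hc, hc'⟩
    have h1 := congrArg (fun w : (Γ(X, V c ⊓ V c'))ˣ => toK _ h0 w) (hs c c')
    rw [Units.val_mul, map_mul, Units.val_mul, map_mul] at h1
    have h2 : ∀ {W : X.Opens} (h : V c ⊓ V c' ≤ W) (w : (Γ(X, W))ˣ),
        toK _ h0 (Units.map (sres X h).toMonoidHom w : Γ(X, V c ⊓ V c')) = toK W (h h0) w :=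
      fun h w => toK_sres h h0 _
    rw [h2, h2, h2, h2] at h1
    rw [hS c hc, hS c' hc']
    exact h1

omit [Algebra k X.functionField] in
lemma exists_tr_of_pullback (φ : X ⟶ X) [UniversallyOpen φ] (L : LineBundle X) (d : ℕ)
    (h : (LineBundle.pullbackLB φ L).EquivLB (L.pow d)) :
    ∃ (κ : Type u) (V : κ → X.Opens) (a b : κ → L.ι) (S : κ → X.functionField),
      (∀ x, ∃ c, x ∈ V c) ∧ (∀ c, S c ≠ 0) ∧ (∀ c, ∀ x ∈ V c, S c ∈ stalkRing x) ∧
      (∀ c, ∀ x ∈ V c, (S c)⁻¹ ∈ stalkRing x) ∧ (∀ c, ∀ x ∈ V c, φ x ∈ L.U (a c)) ∧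
      ∃ hb : ∀ c, V c ≤ L.U (b c), ∀ (c c' : κ) (hac : genericPoint X ∈ L.U (a c))
        (hac' : genericPoint X ∈ L.U (a c')) (hc : genericPoint X ∈ V c)
        (hc' : genericPoint X ∈ V c'),
          pullK φ (tr L (a c) (a c') hac hac') * S c' =
            S c * tr L (b c) (b c') (hb c hc) (hb c' hc') ^ d := by
  obtain ⟨κ, V, a, b, S, hV, hS0, hS, hS', ha, hb, hs⟩ := exists_tr_of_equivLB h
  refine ⟨κ, V, a, b, S, hV, hS0, hS, hS', fun c x hx => ha c hx, hb,
    fun c c' hac hac' hc hc' => ?_⟩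
  exact (congrArg (· * S c') (tr_pullbackLB φ L hac hac')).symm.trans
    ((hs c c' hc hc').trans (congrArg (S c * ·) (tr_pow L d (hb c hc) (hb c' hc'))))

/-- An endomorphism of a polarised variety, seen from the function field. -/
lemma exists_endo (hk : Compat sX) (φ : X ⟶ X) [UniversallyOpen φ] (hφ : φ ≫ sX = sX)
    (L : LineBundle X) (d : ℕ) (h : (LineBundle.pullbackLB φ L).EquivLB (L.pow d)) :
    ∃ E : (dataOf L hk).Endo d, E.σ = pullKAlg hk φ hφ ∧ E.φ = φ := by
  obtain ⟨κ, V, a, b, S, hV, hS0, hS, hS', haφ, hbg, hs⟩ := exists_tr_of_pullback φ L d h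
  obtain ⟨c₀, hc₀⟩ := hV (genericPoint X)
  have hag : ∀ (c : κ) (x : X), x ∈ V c → genericPoint X ∈ L.U (a c) :=
    fun c x hx => gen_mem (haφ c x hx)
  let C : X.functionField := (S c₀)⁻¹ * pullK φ (tr L (a c₀) (idx₀ L) (hag _ _ hc₀) (mem_U_idx₀ L)) *
    tr L (idx₀ L) (b c₀) (mem_U_idx₀ L) (hbg _ hc₀) ^ d
  have hC : C ≠ 0 := mul_ne_zero (mul_ne_zero (inv_ne_zero (hS0 _))
    ((map_ne_zero _).2 (tr_ne_zero _ _))) (pow_ne_zero _ (tr_ne_zero _ _))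
  have key : ∀ x, ∃ w ∈ stalkRing x, w ≠ 0 ∧ w⁻¹ ∈ stalkRing x ∧
      pullK φ ((dataOf L hk).τ (φ x)) = w * ((dataOf L hk).τ x ^ d * C) := by
    intro x
    obtain ⟨c, hc⟩ := hV x
    have hcg := gen_mem hc
    have h1 := hs c c₀ (hag c x hc) (hag c₀ _ hc₀) hcg hc₀
    refine ⟨pullK φ (tr L (idx L (φ x)) (a c) (gen_mem (mem_U_idx L _)) (hag c x hc)) * S c *
      tr L (b c) (idx L x) (hbg _ hcg) (gen_mem (mem_U_idx L x)) ^ d, ?_, ?_, ?_, ?_⟩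
    · exact mul_mem (mul_mem (pullK_mem φ (tr_mem (mem_U_idx L _) (haφ c x hc))) (hS c x hc))
        (pow_mem (tr_mem (hbg c hc) (mem_U_idx L x)) d)
    · exact mul_ne_zero (mul_ne_zero ((map_ne_zero _).2 (tr_ne_zero _ _)) (hS0 c))
        (pow_ne_zero _ (tr_ne_zero _ _))
    · rw [mul_inv, mul_inv, ← map_inv₀, ← inv_pow, tr_inv, tr_inv]
      exact mul_mem (mul_mem (pullK_mem φ (tr_mem (haφ c x hc) (mem_U_idx L _))) (hS' c x hc))
        (pow_mem (tr_mem (mem_U_idx L x) (hbg c hc)) d)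
    · have h2 : (dataOf L hk).τ (φ x) =
          tr L (idx L (φ x)) (a c) (gen_mem (mem_U_idx L _)) (hag c x hc) *
          tr L (a c) (a c₀) (hag c x hc) (hag c₀ _ hc₀) *
          tr L (a c₀) (idx₀ L) (hag _ _ hc₀) (mem_U_idx₀ L) := by
        rw [tr_mul_tr, tr_mul_tr]; rfl
      have h3 : tr L (b c) (b c₀) (hbg _ hcg) (hbg _ hc₀) =
          tr L (b c) (idx L x) (hbg _ hcg) (gen_mem (mem_U_idx L x)) * (dataOf L hk).τ x *
          tr L (idx₀ L) (b c₀) (mem_U_idx₀ L) (hbg _ hc₀) := by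
        rw [dataOf, tr_mul_tr, tr_mul_tr]
      have h4 : pullK φ (tr L (a c) (a c₀) (hag c x hc) (hag c₀ _ hc₀)) =
          S c * tr L (b c) (b c₀) (hbg _ hcg) (hbg _ hc₀) ^ d * (S c₀)⁻¹ :=
        (eq_mul_inv_iff_mul_eq₀ (hS0 c₀)).2 h1
      rw [h2, map_mul, map_mul, h4, h3]
      simp only [C]
      ring
  refine ⟨{ σ := pullKAlg hk φ hφ
            φ := φ
            map_O := fun x a ha => pullK_mem φ ha
            inv_mem := fun x a ha h => inv_mem_of_pullK_inv_mem φ ha h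
            c := C
            c_ne := hC
            mem_O := fun x => ?_
            inv_mem_O := fun x => ?_ }, rfl, rfl⟩
  · obtain ⟨w, hw, hw0, hw', hwx⟩ := key x
    change _ / pullK φ _ ∈ stalkRing x
    have h0 := mul_ne_zero (pow_ne_zero d ((dataOf L hk).τ_ne x)) hC
    rwa [hwx, div_mul_cancel_right₀ h0]
  · obtain ⟨w, hw, hw0, hw', hwx⟩ := key x
    change pullK φ _ / _ ∈ stalkRing x
    have h0 := mul_ne_zero (pow_ne_zero d ((dataOf L hk).τ_ne x)) hC
    rwa [hwx, mul_div_cancel_right₀ _ h0]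

end

section

variable {k : Type u} [Field k] {X : Scheme.{u}} [IsIntegral X] {sX : X ⟶ Spec (CommRingCat.of k)}
  [Algebra k X.functionField]

lemma isFractionRing_regMap_target (D : SecData k X.functionField X) (hk : Compat sX)
    (hD : D.O = stalkAlg hk) {d : ℕ} (E : D.Endo d) {φ : X ⟶ X} [UniversallyOpen φ]
    [IsAffineHom φ] (hEφ : E.φ = φ) {f : X.functionField} (hf : f ∈ D.sec 1) {U : X.Opens}
    (hU : ∀ x, x ∈ U ↔ x ∈ D.loc f) (h : genericPoint X ∈ U) (hUa : IsAffineOpen U) :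
    IsFractionRing ((D.pow d).reg ((D.pow d).loc (E.c * E.σ f))) X.functionField :=
  isFractionRing_reg (D.pow d) hk hD _ (φ ⁻¹ᵁ U)
    (fun x => by rw [E.mem_loc hf, hEφ]; exact hU (φ x)) (mem_preimage_gen φ h) (hUa.preimage φ)

lemma regMap_flat_finite_formallyUnramified (D : SecData k X.functionField X) (hk : Compat sX)
    (hD : D.O = stalkAlg hk) {d : ℕ} (E : D.Endo d) {φ : X ⟶ X} [Etale φ] [IsFinite φ]
    (hEσ : ∀ a, E.σ a = pullK φ a) (hEφ : E.φ = φ) {f : X.functionField} (hf : f ∈ D.sec 1)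
    {U : X.Opens} (hU : ∀ x, x ∈ U ↔ x ∈ D.loc f) (h : genericPoint X ∈ U)
    (hUa : IsAffineOpen U) :
    (E.regMap hf).toRingHom.Flat ∧ (E.regMap hf).toRingHom.Finite ∧
      (E.regMap hf).toRingHom.FormallyUnramified := by
  have hU' : ∀ x, x ∈ φ ⁻¹ᵁ U ↔ x ∈ (D.pow d).loc (E.c * E.σ f) := fun x => by
    rw [E.mem_loc hf, hEφ]
    exact hU (φ x)
  let e₁ := regEquiv D hk hD _ U hU h
  let e₂ := regEquiv (D.pow d) hk hD _ (φ ⁻¹ᵁ U) hU' (mem_preimage_gen φ h)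
  have hcomp : (E.regMap hf).toRingHom =
      (e₂.toRingHom.comp (φ.app U).hom).comp e₁.symm.toRingHom := by
    ext a
    obtain ⟨s, rfl⟩ := e₁.surjective a
    change E.σ (toK U h s) = toK _ _ (φ.app U (e₁.symm (e₁ s)))
    rw [hEσ, e₁.symm_apply_apply, pullK_toK φ h (mem_preimage_gen φ h)]
  have het : (φ.app U).hom.Etale := by
    rw [Scheme.Hom.app_eq_appLE]
    exact φ.etale_appLE hUa (hUa.preimage φ) le_rfl
  obtain ⟨h1, h2, -⟩ := RingHom.Etale.iff_flat_and_formallyUnramified.1 het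
  rw [hcomp]
  exact ⟨RingHom.Flat.respectsIso.2 _ e₁.symm (RingHom.Flat.respectsIso.1 _ e₂ h1),
    RingHom.finite_respectsIso.2 _ e₁.symm (RingHom.finite_respectsIso.1 _ e₂
      (φ.finite_app U hUa)),
    RingHom.FormallyUnramified.respectsIso.2 _ e₁.symm
      (RingHom.FormallyUnramified.respectsIso.1 _ e₂ h2)⟩

omit [IsIntegral X] in
lemma secData_pow_pow {K : Type*} [Field K] [Algebra k K] {S : Type*} (D : SecData k K S)
    (m n : ℕ) : (D.pow m).pow n = D.pow (m * n) := by
  rw [SecData.mk.injEq]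
  exact ⟨rfl, funext fun x => (pow_mul (D.τ x) m n).symm⟩

/-- Sections of one power of an ample bundle with affine loci covering the variety. -/
lemma exists_gen_of_isAmple (hk : Compat sX) {L : LineBundle X} (hL : L.IsAmple) :
    ∃ (e : ℕ) (_ : 0 < e) (s : ℕ) (f : Fin s → X.functionField) (U : Fin s → X.Opens),
      ((dataOf L hk).pow e).Gen f ∧ (∀ i, genericPoint X ∈ U i) ∧ (∀ i, IsAffineOpen (U i)) ∧
      (∀ x, ∃ i, x ∈ U i) ∧ ∀ i x, x ∈ U i ↔ x ∈ ((dataOf L hk).pow e).loc (f i) := by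
  obtain ⟨_, hA⟩ := hL
  choose m hm σ hxσ hσ using hA
  obtain ⟨t, ht⟩ := CompactSpace.elim_nhds_subcover (fun x => ((σ x).locus : Set X))
    fun x => (σ x).locus.isOpen.mem_nhds (hxσ x)
  let e := ∏ x ∈ t, m x
  have he : 0 < e := Finset.prod_pos fun x _ => hm x
  have hdiv : ∀ x ∈ t, m x * (e / m x) = e := fun x hx =>
    Nat.mul_div_cancel' (Finset.dvd_prod_of_mem m hx)
  have hq' : ∀ x ∈ t, 0 < e / m x := fun x hx =>
    Nat.pos_of_mul_pos_left (by rw [hdiv x hx]; exact he)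
  let z : Fin t.card → X := fun i => t.equivFin.symm i
  have hz : ∀ i, z i ∈ t := fun i => (t.equivFin.symm i).2
  have hq : ∀ i, 0 < e / m (z i) := fun i => hq' _ (hz i)
  have hcov : ∀ x, ∃ i, x ∈ (σ (z i)).locus := by
    intro x
    obtain ⟨y, hy, hxy⟩ := Set.mem_iUnion₂.1 (ht.ge (Set.mem_univ x))
    refine ⟨t.equivFin ⟨y, hy⟩, ?_⟩
    have hzy : z (t.equivFin ⟨y, hy⟩) = y := by simp [z]
    rwa [hzy]
  have hne : ∀ i, val (σ (z i)) ≠ 0 := fun i => val_ne_zero_of_mem _ (hxσ (z i))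
  have hloc : ∀ i x, x ∈ (σ (z i)).locus ↔
      x ∈ ((dataOf L hk).pow e).loc (val (σ (z i)) ^ (e / m (z i))) := by
    intro i x
    have h1 := val_mem hk (σ (z i))
    rw [dataOf_pow] at h1
    rw [mem_locus_iff hk _ (hne i), dataOf_pow, ← hdiv _ (hz i), ← secData_pow_pow,
      Nat.mul_div_cancel_left _ (hm _), SecData.loc_pow h1 (hq i)]
  refine ⟨e, he, t.card, fun i => val (σ (z i)) ^ (e / m (z i)), fun i => (σ (z i)).locus,
    ⟨fun i => pow_ne_zero _ (hne i), fun i => ?_, fun x => ?_⟩, fun i => gen_mem (hxσ (z i)),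
    fun i => hσ _, hcov, hloc⟩
  · have h1 := val_mem hk (σ (z i))
    rw [dataOf_pow] at h1
    have h2 := SecData.pow_mem_sec h1 (e / m (z i))
    rw [SecData.pow_sec, hdiv _ (hz i)] at h2
    rwa [SecData.pow_sec, mul_one]
  · obtain ⟨i, hi⟩ := hcov x
    exact ⟨i, (hloc i x).1 hi⟩

end

end RatSec

/-- Let `X` be a smooth projective variety of dimension `g` over an
algebraically closed field, `φ : X → X` an étale morphism and `L` an ample line bundle with
`φ*(L) ≅ L^{⊗d}`, `d > 1`. Then the Hilbert polynomial `P(L, x)` satisfies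
`P(L, dx) = d^g · P(L, x)`, and hence `P(L, x) = P(L, 1) · x^g`. -/
theorem stmt_10 {k : Type u} [Field k] [IsAlgClosed k] {X : Scheme.{u}} [IsIntegral X]
    (sX : X ⟶ Spec (CommRingCat.of k)) (hX : IsProjectiveVariety sX) (hsm : IsSmooth sX)
    (g : ℕ) (hdim : topologicalKrullDim X = (g : ℕ∞))
    (φ : X ⟶ X) (hφ : φ ≫ sX = sX) (hetale : IsEtale φ)
    (L : LineBundle X) (hL : L.IsAmple) (d : ℕ) (hd : 1 < d)
    (hpull : (LineBundle.pullbackLB φ L).EquivLB (L.pow d)) :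
    ∀ P : Polynomial ℚ, IsHilbertPoly sX L P →
      P.comp (Polynomial.C (d : ℚ) * Polynomial.X) = Polynomial.C ((d : ℚ) ^ g) * P ∧
      P = Polynomial.C (P.eval 1) * Polynomial.X ^ g := by
  intro P hP
  have hproper := RatSec.isProper_of_isProjectiveVariety hX
  have : Etale φ := hetale
  have := RatSec.isFinite_of_etale hφ
  let _ : Algebra k X.functionField :=
    ((RatSec.toK ⊤ trivial).comp (LineBundle.toSections sX ⊤)).toAlgebra
  have hk : RatSec.Compat sX := fun _ => rfl
  have : CompactSpace X := hL.1
  obtain ⟨E, hEσ, hEφ⟩ := RatSec.exists_endo hk φ hφ L d hpull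
  obtain ⟨e, he, s, f, U, hf, hUg, hUa, hUc, hU⟩ := RatSec.exists_gen_of_isAmple hk hL
  have hD : ((RatSec.dataOf L hk).pow e).Proper := by
    rw [← RatSec.dataOf_pow]
    exact RatSec.proper hk
  have hEσ' : ∀ a, (E.pow e).σ a = RatSec.pullK φ a := fun a => congrArg (· a) hEσ
  have hQ : ∀ᶠ n : ℕ in Filter.atTop,
      (P.comp (Polynomial.C (e : ℚ) * Polynomial.X)).eval (n : ℚ) =
        Module.finrank k (((RatSec.dataOf L hk).pow e).sec n) := by
    obtain ⟨n₀, hn₀⟩ := hP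
    filter_upwards [Filter.eventually_ge_atTop n₀] with n hn
    have h1 := hn₀ (e * n) (hn.trans (Nat.le_mul_of_pos_left n he))
    rw [RatSec.h0_eq hk, RatSec.dataOf_pow, SecData.pow_sec, mul_one] at h1
    rw [SecData.pow_sec, ← h1]
    simp
  obtain ⟨m, hg, -, hQm⟩ := SecData.Endo.exists_eq_C_mul_X_pow hD hf
    (fun i => RatSec.fg_reg _ hk rfl _ (U i) (hU i) (hUg i) (hUa i))
    (fun n y hy hy0 a ha => by
      rw [SecData.pow_sec] at hy
      rw [RatSec.secData_pow_pow] at ha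
      obtain ⟨r, hr⟩ := RatSec.exists_mul_pow_mem_sec hk (e * n) hy hy0 ha
      refine ⟨r, ?_⟩
      rwa [SecData.pow_sec, ← mul_assoc])
    (fun i => RatSec.isFractionRing_reg _ hk rfl _ (U i) (hU i) (hUg i) (hUa i)) hd (E.pow e)
    (fun i => RatSec.isFractionRing_regMap_target _ hk rfl (E.pow e) hEφ (hf.mem i) (hU i) (hUg i)
      (hUa i))
    (fun i => RatSec.regMap_flat_finite_formallyUnramified _ hk rfl (E.pow e) hEσ' hEφ (hf.mem i)
      (hU i) (hUg i) (hUa i)) hQ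
  have hm : m = g := by
    have h1 : topologicalKrullDim X = (m : WithBot ℕ∞) :=
      topologicalKrullDim_eq_of_cover U hUc fun i => by
        obtain ⟨ψ, hψ, hψ'⟩ := hg i
        refine (hUa i).topologicalKrullDim_eq.trans ?_
        rw [ringKrullDim_eq_of_ringEquiv
          (RatSec.regEquiv ((RatSec.dataOf L hk).pow e) hk rfl _ (U i) (hU i) (hUg i))]
        exact ringKrullDim_eq_of_finite_injective ψ hψ hψ'
    have h2 := h1.symm.trans hdim
    exact_mod_cast h2
  subst hm
  have hPm := Polynomial.eq_of_comp_eq he hQm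
  refine ⟨?_, hPm⟩
  conv_lhs => rw [hPm]
  conv_rhs => rw [hPm]
  simp only [Polynomial.mul_comp, Polynomial.C_comp, Polynomial.X_pow_comp, mul_pow,
    Polynomial.C_pow]
  ring
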